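/- Let p be a prime and k a field of characteristic p with [k:k^p] = p such that for every finite field extension l/k the p-primary torsion subgroup of Br(l) is trivial. Let F = k((π)) be the field of formal Laurent series over k, and let D be a central division F-algebra of period p^n. Then deg(D) = p^n, and there exists a tower of field extensions F = E_0 ⊂ E_1 ⊂ ⋯ ⊂ E_n with [E_i : E_{i−1}] = p for each i, such that E_n splits D (i.e. D ⊗_F E_n ≅ M_{p^n}(E_n)) and, equipping each E_i with the unique extension of the π-adic valuation, each residue field extension l_i/l_{i−1} has degree p and is either an Artin–Schreier extension or a purely inseparable extension; in particular the residue field of E_n has degree p^n over k. -/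

import Mathlib

open scoped TensorProduct

noncomputable section

/-- `A` is a central simple algebra over the field `K`: it is a finite-dimensional
associative unital `K`-algebra which is simple and has center exactly `K`. -/
def IsCSA (K A : Type) [Field K] [Ring A] [Algebra K A] : Prop :=
  Subalgebra.center K A = ⊥ ∧ IsSimpleRing A ∧ FiniteDimensional K A

/-- `A` is split over `K`, i.e. isomorphic to a matrix algebra over `K`;
equivalently, its Brauer class is trivial (its index is `1`). -/
def IsSplit (K A : Type) [Field K] [Ring A] [Algebra K A] : Prop :=
  ∃ n : ℕ, 0 < n ∧ Nonempty (A ≃ₐ[K] Matrix (Fin n) (Fin n) K)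

/-- `A` and `B` are Brauer (Morita) equivalent over `K`:
`M_n(A) ≅ M_m(B)` for some `n, m > 0`. -/
def BrEquiv (K A B : Type) [Field K] [Ring A] [Algebra K A] [Ring B] [Algebra K B] : Prop :=
  ∃ n m : ℕ, 0 < n ∧ 0 < m ∧
    Nonempty (Matrix (Fin n) (Fin n) A ≃ₐ[K] Matrix (Fin m) (Fin m) B)

/-- The period of (the Brauer class of) `A`: the least `n > 0` such that the `n`-fold
tensor power of `A` over `K` is split. -/
def period (K A : Type) [Field K] [Ring A] [Algebra K A] : ℕ :=
  sInf {n : ℕ | 0 < n ∧ IsSplit K (⨂[K] _ : Fin n, A)}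

/-- The index of (the Brauer class of) `A`: the degree of the division algebra `D`
with `A ≅ M_r(D)` (Artin--Wedderburn), i.e. the square root of `dim_K D`. -/
def index (K A : Type) [Field K] [Ring A] [Algebra K A] : ℕ :=
  sInf {d : ℕ | ∃ (D : Type) (_ : DivisionRing D) (_ : Algebra K D) (r : ℕ), 0 < r ∧
    Nonempty (A ≃ₐ[K] Matrix (Fin r) (Fin r) D) ∧ Module.finrank K D = d ^ 2}

/-- The subfield `k^p` of `p`-th powers of a field `k` (of characteristic `p`). -/
def pthPowers (k : Type) [Field k] (p : ℕ) : Subfield k :=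
  Subfield.closure (Set.range fun x : k => x ^ p)

/-- `[k : k^p]`, the degree of `k` over its subfield of `p`-th powers. -/
def pDegree (k : Type) [Field k] (p : ℕ) : ℕ :=
  Module.finrank (pthPowers k p) k


/-- (Helper instance: the base-field module structure on an intermediate field; this is
defeq to the Mathlib instance but stated so that instance search succeeds over
`LaurentSeries`.) -/
instance intermediateFieldModule {K L : Type} [Field K] [Field L] [Algebra K L]
    (S : IntermediateField K L) : Module K S :=
  inferInstanceAs (Module K S.toSubalgebra)

/-- The residue field extension `l₂/l₁` attached to an inclusion of (valuation) subrings
`O₁ ⊆ O₂` of `L` has degree `p` and is either an Artin–Schreier extension or a purely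
inseparable extension.  The embedding `φ : l₁ → l₂` is required to be compatible with
the inclusion `O₁ ⊆ O₂`. -/
def ResidueStep (p : ℕ) {L : Type} [Field L] (O₁ O₂ : Subring L) : Prop :=
  ∃ (_ : IsLocalRing O₁) (_ : IsLocalRing O₂)
    (φ : IsLocalRing.ResidueField O₁ →+* IsLocalRing.ResidueField O₂),
    (∀ (x : O₁) (y : O₂), (x : L) = (y : L) →
      φ (IsLocalRing.residue _ x) = IsLocalRing.residue _ y) ∧
    (letI := φ.toAlgebra
     Module.finrank (IsLocalRing.ResidueField O₁) (IsLocalRing.ResidueField O₂) = p) ∧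
    ((∀ x : IsLocalRing.ResidueField O₂, x ^ p ∈ φ.range) ∨
     (∃ α : IsLocalRing.ResidueField O₂, α ∉ φ.range ∧ α ^ p - α ∈ φ.range))

noncomputable section

theorem csa_tensor_injective {F A E R : Type} [Field F] [Ring A] [Algebra F A] [Field E]
    [Algebra F E] [Ring R] [Nontrivial R]
    (hA : IsCSA F A) (g : E ⊗[F] A →+* R) : Function.Injective g := by
  obtain ⟨hc, hs, hf⟩ := hA
  let b := Module.Basis.ofVectorSpace F E
  have key : ∀ (s : Finset (Module.Basis.ofVectorSpaceIndex F E)) (a : (Module.Basis.ofVectorSpaceIndex F E) → A),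
      ∑ i ∈ s, g (b i ⊗ₜ a i) = 0 → ∀ i ∈ s, a i = 0 := by
    classical
    intro s
    induction s using Finset.induction_on with
    | empty => simp
    | insert i0 s hi0 ih =>
      intro a ha
      let J : TwoSidedIdeal A := TwoSidedIdeal.mk'
        {y | ∃ a : (Module.Basis.ofVectorSpaceIndex F E) → A, ∑ i ∈ insert i0 s, g (b i ⊗ₜ a i) = 0 ∧ a i0 = y}
        ⟨0, by simp⟩
        (by
          rintro x y ⟨a, ha, rfl⟩ ⟨a', ha', rfl⟩
          refine ⟨a + a', ?_, rfl⟩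
          simp only [Pi.add_apply, TensorProduct.tmul_add, map_add, Finset.sum_add_distrib, ha, ha', add_zero])
        (by
          rintro x ⟨a, ha, rfl⟩
          refine ⟨-a, ?_, rfl⟩
          simp only [Pi.neg_apply, TensorProduct.tmul_neg, map_neg, Finset.sum_neg_distrib, ha, neg_zero])
        (by
          rintro x y ⟨a, ha, rfl⟩
          refine ⟨fun i => x * a i, ?_, rfl⟩
          have : ∀ i, g (b i ⊗ₜ (x * a i)) = g (1 ⊗ₜ x) * g (b i ⊗ₜ a i) := by
            intro i; rw [← map_mul]; simp
          simp only [this, ← Finset.mul_sum, ha, mul_zero])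
        (by
          rintro y x ⟨a, ha, rfl⟩
          refine ⟨fun i => a i * x, ?_, rfl⟩
          have : ∀ i, g (b i ⊗ₜ (a i * x)) = g (b i ⊗ₜ a i) * g (1 ⊗ₜ x)  := by
            intro i; rw [← map_mul]; simp
          simp only [this, ← Finset.sum_mul, ha, zero_mul])
      have hJ : ∀ y, y ∈ J ↔ ∃ a : (Module.Basis.ofVectorSpaceIndex F E) → A, ∑ i ∈ insert i0 s, g (b i ⊗ₜ a i) = 0 ∧ a i0 = y := by
        intro y
        exact TwoSidedIdeal.mem_mk' _ _ _ _ _ _ y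
      have hJtop : J ≠ ⊤ := by
        intro htop
        have h1 : (1 : A) ∈ J := by rw [htop]; trivial
        obtain ⟨a', ha', h1'⟩ := (hJ 1).1 h1
        have hcomm : ∀ i ∈ s, ∀ x, x * a' i = a' i * x := by
          intro i hi x
          have := ih (fun i => x * a' i - a' i * x) (by
            have e1 : ∀ i, g (b i ⊗ₜ (x * a' i - a' i * x)) = g (1 ⊗ₜ x) * g (b i ⊗ₜ a' i) - g (b i ⊗ₜ a' i) * g (1 ⊗ₜ x) := by
              intro i; rw [← map_mul, ← map_mul, ← map_sub]; simp [TensorProduct.tmul_sub]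
            simp only [e1, Finset.sum_sub_distrib, ← Finset.mul_sum, ← Finset.sum_mul]
            rw [Finset.sum_insert hi0] at ha'
            rw [eq_neg_of_add_eq_zero_right ha', h1', mul_neg, neg_mul, ← map_mul, ← map_mul]
            simp) i hi
          exact sub_eq_zero.1 this
        have hcen : ∀ i ∈ insert i0 s, ∃ c : F, a' i = algebraMap F A c := by
          intro i hi
          have : a' i ∈ Subalgebra.center F A := by
            rw [Subalgebra.mem_center_iff]
            rcases Finset.mem_insert.1 hi with rfl | hi
            · simp [h1']
            · exact hcomm i hi
          rw [hc] at this
          obtain ⟨c, hc⟩ := Algebra.mem_bot.1 this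
          exact ⟨c, hc.symm⟩
        choose! c hc' using hcen
        have hz : ∑ i ∈ insert i0 s, g (b i ⊗ₜ a' i) = g ((∑ i ∈ insert i0 s, c i • b i) ⊗ₜ 1) := by
          rw [TensorProduct.sum_tmul, map_sum]
          refine Finset.sum_congr rfl fun i hi => ?_
          rw [hc' i hi, Algebra.algebraMap_eq_smul_one, TensorProduct.tmul_smul, TensorProduct.smul_tmul']
        rw [ha'] at hz
        have hz2 : (∑ i ∈ insert i0 s, c i • b i) = 0 := by
          let h : E →+* R := g.comp (Algebra.TensorProduct.includeLeftRingHom)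
          have : h (∑ i ∈ insert i0 s, c i • b i) = 0 := by
            simp only [h, RingHom.comp_apply]; exact hz.symm
          exact (map_eq_zero h).1 this
        have := (linearIndependent_iff'.1 b.linearIndependent) _ c hz2 i0 (Finset.mem_insert_self _ _)
        have h2 := hc' i0 (Finset.mem_insert_self _ _)
        rw [this, h1', map_zero] at h2
        exact one_ne_zero h2
      have hJbot : J = ⊥ := (eq_bot_or_eq_top J).resolve_right hJtop
      have h0 : a i0 = 0 := by
        have : a i0 ∈ J := (hJ _).2 ⟨a, ha, rfl⟩
        rw [hJbot] at this
        simpa using this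
      intro i hi
      rcases Finset.mem_insert.1 hi with rfl | hi
      · exact h0
      · rw [Finset.sum_insert hi0, h0] at ha
        exact ih a (by simpa using ha) i hi
  rw [injective_iff_map_eq_zero]
  intro z hz
  have gen : ∀ z : E ⊗[F] A, ∃ a : (Module.Basis.ofVectorSpaceIndex F E) →₀ A,
      z = a.sum (fun i x => b i ⊗ₜ x) := by
    intro z
    classical
    induction z using TensorProduct.induction_on with
    | zero => exact ⟨0, by simp⟩
    | tmul x y =>
      refine ⟨(b.repr x).mapRange (fun c => c • y) (by simp), ?_⟩
      rw [Finsupp.sum_mapRange_index (by simp)]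
      conv_lhs => rw [← b.linearCombination_repr x, Finsupp.linearCombination_apply,
        Finsupp.sum, TensorProduct.sum_tmul]
      simp [Finsupp.sum, TensorProduct.smul_tmul]
    | add x y hx hy =>
      obtain ⟨a, rfl⟩ := hx
      obtain ⟨a', rfl⟩ := hy
      exact ⟨a + a', (Finsupp.sum_add_index' (by simp) (by simp [TensorProduct.tmul_add])).symm⟩
  obtain ⟨a, rfl⟩ := gen z
  have := key a.support a (by simpa [Finsupp.sum] using hz)
  have ha : a = 0 := by
    ext i
    by_cases hi : i ∈ a.support
    · exact this i hi
    · simpa using hi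
  simp [ha]

theorem exists_functional_one (F E : Type) [Field F] [Ring E] [Nontrivial E] [Algebra F E] :
    ∃ l : E →ₗ[F] F, l 1 = 1 := by
  obtain ⟨l, hl⟩ := LinearMap.exists_leftInverse_of_injective (Algebra.linearMap F E)
    (LinearMap.ker_eq_bot.2 (algebraMap F E).injective)
  exact ⟨l, by simpa using LinearMap.congr_fun hl 1⟩

theorem simple_of_hom {A : Type} [Ring A] [Nontrivial A]
    (h : ∀ (I : TwoSidedIdeal A), Nontrivial I.ringCon.Quotient →
      Function.Injective I.ringCon.mk') : IsSimpleRing A := by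
  refine IsSimpleRing.of_eq_bot_or_eq_top fun I => ?_
  rcases subsingleton_or_nontrivial I.ringCon.Quotient with hq | hq
  · right
    exact le_antisymm le_top fun x _ => I.mem_iff _ |>.2 (Quotient.eq'.1 (hq.elim x 0))
  · left
    rw [← TwoSidedIdeal.ker_ringCon_mk' I, TwoSidedIdeal.ker_eq_bot]
    exact h I hq

theorem csa_tensor_simple {F A : Type} (E : Type) [Field F] [Ring A] [Algebra F A] [Field E]
    [Algebra F E] (hA : IsCSA F A) : IsSimpleRing (E ⊗[F] A) := by
  have := hA.2.1
  exact simple_of_hom fun I _ => csa_tensor_injective hA I.ringCon.mk'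

/-- Scalar extension of an algebra map. -/
abbrev extMap {F A : Type} {E R : Type} [Field F] [Ring A] [Algebra F A] [Field E]
    [Algebra F E] [Ring R] [Algebra F R] [Algebra E R] [IsScalarTower F E R]
    (τ : A →ₐ[F] R) : E ⊗[F] A →ₐ[E] R :=
  AlgHom.liftEquiv F E A R τ

theorem extMap_tmul {F A : Type} {E R : Type} [Field F] [Ring A] [Algebra F A] [Field E]
    [Algebra F E] [Ring R] [Algebra F R] [Algebra E R] [IsScalarTower F E R]
    (τ : A →ₐ[F] R) (e : E) (a : A) : extMap τ (e ⊗ₜ[F] a) = e • τ a := by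
  simp [extMap, AlgHom.liftEquiv]

theorem csa_ext_bijective {F A : Type} {E R : Type} [Field F] [Ring A] [Algebra F A] [Field E]
    [Algebra F E] [Ring R] [Nontrivial R] [Algebra F R] [Algebra E R] [IsScalarTower F E R]
    [FiniteDimensional E R]
    (hA : IsCSA F A) (τ : A →ₐ[F] R) (hd : Module.finrank F A = Module.finrank E R) :
    Function.Bijective (extMap (E := E) τ) := by
  have := hA.2.2
  have hinj : Function.Injective (extMap (E := E) τ) :=
    csa_tensor_injective hA (extMap (E := E) τ).toRingHom
  refine ⟨hinj, ?_⟩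
  exact (LinearMap.injective_iff_surjective_of_finrank_eq_finrank
    (f := (extMap (E := E) τ).toLinearMap) (by rw [Module.finrank_baseChange, hd])).1 hinj

theorem csa_of_ext_bijective {F A : Type} {E ι : Type} [Field F] [Ring A] [Algebra F A] [Field E]
    [Algebra F E] [Fintype ι] [DecidableEq ι] [Nonempty ι]
    (τ : A →ₐ[F] Matrix ι ι E) (hb : Function.Bijective (extMap (E := E) τ)) : IsCSA F A := by
  let e : E ⊗[F] A ≃ₐ[E] Matrix ι ι E := AlgEquiv.ofBijective _ hb
  have hs : IsSimpleRing (E ⊗[F] A) := IsSimpleRing.of_ringEquiv e.symm.toRingEquiv inferInstance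
  have hfr : Module.finrank F A = Fintype.card ι * Fintype.card ι := by
    rw [← Module.finrank_baseChange (R := E), e.toLinearEquiv.finrank_eq, Module.finrank_matrix]
    simp
  have hfd : FiniteDimensional F A := by
    apply Module.finite_of_finrank_pos
    rw [hfr]
    have : 0 < Fintype.card ι := Fintype.card_pos
    positivity
  have hnt : Nontrivial A := by
    apply Module.nontrivial_of_finrank_pos (R := F)
    rw [hfr]
    have : 0 < Fintype.card ι := Fintype.card_pos
    positivity
  refine ⟨?_, ?_, hfd⟩
  · rw [eq_bot_iff]
    intro x hx
    rw [Subalgebra.mem_center_iff] at hx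
    have hxc : ∀ y : E ⊗[F] A, y * (1 ⊗ₜ x) = (1 ⊗ₜ x) * y := by
      intro y
      induction y using TensorProduct.induction_on with
      | zero => simp
      | tmul a b => simp [hx b]
      | add a b ha hb => rw [add_mul, mul_add, ha, hb]
    have hxc2 : e (1 ⊗ₜ x) ∈ Subalgebra.center E (Matrix ι ι E) := by
      rw [Subalgebra.mem_center_iff]
      intro y
      obtain ⟨y, rfl⟩ := e.surjective y
      rw [← map_mul, hxc, map_mul]
    rw [Algebra.IsCentral.center_eq_bot, Algebra.mem_bot] at hxc2
    obtain ⟨c, hc⟩ := hxc2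
    have hc2 : (1 : E) ⊗ₜ[F] x = c ⊗ₜ 1 := by
      apply e.injective
      rw [← hc, ← e.commutes]; rfl
    obtain ⟨l, hl⟩ := exists_functional_one F E
    let L : E ⊗[F] A →ₗ[F] A := TensorProduct.lift
      ((LinearMap.lsmul F A).comp l)
    have := congrArg L hc2
    simp only [L, TensorProduct.lift.tmul, LinearMap.comp_apply, LinearMap.lsmul_apply, hl,
      one_smul] at this
    exact Algebra.mem_bot.2 ⟨l c, by rw [this, Algebra.algebraMap_eq_smul_one]⟩
  · refine simple_of_hom fun I hI => ?_
    let q : A →ₐ[F] I.ringCon.Quotient := { I.ringCon.mk' with commutes' := fun r => rfl }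
    have hin := RingHom.injective (Algebra.TensorProduct.map (AlgHom.id E E) q).toRingHom
    intro a b hab
    have h1 : (1 : E) ⊗ₜ[F] a = 1 ⊗ₜ b := by
      apply hin
      change (Algebra.TensorProduct.map (AlgHom.id E E) q) _ =
        (Algebra.TensorProduct.map (AlgHom.id E E) q) _
      rw [Algebra.TensorProduct.map_tmul, Algebra.TensorProduct.map_tmul]
      congr 1
    exact Algebra.TensorProduct.includeRight_injective (algebraMap F E).injective h1

theorem csa_exists_form {F A : Type} [Field F] [Ring A] [Algebra F A] (hA : IsCSA F A) :
    ∃ d : ℕ, 0 < d ∧ Module.finrank F A = d ^ 2 ∧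
      Nonempty (A →ₐ[F] Matrix (Fin d) (Fin d) (AlgebraicClosure F)) := by
  have := csa_tensor_simple (AlgebraicClosure F) hA
  have := hA.2.2
  obtain ⟨n, hn, ⟨e⟩⟩ := IsSimpleRing.exists_algEquiv_matrix_of_isAlgClosed
    (AlgebraicClosure F) (AlgebraicClosure F ⊗[F] A)
  refine ⟨n, Nat.pos_of_ne_zero hn.1, ?_, ⟨(e.toAlgHom.restrictScalars F).comp
    Algebra.TensorProduct.includeRight⟩⟩
  rw [← Module.finrank_baseChange (R := AlgebraicClosure F), e.toLinearEquiv.finrank_eq,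
    Module.finrank_matrix]
  simp [sq]

/-- base-change splitting from a homomorphism -/
theorem csa_ext_equiv {F A : Type} {E R : Type} [Field F] [Ring A] [Algebra F A] [Field E]
    [Algebra F E] [Ring R] [Nontrivial R] [Algebra F R] [Algebra E R] [IsScalarTower F E R]
    [FiniteDimensional E R]
    (hA : IsCSA F A) (τ : A →ₐ[F] R) (hd : Module.finrank F A = Module.finrank E R) :
    Nonempty (E ⊗[F] A ≃ₐ[E] R) :=
  ⟨AlgEquiv.ofBijective _ (csa_ext_bijective hA τ hd)⟩

theorem csa_equiv {F A R : Type} [Field F] [Ring A] [Algebra F A] [Ring R] [Nontrivial R]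
    [Algebra F R] [FiniteDimensional F R]
    (hA : IsCSA F A) (τ : A →ₐ[F] R) (hd : Module.finrank F A = Module.finrank F R) :
    Nonempty (A ≃ₐ[F] R) := by
  obtain ⟨e⟩ := csa_ext_equiv (E := F) hA τ hd
  exact ⟨(Algebra.TensorProduct.lid F A).symm.trans e⟩

theorem finrank_matrix_self {E ι : Type} [Field E] [Fintype ι] :
    Module.finrank E (Matrix ι ι E) = Fintype.card ι ^ 2 := by
  rw [Module.finrank_matrix]; simp [sq]

/-- `A` (of dimension `d^2`) is split by `E`, expressed by homomorphisms. -/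
def SplitBy (F E A : Type) [Field F] [Field E] [Algebra F E] [Ring A] [Algebra F A]
    (d : ℕ) : Prop := Nonempty (A →ₐ[F] Matrix (Fin d) (Fin d) E)

theorem IsSplit.splitBy {F A : Type} [Field F] [Ring A] [Algebra F A] {d : ℕ}
    (h : IsSplit F A) (hd : Module.finrank F A = d ^ 2) : SplitBy F F A d := by
  obtain ⟨n, hn, ⟨e⟩⟩ := h
  have h1 := e.toLinearEquiv.finrank_eq
  rw [hd, finrank_matrix_self, Fintype.card_fin] at h1
  obtain rfl : d = n := by simpa using h1
  exact ⟨e.toAlgHom⟩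

theorem SplitBy.isSplit {F A : Type} [Field F] [Ring A] [Algebra F A] {d : ℕ} (hd0 : 0 < d)
    (hA : IsCSA F A) (h : SplitBy F F A d) (hd : Module.finrank F A = d ^ 2) : IsSplit F A := by
  obtain ⟨τ⟩ := h
  have : NeZero d := ⟨hd0.ne'⟩
  exact ⟨d, hd0, csa_equiv hA τ (by rw [hd, finrank_matrix_self, Fintype.card_fin])⟩

theorem splitBy_of_module {F E A W : Type} [Field F] [Field E] [Algebra F E] [Ring A] [Algebra F A]
    [AddCommGroup W] [Module E W] [Module F W] [IsScalarTower F E W] {d : ℕ} (hd0 : 0 < d)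
    (hW : Module.finrank E W = d)
    (f : A →ₐ[F] Module.End E W) : SplitBy F E A d := by
  have : FiniteDimensional E W := Module.finite_of_finrank_pos (by omega)
  let b := Module.finBasisOfFinrankEq E W hW
  exact ⟨((algEquivMatrix b).toAlgHom.restrictScalars F).comp f⟩

end

noncomputable section

section kpr
variable {E : Type} [Field E] {ι : Type} [Fintype ι] [DecidableEq ι]

/-- Kronecker product of a family of matrices. -/
def kpr {a b : Type} (X : ι → Matrix a b E) : Matrix (ι → a) (ι → b) E :=
  Matrix.of fun w w' => ∏ i, X i (w i) (w' i)

theorem kpr_apply {a b : Type} (X : ι → Matrix a b E) (w : ι → a) (w' : ι → b) :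
    kpr X w w' = ∏ i, X i (w i) (w' i) := rfl

theorem kpr_mul {a b c : Type} [Fintype b] (X : ι → Matrix a b E)
    (Y : ι → Matrix b c E) : kpr X * kpr Y = kpr (fun i => X i * Y i) := by
  ext w w'
  simp only [Matrix.mul_apply, kpr_apply, ← Finset.prod_mul_distrib]
  rw [Finset.prod_univ_sum]
  simp

theorem kpr_one {a : Type} [DecidableEq a] : kpr (fun _ : ι => (1 : Matrix a a E)) = 1 := by
  ext w w'
  simp only [kpr_apply, Matrix.one_apply]
  by_cases h : w = w'
  · simp [h]
  · rw [if_neg h]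
    obtain ⟨i, hi⟩ := Function.ne_iff.1 h
    exact Finset.prod_eq_zero (Finset.mem_univ i) (by simp [hi])

/-- The Kronecker product as a multilinear map. -/
def kprM (E ι a : Type) [Field E] [Fintype ι] :
    MultilinearMap E (fun _ : ι => Matrix a a E) (Matrix (ι → a) (ι → a) E) where
  toFun := kpr
  map_update_add' m i x y := by
    ext w w'
    have := ((MultilinearMap.mkPiAlgebra E ι E).compLinearMap
      (fun i => Matrix.entryLinearMap E E (w i) (w' i))).map_update_add m i x y
    exact this
  map_update_smul' m i c x := by
    ext w w'
    have := ((MultilinearMap.mkPiAlgebra E ι E).compLinearMap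
      (fun i => Matrix.entryLinearMap E E (w i) (w' i))).map_update_smul m i c x
    exact this

theorem kprM_apply {a : Type} (X : ι → Matrix a a E) : kprM E ι a X = kpr X := rfl

theorem kpr_single {a b : Type} [DecidableEq a] [DecidableEq b] (w : ι → a) (w' : ι → b) :
    kpr (fun i => Matrix.single (w i) (w' i) (1 : E)) = Matrix.single w w' 1 := by
  ext v v'
  simp only [kpr_apply, Matrix.single_apply]
  by_cases h : w = v ∧ w' = v'
  · obtain ⟨rfl, rfl⟩ := h; simp
  · rw [if_neg h]
    rw [not_and_or, ← ne_eq, ← ne_eq, Function.ne_iff, Function.ne_iff] at h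
    rcases h with ⟨i, hi⟩ | ⟨i, hi⟩
    · exact Finset.prod_eq_zero (Finset.mem_univ i) (by simp [hi])
    · exact Finset.prod_eq_zero (Finset.mem_univ i) (by simp [hi])

variable {F A : Type} [Field F] [Ring A] [Algebra F A] [Algebra F E] {a : Type} [Fintype a]
  [DecidableEq a]

/-- Tensor power of a matrix representation. -/
def kappa (ι : Type) [Fintype ι] [DecidableEq ι] (τ : A →ₐ[F] Matrix a a E) :
    (⨂[F] _ : ι, A) →ₐ[F] Matrix (ι → a) (ι → a) E :=
  PiTensorProduct.liftAlgHom
    (((kprM E ι a).restrictScalars F).compLinearMap (fun _ => τ.toLinearMap))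
    (by
      simp only [MultilinearMap.compLinearMap_apply, AlgHom.toLinearMap_apply, Pi.one_apply, map_one]
      exact kpr_one)
    (by
      intro x y
      simp only [MultilinearMap.compLinearMap_apply, AlgHom.toLinearMap_apply, Pi.mul_apply, map_mul]
      exact (kpr_mul _ _).symm)

theorem kappa_tprod (τ : A →ₐ[F] Matrix a a E) (x : ι → A) :
    kappa ι τ (PiTensorProduct.tprod F x) = kpr (fun i => τ (x i)) := by
  simp [kappa, kprM_apply]

theorem finrank_piTensor (F A : Type) [Field F] [Ring A] [Algebra F A] [FiniteDimensional F A]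
    (ι : Type) [Fintype ι] :
    Module.finrank F (⨂[F] _ : ι, A) = Module.finrank F A ^ Fintype.card ι := by
  classical
  let b := Module.finBasis F A
  rw [Module.finrank_eq_card_basis (Basis.piTensorProduct (fun _ : ι => b))]
  simp

theorem kappa_bijective [Nonempty a] (τ : A →ₐ[F] Matrix a a E) (hA : IsCSA F A)
    (hd : Module.finrank F A = Fintype.card a ^ 2) :
    Function.Bijective (extMap (E := E) (kappa ι τ)) := by
  have := hA.2.2
  have hb := csa_ext_bijective hA τ (by rw [hd, finrank_matrix_self])
  have hsurj : Function.Surjective (extMap (E := E) (kappa ι τ)) := by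
    let b := Module.finBasis F A
    have hspan : ∀ X : Matrix a a E, ∃ c : Fin (Module.finrank F A) → E,
        X = ∑ j, c j • τ (b j) := by
      intro X
      obtain ⟨z, rfl⟩ := hb.2 X
      let bE := b.baseChange E
      refine ⟨fun j => bE.repr z j, ?_⟩
      conv_lhs => rw [← bE.sum_repr z]
      simp only [map_sum, map_smul]
      refine Finset.sum_congr rfl fun j _ => ?_
      simp only [bE, Module.Basis.baseChange_apply]
      rw [extMap_tmul, one_smul]
    choose c hc using hspan
    have hr : ∀ X : ι → Matrix a a E, kpr X ∈ (extMap (E := E) (kappa ι τ)).range := by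
      intro X
      have h1 : X = fun i => ∑ j, c (X i) j • τ (b j) := by ext1 i; exact hc _
      rw [← kprM_apply, h1, MultilinearMap.map_sum]
      refine Subalgebra.sum_mem _ fun r _ => ?_
      rw [MultilinearMap.map_smul_univ]
      refine Subalgebra.smul_mem _ ?_ _
      rw [kprM_apply, ← kappa_tprod]
      exact ⟨1 ⊗ₜ (PiTensorProduct.tprod F fun i => b (r i)), by
        simp only [AlgHom.toRingHom_eq_coe, RingHom.coe_coe]; rw [extMap_tmul, one_smul]⟩
    intro X
    have : X ∈ (extMap (E := E) (kappa ι τ)).range := by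
      rw [Matrix.matrix_eq_sum_single X]
      refine Subalgebra.sum_mem _ fun w _ => Subalgebra.sum_mem _ fun w' _ => ?_
      have : Matrix.single w w' (X w w') = X w w' • Matrix.single w w' (1 : E) := by simp
      rw [this, ← kpr_single]
      exact Subalgebra.smul_mem _ (hr _) _
    exact this
  refine ⟨?_, hsurj⟩
  exact (LinearMap.injective_iff_surjective_of_finrank_eq_finrank
    (f := (extMap (E := E) (kappa ι τ)).toLinearMap) (by
      rw [Module.finrank_baseChange, finrank_piTensor, hd, finrank_matrix_self, Fintype.card_fun]
      rw [← pow_mul, ← pow_mul, mul_comm])).2 hsurj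

end kpr

theorem csa_piTensor {F A : Type} [Field F] [Ring A] [Algebra F A] (hA : IsCSA F A)
    (ι : Type) [Fintype ι] : IsCSA F (⨂[F] _ : ι, A) := by
  classical
  obtain ⟨d, hd0, hd, ⟨τ⟩⟩ := csa_exists_form hA
  have : NeZero d := ⟨hd0.ne'⟩
  exact csa_of_ext_bijective (kappa ι τ) (kappa_bijective τ hA (by simpa using hd))

/-- homomorphism out of a tensor power from a commuting family -/
theorem exists_commLift {F R ι : Type} {A : ι → Type} [Field F] [∀ i, Ring (A i)]
    [∀ i, Algebra F (A i)] [Ring R] [Algebra F R] [Fintype ι] [inst0 : DecidableEq ι]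
    (f : ∀ i, A i →ₐ[F] R) (hf : ∀ i j, i ≠ j → ∀ x y, Commute (f i x) (f j y)) :
    ∃ Φ : (⨂[F] i, A i) →ₐ[F] R, ∀ i (x : A i), Φ (PiTensorProduct.singleAlgHom i x) = f i x := by
  have hcomm : ∀ x : ∀ i, A i,
      (↑(Finset.univ : Finset ι) : Set ι).Pairwise (Function.onFun Commute fun i => f i (x i)) :=
    fun x i _ j _ hij => hf i j hij _ _
  have hcomm2 : ∀ (x y : ∀ i, A i),
      (↑(Finset.univ : Finset ι) : Set ι).Pairwise (fun i j => Commute (f i (y i)) (f j (x j))) :=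
    fun x y i _ j _ hij => hf i j hij _ _
  have hupd : ∀ (m : ∀ i, A i) (i : ι) (x : A i),
      Finset.univ.noncommProd (fun j => f j (Function.update m i x j)) (hcomm _) =
      f i x * (Finset.univ.erase i).noncommProd (fun j => f j (m j))
        (fun i _ j _ hij => hf i j hij _ _) := by
    intro m i x
    rw [← Finset.mul_noncommProd_erase Finset.univ (Finset.mem_univ i) _ (hcomm _)]
    simp only [Function.update_self]
    congr 1
    refine Finset.noncommProd_congr rfl (fun j hj => ?_) _
    rw [Function.update_of_ne (Finset.ne_of_mem_erase hj)]
  let M : MultilinearMap F A R :=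
    { toFun := fun x => Finset.univ.noncommProd (fun i => f i (x i)) (hcomm x)
      map_update_add' := by
        intro dd m i x y
        obtain rfl : dd = inst0 := Subsingleton.elim _ _
        rw [hupd, hupd, hupd, map_add, add_mul]
      map_update_smul' := by
        intro dd m i c x
        obtain rfl : dd = inst0 := Subsingleton.elim _ _
        rw [hupd, hupd, map_smul, smul_mul_assoc] }
  have hM : ∀ x, M x = Finset.univ.noncommProd (fun i => f i (x i)) (hcomm x) := fun _ => rfl
  refine ⟨PiTensorProduct.liftAlgHom M ?_ ?_, ?_⟩
  · rw [hM]
    exact (Finset.noncommProd_eq_pow_card _ _ _ 1 (by simp)).trans (one_pow _)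
  · intro x y
    rw [hM, hM, hM]
    rw [← Finset.noncommProd_mul_distrib (fun i => f i (x i)) (fun i => f i (y i)) (hcomm x) (hcomm y) (hcomm2 x y)]
    refine Finset.noncommProd_congr rfl (fun j hj => by simp) _
  · intro i x
    have : (PiTensorProduct.singleAlgHom (R := F) i x) = PiTensorProduct.tprod F (Pi.mulSingle i x) := rfl
    rw [this, PiTensorProduct.liftAlgHom_apply, PiTensorProduct.lift.tprod, hM]
    have h1 := hupd 1 i x
    have h2 : ((Finset.univ.erase i).noncommProd (fun j => f j ((1 : ∀ i, A i) j))
        (fun i _ j _ hij => hf i j hij _ _)) = 1 :=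
      (Finset.noncommProd_eq_pow_card _ _ _ 1 (by simp)).trans (one_pow _)
    rw [h2, mul_one] at h1
    exact h1

end

noncomputable section

section rot
variable {p : ℕ} [hp : Fact p.Prime]

/-- rotation of words -/
def rotw {a : Type} (c : ZMod p) (w : ZMod p → a) : ZMod p → a := fun i => w (i + c)

theorem rotw_rotw {a : Type} (c c' : ZMod p) (w : ZMod p → a) :
    rotw c (rotw c' w) = rotw (c + c') w := by
  ext i; simp [rotw, add_assoc]

theorem rotw_zero {a : Type} (w : ZMod p → a) : rotw 0 w = w := by
  ext i; simp [rotw]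

theorem rotw_inj {a : Type} (c : ZMod p) {w w' : ZMod p → a} (h : rotw c w = rotw c w') :
    w = w' := by
  have := congrArg (rotw (-c)) h
  simpa [rotw_rotw, rotw_zero] using this

theorem rotw_eq_const {a : Type} {c : ZMod p} (hc : c ≠ 0) {w : ZMod p → a} (h : rotw c w = w) :
    w = fun _ => w 0 := by
  have h1 : ∀ n : ℕ, ∀ i, w (i + n * c) = w i := by
    intro n
    induction n with
    | zero => simp
    | succ n ih =>
      intro i
      have := congrFun h (i + n * c)
      simp only [rotw] at this
      rw [ih] at this
      rw [← this]; push_cast; ring_nf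
  ext i
  have := h1 (i * c⁻¹).val 0
  simpa [hc] using this

theorem rotw_const {a : Type} (c : ZMod p) (x : a) : rotw c (fun _ => x) = fun _ => x := rfl

theorem sum_words {E a : Type} [Field E] [CharP E p] [Fintype a] [DecidableEq a]
    (f : (ZMod p → a) → E) (hf : ∀ w, f (rotw 1 w) = f w) :
    ∑ w, f w = ∑ x : a, f (fun _ => x) := by
  classical
  let s : Finset E := Finset.univ.image f
  have h1 : ∑ w, f w = ∑ v ∈ s, ((Finset.univ.filter fun w => f w = v).card : E) * v := by
    rw [← Finset.sum_fiberwise_of_maps_to (s := Finset.univ) (t := s) (g := f) (by simp [s])]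
    refine Finset.sum_congr rfl fun v _ => ?_
    rw [Finset.sum_congr rfl (g := fun _ => v) (by simp)]
    simp
  have h2 : ∑ x : a, f (fun _ => x) =
      ∑ v ∈ s, ((Finset.univ.filter fun x : a => f (fun _ => x) = v).card : E) * v := by
    rw [← Finset.sum_fiberwise_of_maps_to (s := Finset.univ) (t := s)
      (g := fun x : a => f (fun _ => x)) (by simp [s])]
    refine Finset.sum_congr rfl fun v _ => ?_
    rw [Finset.sum_congr rfl (g := fun _ => v) (by simp)]
    simp
  rw [h1, h2]
  refine Finset.sum_congr rfl fun v _ => ?_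
  congr 1
  rw [CharP.cast_eq_iff_mod_eq E p]
  let X := {w : ZMod p → a // f w = v}
  let φ : Function.End X := fun w => ⟨rotw 1 w.1, by rw [hf, w.2]⟩
  have hφ : ∀ n : ℕ, ∀ w : X, ((φ ^ n) w).1 = rotw (n : ZMod p) w.1 := by
    intro n
    induction n with
    | zero => intro w; simp only [pow_zero, Nat.cast_zero, rotw_zero]; rfl
    | succ n ih =>
      intro w
      rw [pow_succ]
      change ((φ ^ n) (φ w)).1 = _
      rw [ih]
      simp only [φ, rotw_rotw]; push_cast; rfl
  have h3 := Equiv.Perm.card_fixedPoints_modEq (f := φ) (p := p) (n := 1) (by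
    funext w
    apply Subtype.ext
    rw [hφ]
    simp only [pow_one, CharP.cast_eq_zero, rotw_zero]; rfl)
  have e1 : (Finset.univ.filter fun w => f w = v).card = Fintype.card X := by
    rw [Fintype.card_subtype]
  have e2 : (Finset.univ.filter fun x : a => f (fun _ => x) = v).card = Fintype.card φ.fixedPoints := by
    rw [← Fintype.card_subtype]
    refine Fintype.card_congr ⟨fun x => ⟨⟨fun _ => x.1, x.2⟩, ?_⟩, fun w => ⟨w.1.1 0, ?_⟩, ?_, ?_⟩
    · exact Subtype.ext rfl
    · have := rotw_eq_const (one_ne_zero) (congrArg Subtype.val w.2)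
      exact (congrArg f this.symm).trans w.1.2
    · intro x; rfl
    · intro w
      have := rotw_eq_const (one_ne_zero) (congrArg Subtype.val w.2)
      apply Subtype.ext; apply Subtype.ext
      exact this.symm
  rw [e1, e2]
  exact h3

variable (E : Type) [Field E] (a : Type) [Fintype a] [DecidableEq a]

/-- rotation matrix -/
def rotm (c : ZMod p) : Matrix (ZMod p → a) (ZMod p → a) E :=
  Matrix.of fun w w' => if rotw c w = w' then 1 else 0

variable {E a}

theorem rotm_mul_apply {b : Type} (c : ZMod p) (X : Matrix (ZMod p → a) b E) (w) (w') :
    (rotm E a c * X) w w' = X (rotw c w) w' := by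
  simp [Matrix.mul_apply, rotm]

theorem mul_rotm_apply {b : Type} (c : ZMod p) (X : Matrix b (ZMod p → a) E) (w) (w') :
    (X * rotm E a c) w w' = X w (rotw (-c) w') := by
  rw [Matrix.mul_apply, Finset.sum_eq_single (rotw (-c) w')]
  · simp [rotm, rotw_rotw, rotw_zero]
  · intro v _ hv
    have : ¬ rotw c v = w' := by
      rintro rfl; exact hv (by simp [rotw_rotw, rotw_zero])
    simp [rotm, this]
  · simp

theorem rotm_mulVec (c : ZMod p) (x : (ZMod p → a) → E) (w) :
    ((rotm E a c).mulVec x) w = x (rotw c w) := by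
  simp [Matrix.mulVec, dotProduct, rotm]

theorem rotm_mul_rotm (c c' : ZMod p) : rotm E a c * rotm E a c' = rotm E a (c + c') := by
  ext w w'
  rw [rotm_mul_apply]
  simp [rotm, rotw_rotw, add_comm]

theorem rotm_zero : rotm E a (0 : ZMod p) = 1 := by
  ext w w'
  simp [rotm, rotw_zero, Matrix.one_apply]

theorem rotm_one_pow (n : ℕ) : (rotm E a (1 : ZMod p)) ^ n = rotm E a (n : ZMod p) := by
  induction n with
  | zero => simp [rotm_zero]
  | succ n ih => rw [pow_succ, ih, rotm_mul_rotm]; push_cast; rfl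

theorem rotm_kpr {b : Type} [Fintype b] [DecidableEq b] (c : ZMod p) (X : ZMod p → Matrix a b E) :
    rotm E a c * kpr X = kpr (fun i => X (i - c)) * rotm E b c := by
  ext w w'
  rw [rotm_mul_apply, mul_rotm_apply, kpr_apply, kpr_apply]
  refine Fintype.prod_equiv (Equiv.addRight c) _ _ fun i => ?_
  simp [rotw]

variable (E a) in
/-- the norm matrix -/
def rotN (p : ℕ) [Fact p.Prime] : Matrix (ZMod p → a) (ZMod p → a) E := ∑ c : ZMod p, rotm E a c

theorem rotN_kpr {b : Type} [Fintype b] [DecidableEq b] (X : Matrix a b E) :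
    rotN E a p * kpr (ι := ZMod p) (fun _ => X) = kpr (ι := ZMod p) (fun _ => X) * rotN E b p := by
  rw [rotN, rotN, Matrix.sum_mul, Matrix.mul_sum]
  exact Finset.sum_congr rfl fun c _ => rotm_kpr c _

theorem rotN_mulVec (x : (ZMod p → a) → E) (w) :
    ((rotN E a p).mulVec x) w = ∑ c : ZMod p, x (rotw c w) := by
  rw [rotN, Matrix.sum_mulVec]
  simp [rotm_mulVec]

variable (p a) in
def rotSetoid : Setoid (ZMod p → a) where
  r w w' := ∃ c, rotw c w = w'
  iseqv := ⟨fun w => ⟨0, rotw_zero w⟩, by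
    rintro w _ ⟨c, rfl⟩; exact ⟨-c, by simp [rotw_rotw, rotw_zero]⟩, by
    rintro w _ _ ⟨c, rfl⟩ ⟨c', rfl⟩; exact ⟨c' + c, by simp [rotw_rotw]⟩⟩

def IsConstW (w : ZMod p → a) : Prop := ∃ x, w = fun _ => x

theorem isConstW_rotw (c : ZMod p) (w : ZMod p → a) : IsConstW (rotw c w) ↔ IsConstW w := by
  constructor
  · rintro ⟨x, hx⟩; exact ⟨x, rotw_inj c (by rw [hx]; rfl)⟩
  · rintro ⟨x, rfl⟩; exact ⟨x, rfl⟩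

theorem rotw_free {w : ZMod p → a} (hw : ¬ IsConstW w) {c c' : ZMod p}
    (h : rotw c w = rotw c' w) : c = c' := by
  by_contra hne
  have h2 : rotw (c - c') w = w := by
    have := congrArg (rotw (-c')) h
    rw [rotw_rotw, rotw_rotw, neg_add_cancel, rotw_zero] at this
    rwa [neg_add_eq_sub] at this
  exact hw ⟨_, rotw_eq_const (sub_ne_zero.2 hne) h2⟩

/-- There are `r` with `p r = m^p - m` and the ranks as expected. -/
theorem rotN_ranks (E a : Type) [Field E] [CharP E p] [Fintype a] [DecidableEq a] :
    ∃ r : ℕ, p * r + Fintype.card a = Fintype.card a ^ p ∧ (rotN E a p).rank = r ∧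
      Module.finrank E (LinearMap.ker ((rotm E a (1 : ZMod p) - 1).mulVecLin)) =
        Fintype.card a + r := by
  classical
  let S := rotSetoid p a
  let Q := Quotient S
  have hcl : ∀ q : Q, ∃ P : Prop, ∀ w : ZMod p → a, (Quotient.mk S w = q) → (IsConstW w ↔ P) := by
    intro q
    induction q using Quotient.inductionOn with
    | h w =>
      refine ⟨IsConstW w, fun w' h => ?_⟩
      obtain ⟨c, rfl⟩ := Quotient.exact h
      exact (isConstW_rotw c w').symm
  let cst : Q → Prop := fun q => IsConstW q.out
  have hcst : ∀ w, cst (Quotient.mk S w) ↔ IsConstW w := by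
    intro w
    obtain ⟨P, hP⟩ := hcl (Quotient.mk S w)
    rw [hP w rfl]
    exact hP _ (Quotient.out_eq _)
  let Q' := {q : Q // ¬ cst q}
  have hcardcst : Fintype.card {q : Q // cst q} = Fintype.card a := by
    refine Fintype.card_congr ⟨fun q => q.1.out 0, fun x => ⟨Quotient.mk S (fun _ => x), ?_⟩, ?_, ?_⟩
    · rw [hcst]; exact ⟨x, rfl⟩
    · rintro ⟨q, x, hx⟩
      apply Subtype.ext
      simp only
      conv_rhs => rw [← Quotient.out_eq q, hx]
      rw [hx]
    · intro x
      simp only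
      obtain ⟨c, hc⟩ := Quotient.exact (Quotient.out_eq (Quotient.mk S (fun _ : ZMod p => x)))
      have := congrFun hc (-c)
      simpa [rotw] using this
  have hcardQ : Fintype.card Q = Fintype.card a + Fintype.card Q' := by
    have h1 := Fintype.card_subtype_compl cst
    have h2 := Fintype.card_subtype_le cst
    change Fintype.card Q' = _ at h1
    omega
  refine ⟨Fintype.card Q', ?_, ?_, ?_⟩
  · have e : {w : ZMod p → a // ¬ IsConstW w} ≃ Q' × ZMod p := by
      refine (Equiv.ofBijective (fun x : Q' × ZMod p => (⟨rotw x.2 x.1.1.out, by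
        rw [isConstW_rotw]; exact x.1.2⟩ : {w : ZMod p → a // ¬ IsConstW w})) ⟨?_, ?_⟩).symm
      · rintro ⟨q, c⟩ ⟨q', c'⟩ h
        have h' : rotw c q.1.out = rotw c' q'.1.out := congrArg Subtype.val h
        have hq : q = q' := by
          apply Subtype.ext
          rw [← Quotient.out_eq q.1, ← Quotient.out_eq q'.1]
          apply Quotient.sound
          exact ⟨-c' + c, by rw [← rotw_rotw, h', rotw_rotw]; simp [rotw_zero]⟩
        subst hq
        rw [rotw_free q.2 h']
      · rintro ⟨w, hw⟩
        obtain ⟨c, hc⟩ := Quotient.exact (Quotient.out_eq (Quotient.mk S w))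
        exact ⟨⟨⟨Quotient.mk S w, by rwa [hcst]⟩, c⟩, Subtype.ext hc⟩
    have e2 : {w : ZMod p → a // IsConstW w} ≃ a :=
      (Equiv.ofBijective (fun x : a => (⟨fun _ => x, x, rfl⟩ : {w : ZMod p → a // IsConstW w}))
        ⟨fun x y h => congrFun (congrArg Subtype.val h) 0, by
          rintro ⟨w, x, rfl⟩; exact ⟨x, rfl⟩⟩).symm
    have h1 := Fintype.card_congr e
    rw [Fintype.card_subtype_compl, Fintype.card_congr e2, Fintype.card_prod, Fintype.card_fun, ZMod.card] at h1
    have h2 : Fintype.card a ≤ Fintype.card a ^ p := Nat.le_self_pow hp.out.ne_zero _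
    rw [mul_comm p, ← h1]
    omega
  · let Ψ : (Q' → E) →ₗ[E] ((ZMod p → a) → E) :=
      { toFun := fun y w => if h : cst (Quotient.mk S w) then 0 else y ⟨_, h⟩
        map_add' := by intro x y; ext w; by_cases h : cst (Quotient.mk S w) <;> simp [h]
        map_smul' := by intro x y; ext w; by_cases h : cst (Quotient.mk S w) <;> simp [h] }
    have hinj : Function.Injective Ψ := by
      intro y y' h
      ext q
      have := congrFun h q.1.out
      have h2 : ¬ cst (Quotient.mk S q.1.out) := by rw [Quotient.out_eq]; exact q.2
      simp only [Ψ, LinearMap.coe_mk, AddHom.coe_mk, dif_neg h2] at this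
      have h3 : (⟨Quotient.mk S q.1.out, h2⟩ : Q') = q := Subtype.ext (Quotient.out_eq _)
      rwa [h3] at this
    have hrange : LinearMap.range Ψ = LinearMap.range (rotN E a p).mulVecLin := by
      apply le_antisymm
      · rintro _ ⟨y, rfl⟩
        refine ⟨fun w => if (Quotient.mk S w).out = w then Ψ y w else 0, ?_⟩
        ext w
        rw [Matrix.mulVecLin_apply, rotN_mulVec]
        have hmk : ∀ c, Quotient.mk S (rotw c w) = Quotient.mk S w :=
          fun c => Quotient.sound ⟨-c, by simp [rotw_rotw, rotw_zero]⟩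
        by_cases h : cst (Quotient.mk S w)
        · simp [Ψ, hmk, h]
        · obtain ⟨c, hc⟩ := Quotient.exact (Quotient.out_eq (Quotient.mk S w))
          have hc' : (Quotient.mk S w).out = rotw (-c) w := by
            conv_rhs => rw [← hc]
            rw [rotw_rotw, neg_add_cancel, rotw_zero]
          rw [Finset.sum_eq_single (-c)]
          · simp [Ψ, hmk, h, hc']
          · intro c1 _ hne
            rw [if_neg]
            rw [hmk, hc']
            intro h'
            exact hne (rotw_free ((hcst w).not.1 h) h').symm
          · simp
      · rintro _ ⟨x, rfl⟩
        refine ⟨fun q => ((rotN E a p).mulVec x) q.1.out, ?_⟩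
        ext w
        simp only [Ψ, LinearMap.coe_mk, AddHom.coe_mk, Matrix.mulVecLin_apply]
        by_cases h : cst (Quotient.mk S w)
        · rw [dif_pos h, rotN_mulVec]
          obtain ⟨x0, rfl⟩ := (hcst w).1 h
          simp [rotw_const, ZMod.card, CharP.cast_eq_zero]
        · rw [dif_neg h, rotN_mulVec, rotN_mulVec]
          obtain ⟨c, hc⟩ := Quotient.exact (Quotient.out_eq (Quotient.mk S w))
          refine Fintype.sum_equiv (Equiv.subRight c) _ _ fun c1 => ?_
          conv_rhs => rw [← hc]
          simp [rotw_rotw]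
    rw [Matrix.rank, ← hrange, LinearMap.finrank_range_of_inj hinj]
    simp
  · let Ψ : (Q → E) →ₗ[E] ((ZMod p → a) → E) :=
      { toFun := fun y w => y (Quotient.mk S w)
        map_add' := by intro x y; rfl
        map_smul' := by intro x y; rfl }
    have hinj : Function.Injective Ψ := by
      intro y y' h
      ext q
      have := congrFun h q.out
      simp only [Ψ, LinearMap.coe_mk, AddHom.coe_mk] at this
      rwa [Quotient.out_eq] at this
    have hrange : LinearMap.range Ψ = LinearMap.ker ((rotm E a (1 : ZMod p) - 1).mulVecLin) := by
      apply le_antisymm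
      · rintro _ ⟨y, rfl⟩
        rw [LinearMap.mem_ker]
        ext w
        rw [Matrix.mulVecLin_apply, Matrix.sub_mulVec, Pi.sub_apply, rotm_mulVec, Matrix.one_mulVec]
        have hmk : ∀ c, Quotient.mk S (rotw c w) = Quotient.mk S w :=
          fun c => Quotient.sound ⟨-c, by simp [rotw_rotw, rotw_zero]⟩
        simp [Ψ, hmk]
      · intro x hx
        have hx1 : ∀ w, x (rotw 1 w) = x w := by
          intro w
          have := congrFun (LinearMap.mem_ker.1 hx) w
          rw [Matrix.mulVecLin_apply, Matrix.sub_mulVec, Pi.sub_apply, rotm_mulVec, Matrix.one_mulVec] at this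
          exact sub_eq_zero.1 this
        have hx2 : ∀ n : ℕ, ∀ w, x (rotw (n : ZMod p) w) = x w := by
          intro n
          induction n with
          | zero => intro w; simp [rotw_zero]
          | succ n ih =>
            intro w
            push_cast
            rw [← rotw_rotw, ih, hx1]
        refine ⟨fun q => x q.out, ?_⟩
        ext w
        simp only [Ψ, LinearMap.coe_mk, AddHom.coe_mk]
        obtain ⟨c, hc⟩ := Quotient.exact (Quotient.out_eq (Quotient.mk S w))
        conv_rhs => rw [← hc]
        rw [← ZMod.natCast_zmod_val c, hx2]
    rw [← hrange, LinearMap.finrank_range_of_inj hinj, Module.finrank_pi, hcardQ]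

end rot
end

noncomputable section

section cyc
variable {p : ℕ} [hp : Fact p.Prime]
variable {F A E a : Type} [Field F] [Ring A] [Algebra F A] [Field E] [Algebra F E] [Fintype a]
  [DecidableEq a] [Nonempty a]

theorem exists_cyc [CharP E p] (hA : IsCSA F A) (hd : Module.finrank F A = Fintype.card a ^ 2)
    (τ : A →ₐ[F] Matrix a a E) :
    ∃ g : (⨂[F] _ : ZMod p, A), kappa (ZMod p) τ g = rotm E a 1 := by
  classical
  have hnt : Nontrivial A := by
    have := hA.2.1; infer_instance
  have hb := kappa_bijective (ι := ZMod p) τ hA hd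
  have hb0 := csa_ext_bijective hA τ (by rw [hd, finrank_matrix_self])
  let e : E ⊗[F] (⨂[F] _ : ZMod p, A) ≃ₐ[E] Matrix (ZMod p → a) (ZMod p → a) E :=
    AlgEquiv.ofBijective _ hb
  have he : ∀ y, e (1 ⊗ₜ y) = kappa (ZMod p) τ y := by
    intro y
    exact (extMap_tmul (E := E) (kappa (ZMod p) τ) 1 y).trans (one_smul _ _)
  let e0 : E ⊗[F] A ≃ₐ[E] Matrix a a E := AlgEquiv.ofBijective _ hb0
  have he0 : ∀ y, e0 (1 ⊗ₜ y) = τ y := by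
    intro y
    exact (extMap_tmul (E := E) τ 1 y).trans (one_smul _ _)
  let L : (E →ₗ[F] F) → E ⊗[F] (⨂[F] _ : ZMod p, A) →ₗ[F] (⨂[F] _ : ZMod p, A) := fun l =>
    TensorProduct.lift ((LinearMap.lsmul F _).comp l)
  have hL : ∀ l x y, L l (x ⊗ₜ y) = l x • y := fun l x y => by simp [L]
  have hL1 : ∀ l y z, L l ((1 ⊗ₜ y) * z) = y * L l z := by
    intro l y z
    induction z using TensorProduct.induction_on with
    | zero => simp
    | tmul u v => simp [hL]
    | add u v hu hv => rw [mul_add, map_add, map_add, hu, hv, mul_add]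
  have hL2 : ∀ l y z, L l (z * (1 ⊗ₜ y)) = L l z * y := by
    intro l y z
    induction z using TensorProduct.induction_on with
    | zero => simp
    | tmul u v => simp [hL]
    | add u v hu hv => rw [add_mul, map_add, map_add, hu, hv, add_mul]
  let z := e.symm (rotm E a 1)
  have hz : z ≠ 0 := by
    intro h
    have : rotm E a (1 : ZMod p) = 0 := by
      rw [← e.apply_symm_apply (rotm E a 1)]; change e z = 0; rw [h, map_zero]
    have h2 := rotm_mul_rotm (E := E) (a := a) (1 : ZMod p) (-1)
    rw [this, zero_mul, add_neg_cancel, rotm_zero] at h2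
    exact zero_ne_one h2
  obtain ⟨l, hl⟩ : ∃ l, L l z ≠ 0 := by
    let b := Module.Basis.ofVectorSpace F E
    by_contra hcon
    push Not at hcon
    apply hz
    apply (TensorProduct.equivFinsuppOfBasisLeft (N := (⨂[F] _ : ZMod p, A)) b).injective
    rw [map_zero]
    ext i
    have : L (b.coord i) = (Finsupp.lapply i).comp
      (TensorProduct.equivFinsuppOfBasisLeft (N := (⨂[F] _ : ZMod p, A)) b).toLinearMap := by
      apply TensorProduct.ext'
      intro x y
      rw [hL]
      simp [TensorProduct.equivFinsuppOfBasisLeft_apply_tmul_apply]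
    have h2 := hcon (b.coord i)
    rw [this] at h2
    simpa using h2
  let g := L l z
  have hgz : ∀ x : ZMod p → A, g * PiTensorProduct.tprod F x =
      PiTensorProduct.tprod F (fun i => x (i - 1)) * g := by
    intro x
    rw [← hL1, ← hL2]
    congr 1
    apply e.injective
    rw [map_mul, map_mul, he, he, kappa_tprod, kappa_tprod]
    simp only [z, e.apply_symm_apply]
    exact rotm_kpr 1 _
  let κ := kappa (ZMod p) τ
  have hXc : κ g * rotm E a (-1) ∈ Subalgebra.center E (Matrix (ZMod p → a) (ZMod p → a) E) := by
    rw [Subalgebra.mem_center_iff]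
    have h1 : ∀ y, κ y * (κ g * rotm E a (-1)) = (κ g * rotm E a (-1)) * κ y := by
      intro y
      induction y using PiTensorProduct.induction_on with
      | smul_tprod r x =>
        rw [map_smul, smul_mul_assoc, mul_smul_comm]
        congr 1
        have h2 : g * PiTensorProduct.tprod F (fun i => x (i + 1)) =
            PiTensorProduct.tprod F x * g := by
          have h2 := hgz (fun i => x (i + 1))
          have h4 : (fun i => x (i - 1 + 1)) = x := funext fun i => congrArg x (sub_add_cancel i 1)
          exact h2.trans (congrArg (fun y => PiTensorProduct.tprod F y * g) h4)
        have h3 : rotm E a (-1 : ZMod p) * kpr (fun i => τ (x i)) =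
            kpr (fun i => τ (x (i + 1))) * rotm E a (-1) := by
          have h3 := rotm_kpr (E := E) (-1 : ZMod p) (fun i => τ (x i))
          have h4 : (fun i => τ (x (i - -1))) = fun i => τ (x (i + 1)) :=
            funext fun i => congrArg (fun j => τ (x j)) (sub_neg_eq_add i 1)
          exact h3.trans (congrArg (fun y => kpr y * rotm E a (-1)) h4)
        calc κ (PiTensorProduct.tprod F x) * (κ g * rotm E a (-1))
            = κ (PiTensorProduct.tprod F x * g) * rotm E a (-1) := by rw [map_mul, mul_assoc]
          _ = κ (g * (PiTensorProduct.tprod F) fun i => x (i + 1)) * rotm E a (-1) := by rw [h2]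
          _ = κ g * (kpr (fun i => τ (x (i + 1))) * rotm E a (-1)) := by
              rw [map_mul, mul_assoc]; congr 2; exact kappa_tprod _ _
          _ = κ g * (rotm E a (-1) * κ (PiTensorProduct.tprod F x)) := by
              rw [← h3]; congr 2; exact (kappa_tprod _ _).symm
          _ = _ := by rw [mul_assoc]
      | add u v hu hv => rw [map_add, add_mul, mul_add, hu, hv]
    intro y
    obtain ⟨y, rfl⟩ := e.surjective y
    induction y using TensorProduct.induction_on with
    | zero => simp
    | tmul u v =>
      have : e (u ⊗ₜ v) = u • κ v := extMap_tmul (E := E) (kappa (ZMod p) τ) u v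
      rw [this, smul_mul_assoc, mul_smul_comm, h1]
    | add u v hu hv => rw [map_add, add_mul, mul_add, hu, hv]
  rw [Algebra.IsCentral.center_eq_bot, Algebra.mem_bot] at hXc
  obtain ⟨c, hc⟩ := hXc
  have hκg : κ g = c • rotm E a 1 := by
    have h1 : κ g * rotm E a (-1) * rotm E a 1 = κ g := by
      rw [mul_assoc, rotm_mul_rotm, neg_add_cancel, rotm_zero, mul_one]
    rw [← h1, ← hc, Algebra.algebraMap_eq_smul_one, smul_mul_assoc, one_mul]
  have hc0 : c ≠ 0 := by
    rintro rfl
    rw [zero_smul, ← he] at hκg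
    have h2 : (1 : E) ⊗ₜ[F] g = 0 := e.injective (by rw [map_zero]; exact hκg)
    apply hl
    exact Algebra.TensorProduct.includeRight_injective (A := E) (algebraMap F E).injective
      (h2.trans (TensorProduct.tmul_zero _ _).symm)
  obtain ⟨l0, hl0⟩ := exists_functional_one F A
  let L0 : Matrix a a E →ₗ[E] E :=
    (LinearMap.liftBaseChange E ((Algebra.linearMap F E).comp l0)).comp e0.symm.toLinearMap
  have hL0 : ∀ x, L0 (τ x) = algebraMap F E (l0 x) := by
    intro x
    rw [← he0]
    simp [L0, LinearMap.liftBaseChange_tmul]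
  let ℓ : Matrix (ZMod p → a) (ZMod p → a) E →ₗ[E] E :=
    { toFun := fun X => ∑ w, ∑ w', X w w' * ∏ i, L0 (Matrix.single (w i) (w' i) 1)
      map_add' := by intro X Y; simp [add_mul, Finset.sum_add_distrib]
      map_smul' := by intro X Y; simp [mul_assoc, Finset.mul_sum] }
  have hℓ0 : ∀ X, ℓ X = ∑ w, ∑ w', X w w' * ∏ i, L0 (Matrix.single (w i) (w' i) 1) := fun _ => rfl
  have hℓ : ∀ X : ZMod p → Matrix a a E, ℓ (kpr X) = ∏ i, L0 (X i) := by
    intro X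
    have h1 : ∀ i, L0 (X i) = ∑ u, ∑ v, X i u v * L0 (Matrix.single u v 1) := by
      intro i
      conv_lhs => rw [Matrix.matrix_eq_sum_single (X i)]
      simp only [map_sum]
      refine Finset.sum_congr rfl fun u _ => Finset.sum_congr rfl fun v _ => ?_
      rw [← smul_eq_mul, ← map_smul, Matrix.smul_single]; simp
    rw [hℓ0]
    simp only [h1, Finset.prod_univ_sum, Fintype.piFinset_univ, kpr_apply, Finset.prod_mul_distrib]
  have hℓκ : ∀ y, ∃ r : F, ℓ (κ y) = algebraMap F E r := by
    intro y
    induction y using PiTensorProduct.induction_on with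
    | smul_tprod r x =>
      refine ⟨r * ∏ i, l0 (x i), ?_⟩
      have : κ (PiTensorProduct.tprod F x) = kpr fun i => τ (x i) := kappa_tprod _ _
      rw [map_smul, this, ← algebraMap_smul E r, map_smul, hℓ]
      simp [hL0]
    | add u v hu hv =>
      obtain ⟨r, hr⟩ := hu
      obtain ⟨s, hs⟩ := hv
      exact ⟨r + s, by rw [map_add, map_add, hr, hs, map_add]⟩
  have hℓ1 : ℓ 1 = 1 := by
    rw [← kpr_one, hℓ]
    have : L0 1 = 1 := by rw [← map_one τ, hL0, hl0, map_one]
    simp [this]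
  have hℓc : ℓ (rotm E a 1) = 1 := by
    rw [← hℓ1, hℓ0, hℓ0]
    simp only [rotm, Matrix.of_apply, Matrix.one_apply, ite_mul, one_mul, zero_mul,
      Finset.sum_ite_eq, Finset.mem_univ, if_true]
    rw [sum_words (p := p), sum_words (p := p)]
    · rfl
    · intro w
      refine Fintype.prod_equiv (Equiv.addRight 1) _ _ fun i => ?_
      simp [rotw]
    · intro w
      refine Fintype.prod_equiv (Equiv.addRight 1) _ _ fun i => ?_
      simp [rotw]
  obtain ⟨r, hr⟩ := hℓκ g
  rw [hκg, map_smul, hℓc, smul_eq_mul, mul_one] at hr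
  have hr0 : r ≠ 0 := by rintro rfl; exact hc0 (by rw [hr, map_zero])
  refine ⟨r⁻¹ • g, ?_⟩
  rw [map_smul]
  change r⁻¹ • κ g = _
  rw [hκg, hr, ← algebraMap_smul E r⁻¹, smul_smul, ← map_mul, inv_mul_cancel₀ hr0, map_one, one_smul]

end cyc
end

noncomputable section

theorem finrank_range_baseChange {F E V W : Type} [Field F] [Field E] [Algebra F E] [AddCommGroup V]
    [Module F V] [AddCommGroup W] [Module F W] (f : V →ₗ[F] W) :
    Module.finrank E (LinearMap.range (f.baseChange E)) = Module.finrank F (LinearMap.range f) := by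
  have h1 : f.baseChange E = ((LinearMap.range f).subtype.baseChange E).comp
      (f.rangeRestrict.baseChange E) := by
    rw [← LinearMap.baseChange_comp]; rfl
  have h2 : Function.Surjective (f.rangeRestrict.baseChange E) :=
    LinearMap.lTensor_surjective E f.surjective_rangeRestrict
  have h3 : Function.Injective ((LinearMap.range f).subtype.baseChange E) :=
    Module.Flat.lTensor_preserves_injective_linearMap _ (LinearMap.range f).injective_subtype
  rw [h1, LinearMap.range_comp, LinearMap.range_eq_top.2 h2, Submodule.map_top,
    LinearMap.finrank_range_of_inj h3, Module.finrank_baseChange]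

theorem finrank_range_mulRight_matrix {E ι : Type} [Field E] [Fintype ι] [DecidableEq ι]
    (M : Matrix ι ι E) :
    Module.finrank E (LinearMap.range (LinearMap.mulRight E M)) = Fintype.card ι * M.rank := by
  let R := LinearMap.range M.transpose.mulVecLin
  let f : (ι → R) →ₗ[E] Matrix ι ι E :=
    { toFun := fun y => Matrix.of fun i j => (y i).1 j
      map_add' := by intro x y; ext i j; simp
      map_smul' := by intro x y; ext i j; simp }
  have hf : Function.Injective f := by
    intro x y h
    ext i j
    exact congrFun (congrFun h i) j
  have hr : LinearMap.range f = LinearMap.range (LinearMap.mulRight E M) := by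
    apply le_antisymm
    · rintro _ ⟨y, rfl⟩
      have : ∀ i, ∃ x, M.transpose.mulVecLin x = (y i).1 := fun i => (y i).2
      choose x hx using this
      refine ⟨Matrix.of x, ?_⟩
      ext i j
      have := congrFun (hx i) j
      simp only [Matrix.mulVecLin_apply, Matrix.mulVec_transpose] at this
      simp only [f, LinearMap.mulRight_apply, LinearMap.coe_mk, AddHom.coe_mk, Matrix.of_apply, ← this]
      simp [Matrix.mul_apply, Matrix.vecMul, dotProduct]
    · rintro _ ⟨y, rfl⟩
      refine ⟨fun i => ⟨M.transpose.mulVecLin (y i), ⟨_, rfl⟩⟩, ?_⟩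
      ext i j
      simp [f, Matrix.mul_apply, Matrix.vecMul, dotProduct, Matrix.mulVec_transpose]
  rw [← hr, LinearMap.finrank_range_of_inj hf, Module.finrank_pi_fintype]
  simp [R]
  left
  exact Matrix.rank_transpose M

theorem lemR {F E Γ ι : Type} [Field F] [Field E] [Algebra F E] [Ring Γ] [Algebra F Γ] [Fintype ι]
    [DecidableEq ι] (κ : Γ →ₐ[F] Matrix ι ι E) (hb : Function.Bijective (extMap (E := E) κ)) (X : Γ) :
    Module.finrank F (LinearMap.range (LinearMap.mulRight F X)) = Fintype.card ι * (κ X).rank := by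
  rw [← finrank_range_mulRight_matrix, ← finrank_range_baseChange (E := E)]
  let e : E ⊗[F] Γ ≃ₐ[E] Matrix ι ι E := AlgEquiv.ofBijective _ hb
  have h1 : (LinearMap.mulRight E (κ X)).comp e.toLinearMap =
      e.toLinearMap.comp ((LinearMap.mulRight F X).baseChange E) := by
    apply LinearMap.ext
    intro z
    induction z using TensorProduct.induction_on with
    | zero => simp
    | tmul u v =>
      have he : ∀ u v, e (u ⊗ₜ v) = u • κ v := fun u v => extMap_tmul (E := E) κ u v
      simp [he]
    | add u v hu hv => rw [map_add, map_add, hu, hv]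
  have h2 : LinearMap.range (LinearMap.mulRight E (κ X)) =
      (LinearMap.range ((LinearMap.mulRight F X).baseChange E)).map e.toLinearEquiv.toLinearMap := by
    rw [← LinearMap.range_comp]
    have : LinearMap.range (LinearMap.mulRight E (κ X)) =
      LinearMap.range ((LinearMap.mulRight E (κ X)).comp e.toLinearMap) :=
      (LinearMap.range_comp_of_range_eq_top _ (LinearMap.range_eq_top.2 e.surjective)).symm
    rw [this, h1]
  rw [h2]
  exact (LinearEquiv.finrank_map_eq e.toLinearEquiv _).symm

theorem sum_words_mem {p : ℕ} [hp : Fact p.Prime] {a V : Type} [Fintype a] [DecidableEq a]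
    [AddCommGroup V] (R : AddSubgroup V)
    (h : (ZMod p → a) → V) (hR : ∀ w, ∑ c : ZMod p, h (rotw c w) ∈ R) :
    (∑ w, h w) - ∑ x : a, h (fun _ => x) ∈ R := by
  classical
  let S := rotSetoid p a
  have h1 : ∑ x : a, h (fun _ => x) = ∑ w with IsConstW w, h w := by
    symm
    refine Finset.sum_bij (fun w _ => w 0) (by simp) ?_ ?_ ?_
    · intro w hw w' hw' e
      obtain ⟨x, rfl⟩ := (Finset.mem_filter.1 hw).2
      obtain ⟨y, rfl⟩ := (Finset.mem_filter.1 hw').2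
      exact funext fun _ => e
    · intro x _; exact ⟨fun _ => x, by simp only [Finset.mem_filter, Finset.mem_univ, true_and]; exact ⟨x, rfl⟩, rfl⟩
    · intro w hw
      obtain ⟨x, rfl⟩ := (Finset.mem_filter.1 hw).2
      rfl
  rw [h1, ← Finset.sum_filter_add_sum_filter_not Finset.univ IsConstW h, add_sub_cancel_left]
  rw [← Finset.sum_fiberwise (s := Finset.filter (fun x => ¬ IsConstW x) Finset.univ) (g := Quotient.mk S)]
  refine AddSubgroup.sum_mem _ fun q _ => ?_
  by_cases hq : ∃ w, ¬ IsConstW w ∧ Quotient.mk S w = q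
  · obtain ⟨w, hw, rfl⟩ := hq
    convert hR w using 1
    symm
    refine Finset.sum_bij (fun c _ => rotw c w) ?_ ?_ ?_ ?_
    · intro c _
      simp only [Finset.mem_filter, Finset.mem_univ, true_and, isConstW_rotw]
      exact ⟨hw, Quotient.sound ⟨-c, by simp [rotw_rotw, rotw_zero]⟩⟩
    · intro c _ c' _ e; exact rotw_free hw e
    · intro w' hw'
      simp only [Finset.mem_filter, Finset.mem_univ, true_and] at hw'
      obtain ⟨c, hc⟩ := Quotient.exact hw'.2
      exact ⟨-c, Finset.mem_univ _, by rw [← hc]; simp [rotw_rotw, rotw_zero]⟩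
    · intro _ _; rfl
  · convert AddSubgroup.zero_mem R
    apply Finset.sum_eq_zero
    intro w hw
    simp only [Finset.mem_filter, Finset.mem_univ, true_and] at hw
    exact absurd ⟨w, hw⟩ hq
end

noncomputable section

/-- `K` viewed as a `K`-algebra through the `p`-Frobenius. -/
def Frob (p : ℕ) (K : Type) : Type := K

instance (p : ℕ) (K : Type) [Field K] : Field (Frob p K) := inferInstanceAs (Field K)
instance (p q : ℕ) (K : Type) [Field K] [CharP K q] : CharP (Frob p K) q := inferInstanceAs (CharP K q)

def Frob.mk (p : ℕ) {K : Type} [Field K] : K ≃+* Frob p K := RingEquiv.refl K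

instance (p : ℕ) [Fact p.Prime] (K : Type) [Field K] [CharP K p] : Algebra K (Frob p K) :=
  ((Frob.mk p).toRingHom.comp (frobenius K p)).toAlgebra

theorem Frob.algebraMap_apply (p : ℕ) [Fact p.Prime] {K : Type} [Field K] [CharP K p] (x : K) :
  algebraMap K (Frob p K) x = Frob.mk p (x ^ p) := rfl

section tate
variable {p : ℕ} [hp : Fact p.Prime]

/-- Tate-cohomology construction. -/
theorem tate_hom {F A V : Type} [Field F] [CharP F p] [Ring A] [Algebra F A] [AddCommGroup V] [Module F V]
    [FiniteDimensional F V] (g : Module.End F V) (P : A → Module.End F V)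
    (hP1 : P 1 = 1) (hPm : ∀ a b, P (a * b) = P a * P b) (hPs : ∀ (c : F) a, P (c • a) = c ^ p • P a)
    (hPg : ∀ a, Commute g (P a)) (hgp : g ^ p = 1)
    (hPa : ∀ a b, ∀ v ∈ LinearMap.ker (g - 1), (P (a + b) - (P a + P b)) v ∈
      LinearMap.range (∑ i ∈ Finset.range p, g ^ i))
    {d r : ℕ} (h1 : Module.finrank F (LinearMap.ker (g - 1)) = d + r)
    (h2 : Module.finrank F (LinearMap.range (∑ i ∈ Finset.range p, g ^ i)) = r) :
    SplitBy F (Frob p F) A d := by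
  set K := LinearMap.ker (g - 1) with hK
  set N := ∑ i ∈ Finset.range p, g ^ i with hN
  set R := LinearMap.range N with hR
  have hRK : R ≤ K := by
    rintro _ ⟨v, rfl⟩
    rw [hK, LinearMap.mem_ker, ← LinearMap.comp_apply]
    change ((g - 1) * N) v = 0
    rw [hN, mul_geom_sum, hgp, sub_self]; rfl
  have hPN : ∀ a, Commute N (P a) := fun a =>
    Commute.sum_left _ _ _ fun i _ => (hPg a).pow_left i
  have hPK : ∀ a, ∀ v ∈ K, P a v ∈ K := by
    intro a v hv
    rw [hK, LinearMap.mem_ker] at hv ⊢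
    have : (g - 1) * P a = P a * (g - 1) := by rw [sub_mul, mul_sub, (hPg a).eq, one_mul, mul_one]
    have h3 := congrArg (fun f => f v) this
    simp only [Module.End.mul_apply] at h3
    rw [h3, hv, map_zero]
  have hPR : ∀ a, ∀ v ∈ R, P a v ∈ R := by
    rintro a _ ⟨v, rfl⟩
    refine ⟨P a v, ?_⟩
    exact congrArg (fun f => f v) (hPN a).eq
  let R' := R.comap K.subtype
  let T := K ⧸ R'
  have hdim : Module.finrank F T = d := by
    have e1 : Module.finrank F R' = r := by
      rw [← h2]
      exact LinearEquiv.finrank_eq (Submodule.comapSubtypeEquivOfLe hRK)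
    have := Submodule.finrank_quotient_add_finrank R'
    change Module.finrank F T + _ = _ at this
    rw [e1, h1] at this
    omega
  let f0 : A → Module.End F K := fun a => (P a).restrict (hPK a)
  have hf0 : ∀ a, R' ≤ R'.comap (f0 a) := by
    intro a v hv
    exact hPR a _ hv
  let f1 : A → Module.End F T := fun a => R'.mapQ R' (f0 a) (hf0 a)
  have hf1 : ∀ a (v : K), f1 a (Submodule.Quotient.mk v) = Submodule.Quotient.mk (f0 a v) :=
    fun a v => rfl
  have hext : ∀ x y : Module.End F T,
      (∀ v : K, x (Submodule.Quotient.mk v) = y (Submodule.Quotient.mk v)) → x = y := by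
    intro x y h
    apply LinearMap.ext
    intro v
    obtain ⟨v, rfl⟩ := Submodule.Quotient.mk_surjective _ v
    exact h v
  have hs : ∀ (c : F) a, f1 (c • a) = c ^ p • f1 a := by
    intro c a
    refine hext _ _ fun v => ?_
    rw [LinearMap.smul_apply, hf1, hf1, ← Submodule.Quotient.mk_smul]
    congr 1
    apply Subtype.ext
    simp [f0, hPs]
  have h11 : f1 1 = 1 := by
    refine hext _ _ fun v => ?_
    rw [hf1]
    change _ = Submodule.Quotient.mk v
    congr 1
    apply Subtype.ext
    simp [f0, hP1]
  have hadd : ∀ a b, f1 (a + b) = f1 a + f1 b := by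
    intro a b
    refine hext _ _ fun v => ?_
    rw [LinearMap.add_apply, hf1, hf1, hf1, ← Submodule.Quotient.mk_add, Submodule.Quotient.eq]
    exact hPa a b v v.2
  have hzero : f1 0 = 0 := by
    have := hadd 0 0
    simpa using this
  let f2 : A →+* Module.End F T :=
    { toFun := f1
      map_one' := h11
      map_zero' := hzero
      map_add' := hadd
      map_mul' := by
        intro a b
        refine hext _ _ fun v => ?_
        rw [Module.End.mul_apply, hf1, hf1, hf1]
        congr 1
        apply Subtype.ext
        simp [f0, hPm] }
  let b : Module.Basis (Fin d) F T := Module.finBasisOfFinrankEq F T hdim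
  let f3 : A →+* Matrix (Fin d) (Fin d) F := (LinearMap.toMatrixAlgEquiv b).toRingEquiv.toRingHom.comp f2
  let f4 : A →+* Matrix (Fin d) (Fin d) (Frob p F) := (Frob.mk p).toRingHom.mapMatrix.comp f3
  refine ⟨{ f4 with commutes' := ?_ }⟩
  intro c
  have e1 : f3 (algebraMap F A c) = c ^ p • (1 : Matrix (Fin d) (Fin d) F) := by
    change LinearMap.toMatrixAlgEquiv b (f1 _) = _
    rw [Algebra.algebraMap_eq_smul_one, hs, h11, map_smul, map_one]
  change (Frob.mk p).toRingHom.mapMatrix (f3 (algebraMap F A c)) = _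
  rw [e1]
  ext i j
  simp [Matrix.algebraMap_matrix_apply, Matrix.one_apply, Frob.algebraMap_apply]
  split_ifs <;> simp

theorem csa_form {F A : Type} [Field F] [Ring A] [Algebra F A] (hA : IsCSA F A) {d : ℕ}
    (hd : Module.finrank F A = d ^ 2) :
    0 < d ∧ Nonempty (A →ₐ[F] Matrix (Fin d) (Fin d) (AlgebraicClosure F)) := by
  obtain ⟨d', h0, h1, h2⟩ := csa_exists_form hA
  have : d' = d := by
    rw [hd] at h1; exact (Nat.pow_left_injective (two_ne_zero) h1).symm
  subst this
  exact ⟨h0, h2⟩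

/-- if `A^{⊗ p}` is split then the Frobenius twist of `A` is split. -/
theorem frob_split' {F A E : Type} [Field F] [CharP F p] [Ring A] [Algebra F A] (hA : IsCSA F A) {d : ℕ}
    (hd : Module.finrank F A = d ^ 2) (hd0 : 0 < d) (hs : IsSplit F (⨂[F] _ : ZMod p, A))
    [Field E] [Algebra F E] (τ : A →ₐ[F] Matrix (Fin d) (Fin d) E) :
    SplitBy F (Frob p F) A d := by
  classical
  haveI : CharP E p := charP_of_injective_algebraMap (algebraMap F E).injective p
  haveI := hA.2.2
  haveI : Nonempty (Fin d) := ⟨⟨0, hd0⟩⟩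
  have hdc : Module.finrank F A = Fintype.card (Fin d) ^ 2 := by rw [hd, Fintype.card_fin]
  obtain ⟨g, hg⟩ := exists_cyc (p := p) hA hdc τ
  have hb := kappa_bijective (ι := ZMod p) τ hA hdc
  have hAp := csa_piTensor hA (ZMod p)
  have hdp : Module.finrank F (⨂[F] _ : ZMod p, A) = (d ^ p) ^ 2 := by
    rw [finrank_piTensor, hd, ZMod.card]; ring
  obtain ⟨θ⟩ := hs.splitBy hdp
  haveI : Nonempty (Fin (d ^ p)) := ⟨⟨0, pow_pos hd0 p⟩⟩
  have hbθ := csa_ext_bijective hAp θ (by rw [hdp, finrank_matrix_self, Fintype.card_fin])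
  let κ := kappa (ZMod p) τ
  have hrank : ∀ X, (θ X).rank = (κ X).rank := by
    intro X
    have e1 := lemR θ hbθ X
    have e2 := lemR κ hb X
    rw [e1] at e2
    simp only [Fintype.card_fin, Fintype.card_fun, ZMod.card] at e2
    exact Nat.eq_of_mul_eq_mul_left (pow_pos hd0 p) e2
  have hκ : Function.Injective κ := by
    intro x y h
    have : (1 : E) ⊗ₜ[F] x = 1 ⊗ₜ y := hb.1 (by
      rw [extMap_tmul, extMap_tmul]; simp only [one_smul]; exact h)
    exact Algebra.TensorProduct.includeRight_injective (A := E) (algebraMap F E).injective this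
  have hgx : ∀ x : ZMod p → A, g * PiTensorProduct.tprod F x =
      PiTensorProduct.tprod F (fun i => x (i - 1)) * g := by
    intro x
    apply hκ
    have e : ∀ x, κ (PiTensorProduct.tprod F x) = kpr fun i => τ (x i) := fun x => kappa_tprod _ _
    rw [map_mul, map_mul, e, e, show κ g = _ from hg]
    exact rotm_kpr 1 _
  have hgp : g ^ p = 1 := by
    apply hκ
    rw [map_pow, show κ g = _ from hg, rotm_one_pow, CharP.cast_eq_zero, rotm_zero, map_one]
  have hκN : κ (∑ i ∈ Finset.range p, g ^ i) = rotN E (Fin d) p := by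
    rw [map_sum, rotN]
    refine Finset.sum_bij (fun i _ => (i : ZMod p)) (by simp) ?_ ?_ ?_
    · intro i hi j hj e
      have := (ZMod.natCast_eq_natCast_iff' i j p).1 e
      rwa [Nat.mod_eq_of_lt (Finset.mem_range.1 hi), Nat.mod_eq_of_lt (Finset.mem_range.1 hj)] at this
    · intro c _; exact ⟨c.val, Finset.mem_range.2 (ZMod.val_lt c), ZMod.natCast_zmod_val c⟩
    · intro i _; rw [map_pow, show κ g = _ from hg, rotm_one_pow]
  obtain ⟨r, hr1, hr2, hr3⟩ := rotN_ranks (p := p) E (Fin d)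
  let Θ : (⨂[F] _ : ZMod p, A) →ₐ[F] Module.End F (Fin (d ^ p) → F) :=
    (Matrix.toLinAlgEquiv' : Matrix _ _ F ≃ₐ[F] _).toAlgHom.comp θ
  have hΘ : ∀ X, Θ X = (θ X).mulVecLin := fun X => rfl
  have hrΘ : ∀ X, Module.finrank F (LinearMap.range (Θ X)) = (κ X).rank := by
    intro X; rw [hΘ, ← hrank]; rfl
  refine tate_hom (p := p) (Θ g) (fun a => Θ (PiTensorProduct.tprod F fun _ => a)) (r := r) ?_ ?_ ?_ ?_ ?_ ?_ ?_ ?_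
  · rw [← map_one Θ]; rfl
  · intro a b
    rw [← map_mul]
    simp only [PiTensorProduct.tprod_mul_tprod]; rfl
  · intro c a
    rw [← map_smul]
    congr 1
    have := MultilinearMap.map_smul_univ (PiTensorProduct.tprod F (s := fun _ : ZMod p => A))
      (fun _ => c) (fun _ => a)
    simpa [ZMod.card] using this
  · intro a
    have := hgx (fun _ => a)
    exact (congrArg Θ this |> fun h => by rw [map_mul, map_mul] at h; exact h)
  · rw [← map_pow, hgp, map_one]
  · intro a b v hv
    have hgv : Θ g v = v := by
      rw [LinearMap.mem_ker, LinearMap.sub_apply, sub_eq_zero] at hv; exact hv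
    have hgv' : ∀ n : ℕ, Θ (g ^ n) v = v := by
      intro n
      induction n with
      | zero => simp
      | succ n ih => rw [pow_succ, map_mul, Module.End.mul_apply, hgv, ih]
    have hgxn : ∀ (n : ℕ) (x : ZMod p → A), g ^ n * PiTensorProduct.tprod F x =
        PiTensorProduct.tprod F (fun i => x (i - n)) * g ^ n := by
      intro n
      induction n with
      | zero => intro x; simp
      | succ n ih =>
        intro x
        rw [pow_succ, mul_assoc, hgx, ← mul_assoc, ih, mul_assoc]
        congr 2
        funext i
        congr 1; push_cast; ring
    let xx : (ZMod p → Bool) → ZMod p → A := fun w i => if w i then a else b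
    have hsum : (PiTensorProduct.tprod F fun _ : ZMod p => a + b) =
        ∑ w : ZMod p → Bool, PiTensorProduct.tprod F (xx w) := by
      have := MultilinearMap.map_sum (PiTensorProduct.tprod F (s := fun _ : ZMod p => A))
        (α := fun _ => Bool) (fun _ j => if j then a else b)
      simpa using this
    have key := sum_words_mem (p := p) (LinearMap.range (∑ i ∈ Finset.range p, (Θ g) ^ i)).toAddSubgroup
      (fun w => Θ (PiTensorProduct.tprod F (xx w)) v) (by
        intro w
        refine ⟨Θ (PiTensorProduct.tprod F (xx w)) v, ?_⟩
        rw [LinearMap.sum_apply]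
        refine Finset.sum_bij (fun i _ => -(i : ZMod p)) (by simp) ?_ ?_ ?_
        · intro i hi j hj e
          have := (ZMod.natCast_eq_natCast_iff' i j p).1 (neg_injective e)
          rwa [Nat.mod_eq_of_lt (Finset.mem_range.1 hi), Nat.mod_eq_of_lt (Finset.mem_range.1 hj)] at this
        · intro c _
          exact ⟨(-c).val, Finset.mem_range.2 (ZMod.val_lt _), by rw [ZMod.natCast_zmod_val, neg_neg]⟩
        · intro i _
          rw [← map_pow, ← Module.End.mul_apply, ← map_mul, hgxn, map_mul, Module.End.mul_apply, hgv']
          congr 2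
          congr 1
          funext i
          simp [xx, rotw, sub_eq_add_neg]
          rfl)
    simp only [Fintype.sum_bool] at key
    rw [← LinearMap.sum_apply, ← map_sum, ← hsum] at key
    simpa [xx] using key
  · have h1 : Module.finrank F (LinearMap.ker (Θ g - 1)) + (κ (g - 1)).rank = d ^ p := by
      rw [← hrΘ, map_sub, map_one]
      have := LinearMap.finrank_range_add_finrank_ker (Θ g - 1)
      rw [Module.finrank_fin_fun] at this
      omega
    have h2 := LinearMap.finrank_range_add_finrank_ker ((rotm E (Fin d) (1 : ZMod p) - 1).mulVecLin)
    rw [map_sub, map_one, show κ g = _ from hg, Matrix.rank] at h1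
    rw [hr3] at h2
    simp only [Module.finrank_fintype_fun_eq_card, Fintype.card_fun, ZMod.card, Fintype.card_fin] at h2
    omega
  · rw [← hr2, ← hκN, ← hrΘ]
    have e : Θ (∑ i ∈ Finset.range p, g ^ i) = ∑ i ∈ Finset.range p, (Θ g) ^ i := by simp
    rw [e]

theorem frob_split {F A : Type} [Field F] [CharP F p] [Ring A] [Algebra F A] (hA : IsCSA F A) {d : ℕ}
    (hd : Module.finrank F A = d ^ 2) (hs : IsSplit F (⨂[F] _ : ZMod p, A)) :
    SplitBy F (Frob p F) A d := by
  obtain ⟨hd0, ⟨τ⟩⟩ := csa_form hA hd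
  exact frob_split' hA hd hd0 hs τ
end tate
end

noncomputable section

theorem matrix_units_finrank {F Δ V : Type} [Field F] [Ring Δ] [Algebra F Δ] [AddCommGroup V] [Module F V]
    [FiniteDimensional F V] {n : ℕ} (g : Matrix (Fin n) (Fin n) Δ →ₐ[F] Module.End F V) (i0 : Fin n) :
    Module.finrank F V = n * Module.finrank F (LinearMap.range (g (Matrix.single i0 i0 1))) := by
  classical
  let e : Fin n → Fin n → Module.End F V := fun i j => g (Matrix.single i j 1)
  have hee : ∀ i j k (v : V), e i j (e j k v) = e i k v := by
    intro i j k v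
    rw [← Module.End.mul_apply, ← map_mul, Matrix.single_mul_single_same, one_mul]
  have hee0 : ∀ i j j' k (v : V), j ≠ j' → e i j (e j' k v) = 0 := by
    intro i j j' k v h
    rw [← Module.End.mul_apply, ← map_mul]
    rw [Matrix.single_mul_single_of_ne (h := h), map_zero]; rfl
  have h1 : ∀ v, ∑ i, e i i v = v := by
    intro v
    rw [← LinearMap.sum_apply, ← map_sum]
    have : ∑ i : Fin n, Matrix.single i i (1 : Δ) = (1 : Matrix (Fin n) (Fin n) Δ) := Matrix.sum_single_one
    rw [this, map_one]; rfl
  let φ : V ≃ₗ[F] (Fin n → LinearMap.range (e i0 i0)) :=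
    { toFun := fun v i => ⟨e i0 i v, ⟨e i0 i v, hee _ _ _ _⟩⟩
      map_add' := by intro x y; ext i; simp
      map_smul' := by intro x y; ext i; simp
      invFun := fun y => ∑ i, e i i0 (y i).1
      left_inv := by
        intro v
        simp only [hee]
        exact h1 v
      right_inv := by
        intro y
        funext i
        apply Subtype.ext
        simp only
        rw [map_sum, Finset.sum_eq_single i]
        · obtain ⟨v, hv⟩ := (y i).2
          rw [hee, ← hv, hee]
        · intro j _ hj
          exact hee0 _ _ _ _ _ hj.symm
        · simp }
  rw [φ.finrank_eq, Module.finrank_pi_fintype]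
  simp [e]

/-- If `X` and a matrix algebra act in a commuting way then `X` acts on a smaller space. -/
theorem splitBy_of_commuting {F X V : Type} [Field F] [Ring X] [Algebra F X] [AddCommGroup V] [Module F V]
    [FiniteDimensional F V] {n m : ℕ} (hn : 0 < n) (hm : 0 < m) (hV : Module.finrank F V = n * m)
    (g : Matrix (Fin n) (Fin n) F →ₐ[F] Module.End F V) (f : X →ₐ[F] Module.End F V)
    (hc : ∀ x y, Commute (f x) (g y)) : SplitBy F F X m := by
  have h1 := matrix_units_finrank g ⟨0, hn⟩
  rw [hV] at h1
  set e := g (Matrix.single ⟨0, hn⟩ ⟨0, hn⟩ 1) with he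
  have h2 : Module.finrank F (LinearMap.range e) = m := (Nat.eq_of_mul_eq_mul_left hn h1).symm
  have hst : ∀ x, ∀ v ∈ LinearMap.range e, f x v ∈ LinearMap.range e := by
    rintro x _ ⟨v, rfl⟩
    exact ⟨f x v, (congrArg (fun h => h v) (hc x (Matrix.single ⟨0, hn⟩ ⟨0, hn⟩ 1)).eq).symm⟩
  refine splitBy_of_module hm h2 (AlgHom.ofLinearMap
    { toFun := fun x => (f x).restrict (hst x)
      map_add' := ?_
      map_smul' := ?_ } ?_ ?_)
  · intro x y; ext v; simp
  · intro x y; ext v; simp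
  · ext v; simp
  · intro x y; ext v; simp

/-- the `i`-th inclusion into the tensor power -/
def sgl (F : Type) {A κ : Type} [Field F] [Ring A] [Algebra F A] [DecidableEq κ] (i : κ) :
    A →ₐ[F] (⨂[F] _ : κ, A) := PiTensorProduct.singleAlgHom (R := F) (A := fun _ : κ => A) i

theorem sgl_apply {F A κ : Type} [Field F] [Ring A] [Algebra F A] [DecidableEq κ] (i : κ) (x : A) :
    sgl F i x = PiTensorProduct.tprod F (Pi.mulSingle i x) := rfl

theorem sgl_ext {F A κ R : Type} [Field F] [Ring A] [Algebra F A] [Fintype κ] [DecidableEq κ]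
    [Ring R] [Algebra F R] {f g : (⨂[F] _ : κ, A) →ₐ[F] R} (h : ∀ i x, f (sgl F i x) = g (sgl F i x)) :
    f = g := by
  apply PiTensorProduct.algHom_ext
  intro i
  apply AlgHom.ext
  intro x
  exact h i x

theorem exists_commLift' {F R ι A : Type} [Field F] [Ring A]
    [Algebra F A] [Ring R] [Algebra F R] [Fintype ι] [DecidableEq ι]
    (f : ι → A →ₐ[F] R) (hf : ∀ i j, i ≠ j → ∀ x y, Commute (f i x) (f j y)) :
    ∃ Φ : (⨂[F] _ : ι, A) →ₐ[F] R, ∀ i (x : A), Φ (sgl F i x) = f i x :=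
  exists_commLift (A := fun _ : ι => A) f hf

theorem single_commute {F ι A : Type} [Field F] [Ring A]
    [Algebra F A] [Fintype ι] [DecidableEq ι] {i j : ι} (hij : i ≠ j) (x y : A) :
    Commute (sgl F i x) (sgl F j y) := by
  rw [Commute, SemiconjBy, sgl_apply, sgl_apply, PiTensorProduct.tprod_mul_tprod,
    PiTensorProduct.tprod_mul_tprod]
  exact congrArg _ (Pi.mulSingle_commute (f := fun _ : ι => A) hij x y).eq

theorem piTensor_commute {F R ι A : Type} [Field F] [Ring A]
    [Algebra F A] [Ring R] [Algebra F R] [Fintype ι] [DecidableEq ι]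
    (f : (⨂[F] _ : ι, A) →ₐ[F] R) (y : R)
    (h : ∀ i x, Commute (f (sgl F i x)) y) (X) : Commute (f X) y := by
  let C := Subalgebra.centralizer F {y}
  have hC : ∀ z, z ∈ C ↔ Commute z y := by
    intro z; simp only [C, Subalgebra.mem_centralizer_iff, Set.mem_singleton_iff, forall_eq]
    exact ⟨fun h => h.symm, fun h => h.symm⟩
  obtain ⟨Φ, hΦ⟩ := exists_commLift' (F := F) (R := C) (A := A)
    (fun i => (f.comp (sgl F i)).codRestrict C fun x => (hC _).2 (h i x)) (by
      intro i j hij x y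
      apply Subtype.ext
      exact (single_commute hij x y).map f)
  have : f = C.val.comp Φ := by
    apply sgl_ext
    intro i x
    rw [AlgHom.comp_apply, hΦ]; rfl
  rw [this]
  exact (hC _).1 (Φ X).2

/-- sub-tensor maps -/
theorem exists_subTensor {F A ι κ : Type} [Field F] [Ring A] [Algebra F A] [Fintype ι] [DecidableEq ι]
    [Fintype κ] [DecidableEq κ] (e : ι ↪ κ) :
    ∃ Φ : (⨂[F] _ : ι, A) →ₐ[F] (⨂[F] _ : κ, A), ∀ i (x : A), Φ (sgl F i x) = sgl F (e i) x :=
  exists_commLift' (fun i => sgl F (e i))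
    fun i j hij x y => single_commute (fun h => hij (e.injective h)) x y

theorem subTensor_commute {F A ι ι' κ : Type} [Field F] [Ring A] [Algebra F A] [Fintype ι] [DecidableEq ι]
    [Fintype ι'] [DecidableEq ι']
    [Fintype κ] [DecidableEq κ] (e : ι ↪ κ) (e' : ι' ↪ κ) (he : ∀ i j, e i ≠ e' j)
    (Φ : (⨂[F] _ : ι, A) →ₐ[F] (⨂[F] _ : κ, A)) (hΦ : ∀ i (x : A), Φ (sgl F i x) = sgl F (e i) x)
    (Φ' : (⨂[F] _ : ι', A) →ₐ[F] (⨂[F] _ : κ, A)) (hΦ' : ∀ i (x : A), Φ' (sgl F i x) = sgl F (e' i) x)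
    (X Y) : Commute (Φ X) (Φ' Y) := by
  refine piTensor_commute Φ _ (fun i x => ?_) X
  refine (piTensor_commute Φ' _ (fun j y => ?_) Y).symm
  rw [hΦ, hΦ']
  exact single_commute (he i j).symm y x

theorem nest_equiv {F A ι κ N : Type} [Field F] [Ring A] [Algebra F A] (hA : IsCSA F A)
    [Fintype ι] [DecidableEq ι] [Fintype κ] [DecidableEq κ] [Fintype N] [DecidableEq N]
    (hc : Fintype.card ι * Fintype.card κ = Fintype.card N) :
    Nonempty ((⨂[F] _ : ι, ⨂[F] _ : κ, A) ≃ₐ[F] (⨂[F] _ : N, A)) := by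
  let e : ι × κ ≃ N := Fintype.equivOfCardEq (by rw [Fintype.card_prod, hc])
  have h1 := fun i : ι => exists_subTensor (F := F) (A := A) (ι := κ) (κ := N)
    ⟨fun j => e (i, j), fun j j' h => (Prod.ext_iff.1 (e.injective h)).2⟩
  choose f hf using h1
  obtain ⟨Φ, -⟩ := exists_commLift' (F := F) f (fun i j hij x y =>
    subTensor_commute _ _ (fun a b h => hij (Prod.ext_iff.1 (e.injective h)).1) _ (hf i) _ (hf j) x y)
  haveI := hA.2.2
  have hN := csa_piTensor hA N
  haveI := hN.2.1
  haveI := hN.2.2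
  have hK := csa_piTensor hA κ
  haveI := hK.2.2
  refine csa_equiv (csa_piTensor (csa_piTensor hA κ) ι) Φ ?_
  rw [finrank_piTensor, finrank_piTensor, finrank_piTensor, ← pow_mul, mul_comm, hc]

theorem IsSplit.congr {F A B : Type} [Field F] [Ring A] [Algebra F A] [Ring B] [Algebra F B]
    (e : A ≃ₐ[F] B) (h : IsSplit F A) : IsSplit F B := by
  obtain ⟨n, hn, ⟨f⟩⟩ := h
  exact ⟨n, hn, ⟨e.symm.trans f⟩⟩

theorem reindex_split {F A ι κ : Type} [Field F] [Ring A] [Algebra F A] [Fintype ι] [Fintype κ]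
    (h : Fintype.card ι = Fintype.card κ) (hs : IsSplit F (⨂[F] _ : ι, A)) :
    IsSplit F (⨂[F] _ : κ, A) := by
  classical
  let e := Fintype.equivOfCardEq h
  obtain ⟨Φ, hΦ⟩ := exists_subTensor (F := F) (A := A) e.toEmbedding
  obtain ⟨Ψ, hΨ⟩ := exists_subTensor (F := F) (A := A) e.symm.toEmbedding
  refine hs.congr (AlgEquiv.ofAlgHom Φ Ψ ?_ ?_)
  · apply sgl_ext
    intro i x
    simp only [AlgHom.comp_apply, hΨ, hΦ]; simp
  · apply sgl_ext
    intro i x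
    simp only [AlgHom.comp_apply, hΨ, hΦ]; simp

theorem sub_split {F A : Type} [Field F] [Ring A] [Algebra F A] (hA : IsCSA F A) {d a b : ℕ}
    (hd : Module.finrank F A = d ^ 2) 
    (h1 : IsSplit F (⨂[F] _ : Fin (a + b), A)) (h2 : IsSplit F (⨂[F] _ : Fin a, A)) :
    IsSplit F (⨂[F] _ : Fin b, A) := by
  haveI := hA.2.2
  obtain ⟨hd0, -⟩ := csa_form hA hd
  have hdim : ∀ m : ℕ, Module.finrank F (⨂[F] _ : Fin m, A) = (d ^ m) ^ 2 := by
    intro m; rw [finrank_piTensor, hd, Fintype.card_fin]; ring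
  obtain ⟨θ⟩ := h1.splitBy (hdim _)
  obtain ⟨n, hn, ⟨e⟩⟩ := h2
  have hn' : n = d ^ a := by
    have h1 := e.toLinearEquiv.finrank_eq
    rw [hdim, finrank_matrix_self, Fintype.card_fin] at h1
    exact (Nat.pow_left_injective two_ne_zero h1).symm
  subst hn'
  obtain ⟨Φ, hΦ⟩ := exists_subTensor (F := F) (A := A) (Fin.castAddEmb (n := a) b)
  obtain ⟨Ψ, hΨ⟩ := exists_subTensor (F := F) (A := A) (Fin.natAddEmb a (m := b))
  let T : (⨂[F] _ : Fin (a + b), A) →ₐ[F] Module.End F (Fin (d ^ (a + b)) → F) :=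
    (Matrix.toLinAlgEquiv' : Matrix _ _ F ≃ₐ[F] _).toAlgHom.comp θ
  refine SplitBy.isSplit (pow_pos hd0 b) (csa_piTensor hA _) ?_ (hdim b)
  refine splitBy_of_commuting hn (pow_pos hd0 b) (V := Fin (d ^ (a + b)) → F)
    (by rw [Module.finrank_fin_fun, pow_add]) ((T.comp Φ).comp e.symm.toAlgHom) (T.comp Ψ) ?_
  intro x y
  refine Commute.map (f := T) ?_
  refine (subTensor_commute _ _ ?_ Φ hΦ Ψ hΨ _ _).symm
  intro i j h
  have := congrArg Fin.val h
  simp at this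
  omega

/-- base change of split tensor powers -/
theorem baseChange_split {F E A ι : Type} [Field F] [Field E] [Algebra F E] [Ring A] [Algebra F A]
    (hA : IsCSA F A) (hAE : IsCSA E (E ⊗[F] A)) [Fintype ι] {d : ℕ} (hd : Module.finrank F A = d ^ 2)
    (h : SplitBy F E (⨂[F] _ : ι, A) (d ^ Fintype.card ι)) : IsSplit E (⨂[E] _ : ι, E ⊗[F] A) := by
  classical
  haveI := hA.2.2
  obtain ⟨hd0, -⟩ := csa_form hA hd
  obtain ⟨θ⟩ := h
  obtain ⟨Φ, -⟩ := exists_commLift' (F := E) (A := E ⊗[F] A)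
    (fun i : ι => extMap (E := E) (θ.comp (sgl F i))) (by
      intro i j hij x y
      induction x using TensorProduct.induction_on with
      | zero => rw [map_zero]; exact Commute.zero_left _
      | add u v hu hv => rw [map_add]; exact hu.add_left hv
      | tmul u v =>
        induction y using TensorProduct.induction_on with
        | zero => rw [map_zero]; exact Commute.zero_right _
        | add u v hu hv => rw [map_add]; exact hu.add_right hv
        | tmul u' v' =>
          rw [extMap_tmul, extMap_tmul]
          apply Commute.smul_left
          apply Commute.smul_right
          exact (single_commute hij v v').map θ)
  haveI := hAE.2.2
  refine SplitBy.isSplit (pow_pos hd0 _) (csa_piTensor hAE ι) ⟨Φ⟩ ?_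
  rw [finrank_piTensor, Module.finrank_baseChange, hd]; ring
end

noncomputable section

theorem division_dvd {F Δ W : Type} [Field F] [DivisionRing Δ] [Algebra F Δ] [AddCommGroup W] [Module F W]
    (f : Δ →ₐ[F] Module.End F W) : Module.finrank F Δ ∣ Module.finrank F W := by
  letI : Module Δ W := Module.compHom W f.toRingHom
  haveI : IsScalarTower F Δ W := ⟨fun c δ w => by
    change f (c • δ) w = c • f δ w
    rw [map_smul]; rfl⟩
  exact ⟨_, (Module.finrank_mul_finrank F Δ W).symm⟩

theorem matrix_division_dvd {F Δ V : Type} [Field F] [DivisionRing Δ] [Algebra F Δ] [AddCommGroup V]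
    [Module F V] [FiniteDimensional F V] {n : ℕ} (hn : 0 < n)
    (g : Matrix (Fin n) (Fin n) Δ →ₐ[F] Module.End F V) :
    n * Module.finrank F Δ ∣ Module.finrank F V := by
  rw [matrix_units_finrank g ⟨0, hn⟩]
  apply Nat.mul_dvd_mul_left
  set e := g (Matrix.single ⟨0, hn⟩ ⟨0, hn⟩ 1) with he
  let s : Δ →ₐ[F] Module.End F V := g.comp (Matrix.scalarAlgHom (Fin n) F)
  have hst : ∀ x, ∀ v ∈ LinearMap.range e, s x v ∈ LinearMap.range e := by
    rintro x _ ⟨v, rfl⟩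
    refine ⟨s x v, ?_⟩
    rw [← Module.End.mul_apply, ← Module.End.mul_apply]
    congr 1
    rw [he]
    simp only [s, AlgHom.comp_apply]
    rw [← map_mul, ← map_mul]
    congr 1
    ext i j
    simp [Matrix.single_apply, Matrix.mul_apply, Matrix.scalarAlgHom]
    by_cases h1 : (⟨0, hn⟩ : Fin n) = i <;> by_cases h2 : (⟨0, hn⟩ : Fin n) = j <;> simp [h1, h2, Matrix.diagonal_apply, Matrix.single_apply] <;> aesop
  refine division_dvd (AlgHom.ofLinearMap
    { toFun := fun x => (s x).restrict (hst x)
      map_add' := ?_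
      map_smul' := ?_ } ?_ ?_)
  · intro x y; ext v; simp
  · intro x y; ext v; simp
  · ext v; simp
  · intro x y; ext v; simp

/-- rank prime to `p` forces splitting -/
theorem split_of_rank {F Γ : Type} [Field F] [Ring Γ] [Algebra F Γ] (hΓ : IsCSA F Γ) {p s : ℕ}
    (hp : p.Prime) (hd : Module.finrank F Γ = (p ^ s) ^ 2) (x : Γ) {ρ : ℕ}
    (hx : Module.finrank F (LinearMap.range (LinearMap.mulRight F x)) = p ^ s * ρ)
    (hρ : ¬ p ∣ ρ) : IsSplit F Γ := by
  have := hΓ.2.1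
  have := hΓ.2.2
  have : IsArtinianRing Γ := IsArtinianRing.of_finite F Γ
  obtain ⟨n, hn, Δ, _, _, _, ⟨e⟩⟩ := IsSimpleRing.exists_algEquiv_matrix_divisionRing_finite F Γ
  have hn0 : 0 < n := Nat.pos_of_ne_zero hn.1
  have hst : ∀ y, ∀ v ∈ LinearMap.range (LinearMap.mulRight F x),
      LinearMap.mulLeft F y v ∈ LinearMap.range (LinearMap.mulRight F x) := by
    rintro y _ ⟨v, rfl⟩
    exact ⟨y * v, by simp [mul_assoc]⟩
  let f : Γ →ₐ[F] Module.End F (LinearMap.range (LinearMap.mulRight F x)) := AlgHom.ofLinearMap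
    { toFun := fun y => (LinearMap.mulLeft F y).restrict (hst y)
      map_add' := by intro x y; ext v; simp [add_mul]
      map_smul' := by intro x y; ext v; simp } (by ext v; simp) (by intro x y; ext v; simp [mul_assoc])
  have h1 := matrix_division_dvd hn0 (f.comp e.symm.toAlgHom)
  rw [hx] at h1
  have h2 : n * n * Module.finrank F Δ = (p ^ s) ^ 2 := by
    rw [← hd, e.toLinearEquiv.finrank_eq, Module.finrank_matrix]; simp
  have h3 : n * Module.finrank F Δ ∣ p ^ (s * 2) := by
    rw [pow_mul, ← h2, mul_assoc]; exact dvd_mul_left _ _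
  obtain ⟨t, ht, h4⟩ := (Nat.dvd_prime_pow hp).1 h3
  have h5 : n * Module.finrank F Δ ∣ p ^ s := by
    rw [h4] at h1 ⊢
    exact Nat.Coprime.dvd_of_dvd_mul_right (Nat.Coprime.pow_left _ ((Nat.Prime.coprime_iff_not_dvd hp).2 hρ)) h1
  have hpos : 0 < p ^ s := pow_pos hp.pos s
  have h6 : n * Module.finrank F Δ ≤ p ^ s := Nat.le_of_dvd hpos h5
  have hΔ : 0 < Module.finrank F Δ := Module.finrank_pos
  have h7 : Module.finrank F Δ = 1 := by
    have : p ^ s ≤ n := by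
      by_contra h
      push Not at h
      nlinarith
    nlinarith
  have hbij : Function.Bijective (algebraMap F Δ) := by
    refine ⟨(algebraMap F Δ).injective, ?_⟩
    intro y
    have : (⊥ : Subalgebra F Δ) = ⊤ := Subalgebra.bot_eq_top_iff_finrank_eq_one.2 h7
    have hy : y ∈ (⊥ : Subalgebra F Δ) := by rw [this]; trivial
    exact hy
  exact ⟨n, hn0, ⟨e.trans (AlgEquiv.mapMatrix (AlgEquiv.ofBijective (Algebra.ofId F Δ) hbij).symm)⟩⟩

theorem rank_factor {E a : Type} [Field E] [Fintype a] [DecidableEq a] (M : Matrix a a E) :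
    ∃ (X : Matrix a (Fin M.rank) E) (Y : Matrix (Fin M.rank) a E) (X' : Matrix (Fin M.rank) a E)
      (Y' : Matrix a (Fin M.rank) E), M = X * Y ∧ X' * X = 1 ∧ Y * Y' = 1 := by
  let e : LinearMap.range M.mulVecLin ≃ₗ[E] (Fin M.rank → E) :=
    (Module.finBasisOfFinrankEq E (LinearMap.range M.mulVecLin) rfl).equivFun
  let x : (Fin M.rank → E) →ₗ[E] (a → E) := (LinearMap.range M.mulVecLin).subtype ∘ₗ e.symm.toLinearMap
  let y : (a → E) →ₗ[E] (Fin M.rank → E) := e.toLinearMap ∘ₗ M.mulVecLin.rangeRestrict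
  obtain ⟨x', hx'⟩ := x.exists_leftInverse_of_injective (LinearMap.ker_eq_bot.2 (by
    intro u v h
    exact e.symm.injective (Subtype.ext h)))
  obtain ⟨y', hy'⟩ := y.exists_rightInverse_of_surjective (LinearMap.range_eq_top.2 (by
    intro u
    obtain ⟨v, hv⟩ := M.mulVecLin.surjective_rangeRestrict (e.symm u)
    exact ⟨v, by simp only [y, LinearMap.comp_apply, hv]; simp⟩))
  refine ⟨LinearMap.toMatrix' x, LinearMap.toMatrix' y, LinearMap.toMatrix' x', LinearMap.toMatrix' y', ?_, ?_, ?_⟩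
  · rw [← LinearMap.toMatrix'_comp]
    refine (LinearMap.toMatrix'_toLin' M).symm.trans ?_
    congr 1
    apply LinearMap.ext
    intro v
    simp [x, y]
  · rw [← LinearMap.toMatrix'_comp, hx', LinearMap.toMatrix'_id]
  · rw [← LinearMap.toMatrix'_comp, hy', LinearMap.toMatrix'_id]

variable {p : ℕ} [Fact p.Prime]

theorem rank_step' {F A E : Type} [Field F] [CharP F p] [Ring A] [Algebra F A] (hA : IsCSA F A) {d : ℕ}
    (hd : Module.finrank F A = d ^ 2) (hd0 : 0 < d) [Field E] [Algebra F E] (τ : A →ₐ[F] Matrix (Fin d) (Fin d) E)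
    {m : ℕ} (x : A) (hx : Module.finrank F (LinearMap.range (LinearMap.mulRight F x)) = d * m) :
    ∃ (r : ℕ) (y : ⨂[F] _ : ZMod p, A), p * r + m = m ^ p ∧
      Module.finrank F (LinearMap.range (LinearMap.mulRight F y)) = d ^ p * r := by
  classical
  haveI : CharP E p := charP_of_injective_algebraMap (algebraMap F E).injective p
  haveI := hA.2.2
  haveI : Nonempty (Fin d) := ⟨⟨0, hd0⟩⟩
  have hdc : Module.finrank F A = Fintype.card (Fin d) ^ 2 := by rw [hd, Fintype.card_fin]
  obtain ⟨g, hg⟩ := exists_cyc (p := p) hA hdc τ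
  have hb0 := csa_ext_bijective hA τ (by rw [hdc, finrank_matrix_self])
  have hb := kappa_bijective (ι := ZMod p) τ hA hdc
  let κ := kappa (ZMod p) τ
  have hκN : κ (∑ i ∈ Finset.range p, g ^ i) = rotN E (Fin d) p := by
    rw [map_sum, rotN]
    refine Finset.sum_bij (fun i _ => (i : ZMod p)) (by simp) ?_ ?_ ?_
    · intro i hi j hj e
      have := (ZMod.natCast_eq_natCast_iff' i j p).1 e
      rwa [Nat.mod_eq_of_lt (Finset.mem_range.1 hi), Nat.mod_eq_of_lt (Finset.mem_range.1 hj)] at this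
    · intro c _; exact ⟨c.val, Finset.mem_range.2 (ZMod.val_lt c), ZMod.natCast_zmod_val c⟩
    · intro i _; rw [map_pow, show κ g = _ from hg, rotm_one_pow]
  have h1 := lemR τ hb0 x
  rw [hx, Fintype.card_fin] at h1
  have hm : (τ x).rank = m := (Nat.eq_of_mul_eq_mul_left hd0 h1).symm
  obtain ⟨X, Y, X', Y', hXY, hX, hY⟩ := rank_factor (τ x)
  obtain ⟨r, hr1, hr2, -⟩ := rotN_ranks (p := p) E (Fin (τ x).rank)
  rw [Fintype.card_fin, hm] at hr1
  refine ⟨r, PiTensorProduct.tprod F (fun _ => x) * ∑ i ∈ Finset.range p, g ^ i, hr1, ?_⟩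
  rw [lemR κ hb]
  simp only [Fintype.card_fun, ZMod.card, Fintype.card_fin]
  congr 1
  rw [map_mul, hκN, show κ (PiTensorProduct.tprod F fun _ => x) = kpr (ι := ZMod p) (fun i => τ x) from kappa_tprod _ _, ← hr2]
  have e1 : kpr (ι := ZMod p) (fun i => τ x) * rotN E (Fin d) p =
      kpr (ι := ZMod p) (fun _ => X) * rotN E (Fin (τ x).rank) p * kpr (ι := ZMod p) (fun _ => Y) := by
    conv_lhs => rw [hXY]
    rw [← kpr_mul (fun _ : ZMod p => X) (fun _ => Y), Matrix.mul_assoc, ← rotN_kpr, ← Matrix.mul_assoc]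
  rw [e1]
  apply le_antisymm
  · exact (Matrix.rank_mul_le_left _ _).trans (Matrix.rank_mul_le_right _ _)
  · have e2 : rotN E (Fin (τ x).rank) p = kpr (ι := ZMod p) (fun _ => X') *
      (kpr (ι := ZMod p) (fun _ => X) * rotN E (Fin (τ x).rank) p * kpr (ι := ZMod p) (fun _ => Y)) *
        kpr (ι := ZMod p) (fun _ => Y') := by
      have a1 : kpr (ι := ZMod p) (fun _ => X') * kpr (ι := ZMod p) (fun _ => X) = 1 := by
        rw [kpr_mul]; simp only [hX]; exact kpr_one
      have a2 : kpr (ι := ZMod p) (fun _ => Y) * kpr (ι := ZMod p) (fun _ => Y') = 1 := by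
        rw [kpr_mul]; simp only [hY]; exact kpr_one
      rw [← Matrix.mul_assoc, ← Matrix.mul_assoc, a1, Matrix.one_mul, Matrix.mul_assoc, a2, Matrix.mul_one]
    conv_lhs => rw [e2]
    exact (Matrix.rank_mul_le_left _ _).trans (Matrix.rank_mul_le_right _ _)

theorem rank_step {F A : Type} [Field F] [CharP F p] [Ring A] [Algebra F A] (hA : IsCSA F A) {d : ℕ}
    (hd : Module.finrank F A = d ^ 2)
    {m : ℕ} (x : A) (hx : Module.finrank F (LinearMap.range (LinearMap.mulRight F x)) = d * m) :
    ∃ (r : ℕ) (y : ⨂[F] _ : ZMod p, A), p * r + m = m ^ p ∧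
      Module.finrank F (LinearMap.range (LinearMap.mulRight F y)) = d ^ p * r := by
  obtain ⟨hd0, ⟨τ⟩⟩ := csa_form hA hd
  exact rank_step' hA hd hd0 τ x hx

theorem finrank_mulRight_equiv {F A B : Type} [Field F] [Ring A] [Algebra F A] [Ring B] [Algebra F B]
    (e : A ≃ₐ[F] B) (x : A) : Module.finrank F (LinearMap.range (LinearMap.mulRight F (e x))) =
      Module.finrank F (LinearMap.range (LinearMap.mulRight F x)) := by
  have : LinearMap.range (LinearMap.mulRight F (e x)) =
      (LinearMap.range (LinearMap.mulRight F x)).map e.toLinearMap := by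
    ext y
    constructor
    · rintro ⟨z, rfl⟩
      exact ⟨e.symm z * x, ⟨_, rfl⟩, by simp⟩
    · rintro ⟨_, ⟨z, rfl⟩, rfl⟩
      exact ⟨e z, by simp⟩
  rw [this]
  exact (LinearEquiv.finrank_eq (Submodule.equivMapOfInjective e.toLinearMap e.injective _)).symm

/-- (iii): index kills -/
theorem pow_split {F A : Type} [Field F] [CharP F p] [Ring A] [Algebra F A] (hA : IsCSA F A) {j : ℕ}
    (hd : Module.finrank F A = (p ^ j) ^ 2) : IsSplit F (⨂[F] _ : Fin (p ^ j), A) := by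
  have hp : p.Prime := Fact.out
  haveI := hA.2.2
  have hdim : ∀ m : ℕ, Module.finrank F (⨂[F] _ : Fin m, A) = ((p ^ j) ^ m) ^ 2 := by
    intro m; rw [finrank_piTensor, hd, Fintype.card_fin]; ring
  have key : ∀ i ≤ j, ∃ (u : ℕ) (y : ⨂[F] _ : Fin (p ^ i), A), ¬ p ∣ u ∧
      Module.finrank F (LinearMap.range (LinearMap.mulRight F y)) = (p ^ j) ^ (p ^ i) * (p ^ (j - i) * u) := by
    intro i
    induction i with
    | zero =>
      intro _
      refine ⟨1, 1, hp.one_lt.ne' ∘ Nat.dvd_one.1, ?_⟩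
      rw [LinearMap.mulRight_one, LinearMap.range_id, finrank_top, hdim]
      simp; ring
    | succ i ih =>
      intro hi
      obtain ⟨u, y, hu, hy⟩ := ih (by omega)
      obtain ⟨r, z, hr, hz⟩ := rank_step (p := p) (csa_piTensor hA (Fin (p ^ i))) (hdim _) y hy
      obtain ⟨e⟩ := nest_equiv hA (ι := ZMod p) (κ := Fin (p ^ i)) (N := Fin (p ^ (i + 1)))
        (by simp [ZMod.card, pow_succ, mul_comm])
      obtain ⟨s, hs⟩ : ∃ s, j - i = s + 1 := ⟨j - i - 1, by omega⟩
      have hs' : j - (i + 1) = s := by omega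
      rw [hs] at hr
      rw [hs']
      set M := p ^ (s + 1) * u with hM
      have hM0 : 0 < M := Nat.mul_pos (pow_pos hp.pos _) (Nat.pos_of_ne_zero (fun h => hu (h ▸ dvd_zero p)))
      have hpM : p ∣ M := by rw [hM, pow_succ, mul_assoc]; exact Dvd.dvd.mul_left (dvd_mul_right _ _) _
      have e1 : M ^ p = M * (M ^ (p - 1) - 1) + M := by
        have h1 : 1 ≤ M ^ (p - 1) := Nat.one_le_pow _ _ hM0
        have h2 : M ^ p = M * M ^ (p - 1) := by
          rw [← pow_succ']; congr 1; have := hp.pos; omega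
        rw [h2]
        obtain ⟨q, hq⟩ := Nat.exists_eq_add_of_le h1
        rw [hq]; simp; ring
      have e2 : r = p ^ s * (u * (M ^ (p - 1) - 1)) := by
        have : p * r = p * (p ^ s * (u * (M ^ (p - 1) - 1))) := by
          have : p * r = M * (M ^ (p - 1) - 1) := by omega
          rw [this]; conv_lhs => rw [hM]
          rw [← hM]; ring
        exact Nat.eq_of_mul_eq_mul_left hp.pos this
      refine ⟨u * (M ^ (p - 1) - 1), e z, ?_, ?_⟩
      · intro h
        rcases (Nat.Prime.dvd_mul hp).1 h with h | h
        · exact hu h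
        · have h1 : 1 ≤ M ^ (p - 1) := Nat.one_le_pow _ _ hM0
          have h2 : p ∣ M ^ (p - 1) := dvd_pow hpM (by have := hp.two_le; omega)
          have : p ∣ 1 := by
            have := Nat.dvd_sub h2 h
            rwa [show M ^ (p - 1) - (M ^ (p - 1) - 1) = 1 by omega] at this
          exact hp.one_lt.ne' (Nat.dvd_one.1 this)
      · rw [finrank_mulRight_equiv, hz, e2]
        congr 1
        rw [← pow_mul, ← pow_succ]
  obtain ⟨u, y, hu, hy⟩ := key j le_rfl
  rw [Nat.sub_self, pow_zero, one_mul, ← pow_mul] at hy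
  exact split_of_rank (csa_piTensor hA _) hp (by rw [hdim, ← pow_mul p j]) y hy hu
end

noncomputable section

section weyl
open Polynomial
variable {p : ℕ} [Fact p.Prime]

theorem prod_X_sub_zmod (p : ℕ) [Fact p.Prime] : ∏ j : ZMod p, (X - C j : (ZMod p)[X]) = X ^ p - X := by
  have hp : p.Prime := Fact.out
  have h := FiniteField.roots_X_pow_card_sub_X (ZMod p)
  rw [ZMod.card] at h
  have h2 := prod_multiset_X_sub_C_of_monic_of_roots_card_eq (p := (X ^ p - X : (ZMod p)[X]))
    (monic_X_pow_sub (by rw [degree_X]; exact_mod_cast hp.one_lt)) (by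
      rw [h, FiniteField.X_pow_card_sub_X_natDegree_eq _ hp.one_lt]; simp [ZMod.card])
  rw [h] at h2
  exact h2

theorem prod_X_sub_zmod' (p : ℕ) [Fact p.Prime] (i : ZMod p) (hi : i ≠ 0) :
    ∏ j ∈ Finset.range p, (X - C ((j : ZMod p) * i) : (ZMod p)[X]) = X ^ p - X := by
  rw [← prod_X_sub_zmod]
  refine Finset.prod_bij (fun j _ => (j : ZMod p) * i) (by simp) ?_ ?_ ?_
  · intro a ha b hb e
    have e := mul_right_cancel₀ hi e
    have := (ZMod.natCast_eq_natCast_iff' a b p).1 e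
    rwa [Nat.mod_eq_of_lt (Finset.mem_range.1 ha), Nat.mod_eq_of_lt (Finset.mem_range.1 hb)] at this
  · intro c _; exact ⟨(c * i⁻¹).val, Finset.mem_range.2 (ZMod.val_lt _), by
      rw [ZMod.natCast_zmod_val, mul_assoc, inv_mul_cancel₀ hi, mul_one]⟩
  · intro a _; rfl

theorem natCast_pow_char {F : Type} [Field F] [CharP F p] (i : ℕ) : (i : F) ^ p = i := by
  have := map_natCast (frobenius F p) i
  rwa [frobenius_def] at this

variable {R : Type} [Ring R] [CharP R p]

theorem units_pow_cancel (w : Rˣ) (n : ℕ) (t : R) : (w : R) ^ n * ((↑w⁻¹ : R) ^ n * t) = t := by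
  rw [← mul_assoc, ← Units.val_pow_eq_pow_val, ← Units.val_pow_eq_pow_val, ← Units.val_mul]
  simp

theorem weyl_pow (w : Rˣ) (u : R) (i : ℕ) (hi : ¬ p ∣ i) (h : u * w = w * (u + i)) :
    (↑w⁻¹ * u) ^ p = (↑w⁻¹ : R) ^ p * (u ^ p - u) := by
  letI := ZMod.algebra R p
  have h1 : ∀ n : ℕ, u * (↑w⁻¹ : R) ^ n = (↑w⁻¹ : R) ^ n * (u - n * i) := by
    have h0 : u * (↑w⁻¹ : R) = ↑w⁻¹ * (u - i) := by
      have : ↑w⁻¹ * (u * w) * (↑w⁻¹ : R) = ↑w⁻¹ * (w * (u + i)) * ↑w⁻¹ := by rw [h]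
      rw [mul_assoc, mul_assoc, Units.mul_inv, mul_one, Units.inv_mul_cancel_left, add_mul, (Nat.cast_commute i _).eq] at this
      rw [mul_sub, this]; abel
    intro n
    induction n with
    | zero => simp
    | succ n ih =>
      have e : (n * i : R) * ↑w⁻¹ = ↑w⁻¹ * (n * i) := by
        have := (Nat.cast_commute (n * i) (↑w⁻¹ : R)).eq
        push_cast at this; exact this
      rw [pow_succ, ← mul_assoc, ih, mul_assoc, sub_mul, h0, e, ← mul_sub, mul_assoc]
      congr 2
      push_cast
      noncomm_ring
  have h2 : ∀ n : ℕ, (↑w⁻¹ * u) ^ n = (↑w⁻¹ : R) ^ n *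
      aeval u (∏ j ∈ Finset.range n, (X - C ((j : ZMod p) * i) : (ZMod p)[X])) := by
    intro n
    induction n with
    | zero => simp
    | succ n ih =>
      rw [pow_succ', ih, mul_assoc, ← mul_assoc u, h1, pow_succ', mul_assoc, mul_assoc]
      congr 2
      rw [Finset.prod_range_succ, mul_comm, map_mul]
      congr 1
      simp
  rw [h2 p, prod_X_sub_zmod' p i (by rwa [Ne, ZMod.natCast_eq_zero_iff])]
  simp

theorem wp_add_one (w : Rˣ) (u : R) (i : ℕ) (hi : ¬ p ∣ i) (h : u * w = w * (u + i)) :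
    (u + w) ^ p - (u + w) = u ^ p - u + (w : R) ^ p := by
  have h1 := weyl_pow w u i hi h
  have h2 := weyl_pow w (u + w) i hi (by rw [add_mul, h]; noncomm_ring)
  rw [mul_add, Units.inv_mul, add_pow_char_of_commute p (Commute.one_right _), h1, one_pow] at h2
  have h3 := congrArg (fun y => (w : R) ^ p * y) h2
  simp only [mul_add, units_pow_cancel, mul_one] at h3
  exact h3.symm
end weyl

section St
variable {p : ℕ} [Fact p.Prime] {F R : Type} [Field F] [CharP F p] [Ring R] [Algebra F R] [Nontrivial R]

theorem wp_add {u w : R} (i : ℕ) (hw : IsUnit w) (h : u * w = w * u + (i : F) • w) :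
    (u + (i : F) • w) ^ p - (u + (i : F) • w) = u ^ p - u + (i : F) • w ^ p := by
  haveI : CharP R p := charP_of_injective_algebraMap (algebraMap F R).injective p
  by_cases hi : p ∣ i
  · have : (i : F) = 0 := (CharP.cast_eq_zero_iff F p i).2 hi
    simp [this]
  · have hi' : (i : F) ≠ 0 := fun h => hi ((CharP.cast_eq_zero_iff F p i).1 h)
    have hu : IsUnit ((i : F) • w) := by
      rw [Algebra.smul_def]
      exact ((isUnit_iff_ne_zero.2 hi').map (algebraMap F R)).mul hw
    obtain ⟨w', hw'⟩ := hu
    have := wp_add_one (p := p) w' u i hi (by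
      rw [hw', mul_smul_comm, h, mul_add, smul_mul_assoc, smul_add]
      congr 1
      rw [(Nat.cast_commute i _).symm.eq, Algebra.smul_def (i : F) ((i : F) • w)]; simp)
    rw [hw'] at this
    rw [this, smul_pow]
    congr 2
    exact natCast_pow_char i

variable (p R) in
/-- Standard presentation of `[a,x) ⊗ [b,z)` inside `R`. -/
structure St (u s v r : R) (a x b z : F) : Prop where
  us : u * s = s * u + s
  vr : v * r = r * v + r
  uv : Commute u v
  ur : Commute u r
  vs : Commute v s
  sr : Commute s r
  sp : s ^ p = algebraMap F R x
  rp : r ^ p = algebraMap F R z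
  ua : u ^ p - u = algebraMap F R a
  vb : v ^ p - v = algebraMap F R b
  x0 : x ≠ 0
  z0 : z ≠ 0

variable (p R) in
def HasSt (a x b z : F) : Prop := ∃ u s v r : R, St p R u s v r a x b z

theorem HasSt.swap {a x b z : F} (h : HasSt p R a x b z) : HasSt p R b z a x := by
  obtain ⟨u, s, v, r, h⟩ := h
  exact ⟨v, r, u, s, h.vr, h.us, h.uv.symm, h.vs, h.ur, h.sr.symm, h.rp, h.sp, h.vb, h.ua, h.z0, h.x0⟩


theorem isUnit_of_pow_alg {s : R} {x : F} (hx : x ≠ 0) (h : s ^ p = algebraMap F R x) : IsUnit s := by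
  have hp : p.Prime := Fact.out
  rw [← isUnit_pow_iff hp.ne_zero, h]
  exact (isUnit_iff_ne_zero.2 hx).map _

theorem mul_pow_weyl {u s : R} (h : u * s = s * u + s) (i : ℕ) :
    u * s ^ i = s ^ i * u + (i : F) • s ^ i := by
  induction i with
  | zero => simp
  | succ i ih =>
    rw [pow_succ, ← mul_assoc, ih, add_mul, mul_assoc, h, smul_mul_assoc]
    push_cast
    rw [mul_add, mul_assoc]
    module

theorem HasSt.pw {a x b z : F} (h : HasSt p R a x b z) (c : F) :
    HasSt p R (a + (c ^ p - c)) x b z := by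
  haveI : CharP R p := charP_of_injective_algebraMap (algebraMap F R).injective p
  obtain ⟨u, s, v, r, h⟩ := h
  have hc : ∀ y : R, Commute (algebraMap F R c) y := fun y => Algebra.commutes c y
  refine ⟨u + algebraMap F R c, s, v, r, ?_, h.vr, h.uv.add_left (hc _), h.ur.add_left (hc _), h.vs, h.sr, h.sp, h.rp, ?_, h.vb, h.x0, h.z0⟩
  · rw [add_mul, h.us, (hc s).eq]; noncomm_ring
  · rw [add_pow_char_of_commute p (hc u).symm, map_add, map_sub, map_pow, ← h.ua]; abel

theorem St.mon {u s v r : R} {a x b z : F} (h : St p R u s v r a x b z) (c : F) (i l : ℕ) :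
    u * (c • (s ^ i * r ^ l)) = (c • (s ^ i * r ^ l)) * u + (i : F) • (c • (s ^ i * r ^ l)) ∧
    v * (c • (s ^ i * r ^ l)) = (c • (s ^ i * r ^ l)) * v + (l : F) • (c • (s ^ i * r ^ l)) ∧
    Commute s (c • (s ^ i * r ^ l)) ∧ Commute r (c • (s ^ i * r ^ l)) ∧
    (c • (s ^ i * r ^ l)) ^ p = algebraMap F R (c ^ p * x ^ i * z ^ l) := by
  have e1 := mul_pow_weyl (F := F) h.us i
  have e2 := mul_pow_weyl (F := F) h.vr l
  refine ⟨?_, ?_, ?_, ?_, ?_⟩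
  · rw [mul_smul_comm, ← mul_assoc, e1, add_mul, mul_assoc, (h.ur.pow_right l).eq, smul_mul_assoc, smul_mul_assoc, mul_assoc]
    module
  · rw [mul_smul_comm, ← mul_assoc, (h.vs.pow_right i).eq, mul_assoc, e2, mul_add, smul_mul_assoc, mul_assoc, mul_smul_comm]
    module
  · exact (((Commute.refl s).pow_right i).mul_right (h.sr.pow_right l)).smul_right c
  · exact ((h.sr.symm.pow_right i).mul_right ((Commute.refl r).pow_right l)).smul_right c
  · rw [smul_pow, (h.sr.pow_pow i l).mul_pow, ← pow_mul, ← pow_mul, mul_comm i, mul_comm l, pow_mul, pow_mul, h.sp, h.rp,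
      Algebra.smul_def]
    simp [mul_assoc]

/-- exact forms -/
theorem HasSt.oe {a x b z : F} (h : HasSt p R a x b z) (c : F) (i l : ℕ) :
    HasSt p R (a + i * (c ^ p * x ^ i * z ^ l)) x (b + l * (c ^ p * x ^ i * z ^ l)) z := by
  by_cases hc : c = 0
  · have : (0 : F) ^ p = 0 := zero_pow (Fact.out : p.Prime).ne_zero
    simpa [hc, this] using h
  obtain ⟨u, s, v, r, h⟩ := h
  obtain ⟨h1, h2, h3, h4, h5⟩ := h.mon c i l
  set w := c • (s ^ i * r ^ l) with hw
  have hwu : IsUnit w := isUnit_of_pow_alg (p := p) (x := c ^ p * x ^ i * z ^ l)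
    (mul_ne_zero (mul_ne_zero (pow_ne_zero _ hc) (pow_ne_zero _ h.x0)) (pow_ne_zero _ h.z0)) h5
  refine ⟨u + (i : F) • w, s, v + (l : F) • w, r, ?_, ?_, ?_, ?_, ?_, h.sr, h.sp, h.rp, ?_, ?_, h.x0, h.z0⟩
  · rw [add_mul, h.us, smul_mul_assoc, ← h3.eq, mul_add, mul_smul_comm (i : F) s w]; abel
  · rw [add_mul, h.vr, smul_mul_assoc, ← h4.eq, mul_add, mul_smul_comm (l : F) r w]; abel
  · rw [Commute, SemiconjBy]
    simp only [add_mul, mul_add, smul_mul_assoc, mul_smul_comm, h1, h2, h.uv.eq]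
    module
  · exact h.ur.add_left (h4.symm.smul_left _)
  · exact h.vs.add_left (h3.symm.smul_left _)
  · rw [wp_add i hwu h1, h5, h.ua, Algebra.smul_def, map_add, map_mul _ (i : F)]
  · rw [wp_add l hwu h2, h5, h.vb, Algebra.smul_def, map_add, map_mul _ (l : F)]

/-- monomial change of variables -/
theorem HasSt.om {a x b z : F} (h : HasSt p R a x b z) (c : F) (hc : c ≠ 0) (i m m' : ℕ)
    (hm : (m : F) * m' = 1) :
    HasSt p R (a - i * m' * b) x (m' * b) (c ^ p * x ^ i * z ^ m) := by
  haveI : CharP R p := charP_of_injective_algebraMap (algebraMap F R).injective p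
  obtain ⟨u, s, v, r, h⟩ := h
  obtain ⟨h1, h2, h3, h4, h5⟩ := h.mon c i m
  set w := c • (s ^ i * r ^ m) with hw
  have hnat : ∀ n : ℕ, (n : F) ^ p = n := natCast_pow_char
  refine ⟨u - ((i : F) * m') • v, s, (m' : F) • v, w, ?_, ?_, ?_, ?_, ?_, h3, h.sp, h5, ?_, ?_, h.x0,
    mul_ne_zero (mul_ne_zero (pow_ne_zero _ hc) (pow_ne_zero _ h.x0)) (pow_ne_zero _ h.z0)⟩
  · rw [sub_mul, h.us, smul_mul_assoc, h.vs.eq, mul_sub, mul_smul_comm]; abel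
  · rw [smul_mul_assoc, h2, smul_add, mul_smul_comm, smul_smul, mul_comm (m' : F), hm, one_smul]
  · exact (h.uv.sub_left ((Commute.refl v).smul_left _)).smul_right _
  · rw [Commute, SemiconjBy]
    simp only [sub_mul, mul_sub, smul_mul_assoc, mul_smul_comm, h1, h2, smul_add, smul_smul]
    rw [show (i : F) * m' * m = i by rw [mul_assoc, mul_comm (m' : F), hm, mul_one]]
    abel
  · exact h.vs.smul_left _
  · rw [sub_pow_char_of_commute p (h.uv.smul_right _), smul_pow, mul_pow, hnat, hnat]
    have : u ^ p - ((i : F) * m') • v ^ p - (u - ((i : F) * m') • v) = (u ^ p - u) - ((i : F) * m') • (v ^ p - v) := by module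
    rw [this, h.ua, h.vb, Algebra.smul_def]; simp
  · rw [smul_pow, hnat, ← smul_sub, h.vb, Algebra.smul_def]; simp

theorem HasSt.oadd {a x b z : F} (h : HasSt p R a x b z) (hxz : x + z ≠ 0) :
    HasSt p R (a * (x + z) / x) (x + z) (b - a * z / x) z := by
  haveI : CharP R p := charP_of_injective_algebraMap (algebraMap F R).injective p
  have hp : p.Prime := Fact.out
  obtain ⟨u, s, v, r, h⟩ := h
  obtain ⟨s, rfl⟩ := isUnit_of_pow_alg (p := p) h.x0 h.sp
  obtain ⟨r, rfl⟩ := isUnit_of_pow_alg (p := p) h.z0 h.rp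
  have hsr : (s + r : R) ^ p = algebraMap F R (x + z) := by
    rw [add_pow_char_of_commute p h.sr, h.sp, h.rp, map_add]
  obtain ⟨y, hy⟩ := isUnit_of_pow_alg (p := p) hxz hsr
  have h1 : ¬ p ∣ 1 := hp.one_lt.ne' ∘ Nat.dvd_one.1
  set P : R := ↑s⁻¹ * u with hP
  set Q : R := ↑r⁻¹ * v with hQ
  have hu : u = s * P := by rw [hP, Units.mul_inv_cancel_left]
  have hv : v = r * Q := by rw [hQ, Units.mul_inv_cancel_left]
  have hPs : P * s = s * P + 1 := by
    rw [hP, mul_assoc, h.us, mul_add, Units.inv_mul, Units.inv_mul_cancel_left, Units.mul_inv_cancel_left]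
  have hQr : Q * r = r * Q + 1 := by
    rw [hQ, mul_assoc, h.vr, mul_add, Units.inv_mul, Units.inv_mul_cancel_left, Units.mul_inv_cancel_left]
  have hrs' : Commute (↑r⁻¹ : R) ↑s⁻¹ := by
    have : Commute (r : R) ↑s⁻¹ := Commute.units_inv_right h.sr.symm
    exact Commute.units_inv_left this
  have hPr : Commute P (r : R) := (Commute.units_inv_left h.sr).mul_left h.ur
  have hQs : Commute Q (s : R) := (Commute.units_inv_left h.sr.symm).mul_left h.vs
  have hPQ : Commute P Q := by
    have a1 : Commute u (↑r⁻¹ : R) := Commute.units_inv_right h.ur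
    have a2 : Commute v (↑s⁻¹ : R) := Commute.units_inv_right h.vs
    exact (hrs'.symm.mul_right a2.symm).mul_left (a1.mul_right h.uv)
  have hPp : P ^ p = algebraMap F R (a / x) := by
    have e1 := weyl_pow (p := p) s u 1 h1 (by rw [h.us, mul_add]; simp)
    rw [← hP] at e1
    have e2 : (s : R) ^ p * P ^ p = u ^ p - u := by
      rw [e1, units_pow_cancel]
    rw [h.sp, h.ua] at e2
    rw [div_eq_inv_mul, map_mul, ← e2, ← mul_assoc, ← map_mul, inv_mul_cancel₀ h.x0]; simp
  have hQp : Q ^ p = algebraMap F R (b / z) := by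
    have e1 := weyl_pow (p := p) r v 1 h1 (by rw [h.vr, mul_add]; simp)
    rw [← hQ] at e1
    have e2 : (r : R) ^ p * Q ^ p = v ^ p - v := by
      rw [e1, units_pow_cancel]
    rw [h.rp, h.vb] at e2
    rw [div_eq_inv_mul, map_mul, ← e2, ← mul_assoc, ← map_mul, inv_mul_cancel₀ h.z0]; simp
  have hPy : P * y = y * P + 1 := by
    rw [hy, mul_add, hPs, hPr.eq]; noncomm_ring
  have hQ'y : Commute (Q - P) (y : R) := by
    rw [hy, Commute, SemiconjBy, sub_mul, mul_add, mul_add, hQs.eq, hQr, hPs, hPr.eq]; noncomm_ring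
  have hQ'r : (Q - P) * r = r * (Q - P) + 1 := by
    rw [sub_mul, hQr, hPr.eq]; noncomm_ring
  have hyr : Commute (y : R) r := by rw [hy]; exact h.sr.add_left (Commute.refl _)
  have hPQ' : Commute P (Q - P) := hPQ.sub_right (Commute.refl _)
  have us' : (y * P : R) * y = y * (y * P) + y := by rw [mul_assoc, hPy, mul_add, mul_one]
  have vr' : (r * (Q - P) : R) * r = r * (r * (Q - P)) + r := by rw [mul_assoc, hQ'r, mul_add, mul_one]
  refine ⟨y * P, y, r * (Q - P), r, us', vr', ?_, ?_, ?_, ?_, ?_, h.rp, ?_, ?_, hxz, h.z0⟩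
  · exact (hyr.mul_right hQ'y.symm).mul_left (hPr.mul_right hPQ')
  · exact hyr.mul_left hPr
  · exact hyr.symm.mul_left hQ'y
  · exact hyr
  · rw [hy, hsr]
  · have e1 := weyl_pow (p := p) y (y * P) 1 h1 (by rw [us', mul_add]; simp)
    rw [Units.inv_mul_cancel_left] at e1
    have e2 : (y : R) ^ p * P ^ p = (y * P) ^ p - y * P := by
      rw [e1, units_pow_cancel]
    rw [← e2, hPp, hy, hsr, ← map_mul]
    congr 1; ring
  · have e1 := weyl_pow (p := p) r (r * (Q - P)) 1 h1 (by rw [vr', mul_add]; simp)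
    rw [Units.inv_mul_cancel_left] at e1
    have e2 : (r : R) ^ p * (Q - P) ^ p = (r * (Q - P)) ^ p - r * (Q - P) := by
      rw [e1, units_pow_cancel]
    rw [← e2, sub_pow_char_of_commute p hPQ.symm, hPp, hQp, h.rp, ← map_sub, ← map_mul]
    congr 1
    have := h.z0
    have := h.x0
    field_simp

theorem HasSt.oa {a x b z : F} (h : HasSt p R a x b z) (c : F) (hc : c ≠ 0) (i m n q : ℕ)
    (hnm : n * m = 1 + p * q) (hx' : x + c ^ p * x ^ i * z ^ m ≠ 0) :
    HasSt p R ((a - i * n * b) * (x + c ^ p * x ^ i * z ^ m) / x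
        + i * (n * b - (a - i * n * b) * (c ^ p * x ^ i * z ^ m) / x)) (x + c ^ p * x ^ i * z ^ m)
      (b - m * (a - i * n * b) * (c ^ p * x ^ i * z ^ m) / x)
      (z * (x / (x + c ^ p * x ^ i * z ^ m)) ^ (i * n)) := by
  have hp : p.Prime := Fact.out
  have hx0 : x ≠ 0 := by obtain ⟨u, s, v, r, h⟩ := h; exact h.x0
  have hz0 : z ≠ 0 := by obtain ⟨u, s, v, r, h⟩ := h; exact h.z0
  have hmn : (m : F) * n = 1 := by
    have : ((n * m : ℕ) : F) = 1 := by rw [hnm]; push_cast; rw [CharP.cast_eq_zero]; ring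
    rw [← this]; push_cast; ring
  have h1 := (h.om c hc i m n hmn).oadd hx'
  set ω := c ^ p * x ^ i * z ^ m with hω
  set a1 := a - i * n * b with ha1
  set x' := x + ω with hxx
  have hc' : (c ^ n * z ^ q * x' ^ (i * n))⁻¹ ≠ 0 :=
    inv_ne_zero (mul_ne_zero (mul_ne_zero (pow_ne_zero _ hc) (pow_ne_zero _ hz0)) (pow_ne_zero _ hx'))
  have h2 := h1.om _ hc' ((p - 1) * (i * n)) n m (by rw [mul_comm, hmn])
  have hpc : ((p - 1 : ℕ) : F) = -1 := by
    rw [Nat.cast_sub hp.one_lt.le, CharP.cast_eq_zero]; simp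
  convert h2 using 1
  · push_cast
    rw [hpc]
    linear_combination (-i * (n * b - a1 * ω / x)) * hmn
  · linear_combination (-b) * hmn
  · have e1 : ω ^ n = (c ^ n) ^ p * x ^ (i * n) * (z * (z ^ q) ^ p) := by
      rw [hω, mul_pow, mul_pow, ← pow_mul, ← pow_mul, ← pow_mul, ← pow_mul, mul_comm p n]
      congr 1
      rw [← pow_mul, ← pow_succ']; congr 1; rw [mul_comm m, hnm, mul_comm p q, add_comm]
    have e2 : (x' ^ (i * n)) ^ p = x' ^ ((p - 1) * (i * n)) * x' ^ (i * n) := by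
      rw [← pow_add, ← pow_mul]; congr 1
      obtain ⟨p', rfl⟩ : ∃ p', p = p' + 1 := ⟨p - 1, by have := hp.pos; omega⟩
      simp; ring
    rw [inv_pow, mul_pow, mul_pow, e1, e2, div_pow]
    have := pow_ne_zero n hc
    have := pow_ne_zero q hz0
    have a3 := pow_ne_zero (i * n) hx'
    have a4 := pow_ne_zero ((p - 1) * (i * n)) hx'
    field_simp
end St
end

noncomputable section

/-- leading coefficient calculus of a complete discretely valued field of characteristic `p`. -/
structure ResSys (p : ℕ) (F k : Type) [Field F] [Field k] where
  Res : ℤ → F → k → Prop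
  add : ∀ {n a b α β}, Res n a α → Res n b β → Res n (a + b) (α + β)
  mul : ∀ {n m a b α β}, Res n a α → Res m b β → Res (n + m) (a * b) (α * β)
  neg : ∀ {n a α}, Res n a α → Res n (-a) (-α)
  inv : ∀ {n a α}, Res n a α → α ≠ 0 → Res (-n) a⁻¹ α⁻¹
  one : Res 0 1 1
  zero_iff : ∀ {n a}, Res n a 0 ↔ ∃ α, Res (n - 1) a α
  res_zero : ∀ {n α}, Res n 0 α → α = 0
  lift : ∀ n α, ∃ a, Res n a α
  wp : ∀ {a α}, Res (-1) a α → ∃ c, a = c ^ p - c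
  exhaust : ∀ a, ∃ (n : ℕ) (α : k), Res n a α

namespace ResSys
variable {p : ℕ} {F k : Type} [Field F] [Field k] (S : ResSys p F k)

theorem mono {m n : ℤ} (h : m < n) {a : F} {α : k} (ha : S.Res m a α) : S.Res n a 0 := by
  obtain ⟨d, rfl⟩ : ∃ d : ℕ, n = m + 1 + d := ⟨(n - m - 1).toNat, by omega⟩
  induction d with
  | zero => exact S.zero_iff.2 ⟨α, by simpa using ha⟩
  | succ d ih => exact S.zero_iff.2 ⟨0, by convert ih (by omega) using 1; push_cast; ring⟩

theorem pow {n : ℤ} {a : F} {α : k} (ha : S.Res n a α) (m : ℕ) : S.Res (m * n) (a ^ m) (α ^ m) := by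
  induction m with
  | zero => simpa using S.one
  | succ m ih =>
    rw [pow_succ, pow_succ]
    convert S.mul ih ha using 1; push_cast; ring

theorem zero (n : ℤ) : S.Res n 0 0 := by
  obtain ⟨a, ha⟩ := S.lift n 0
  have := S.add ha (S.neg ha)
  simpa using this

theorem nat (i : ℕ) : S.Res 0 (i : F) (i : k) := by
  induction i with
  | zero => simpa using S.zero 0
  | succ i ih => push_cast; exact S.add ih S.one

theorem natmul (i : ℕ) {n : ℤ} {a : F} {α : k} (ha : S.Res n a α) : S.Res n (i * a) (i * α) := by
  simpa using S.mul (S.nat i) ha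

theorem sub {n a b α β} (h : S.Res n a α) (h' : S.Res n b β) : S.Res n (a - b) (α - β) := by
  rw [sub_eq_add_neg, sub_eq_add_neg]; exact S.add h (S.neg h')

theorem div {n m a b α β} (h : S.Res n a α) (h' : S.Res m b β) (hβ : β ≠ 0) :
    S.Res (n - m) (a / b) (α / β) := by
  rw [div_eq_mul_inv, div_eq_mul_inv, sub_eq_add_neg]; exact S.mul h (S.inv h' hβ)

theorem ne_zero {n a α} (h : S.Res n a α) (hα : α ≠ 0) : a ≠ 0 := by
  rintro rfl
  exact hα (S.res_zero h)
end ResSys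

section descent
variable {p : ℕ} [Fact p.Prime] {F k R : Type} [Field F] [CharP F p] [Field k] [CharP k p] [Ring R] [Algebra F R] [Nontrivial R]
  (S : ResSys p F k)

theorem exists_nmq {m : ℕ} (hm : ¬ p ∣ m) : ∃ n q : ℕ, n * m = 1 + p * q := by
  have hp : p.Prime := Fact.out
  obtain ⟨n, hn, h⟩ := Nat.exists_mul_mod_eq_one_of_coprime (((Nat.Prime.coprime_iff_not_dvd hp).2 hm).symm) hp.one_lt
  refine ⟨n, m * n / p, ?_⟩
  have h2 := Nat.mod_add_div (m * n) p
  rw [h] at h2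
  rw [mul_comm n]
  exact h2.symm

theorem oa_res {a x b z c : F} (h : HasSt p R a x b z) {e f N j : ℤ} {ξ ζ α β c0 : k} (hx : S.Res e x ξ) (hz : S.Res f z ζ)
    (hξ : ξ ≠ 0) (ha : S.Res N a α) (hb : S.Res j b β) (hjN : j < N)
    (hc : S.Res 0 c c0) (hc0 : c0 ≠ 0) (i m : ℕ) (hm : ¬ p ∣ m) (hlt : i * e + m * f < e)
    (hj : N + (i * e + m * f) - e = j) :
    ∃ a' x' b' z', HasSt p R a' x' b' z' ∧ S.Res e x' ξ ∧ S.Res f z' ζ ∧ S.Res N a' α ∧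
      S.Res j b' (β - m * α * (c0 ^ p * ξ ^ i * ζ ^ m) / ξ) := by
  obtain ⟨n, q, hnm⟩ := exists_nmq hm
  have hω : S.Res (i * e + m * f) (c ^ p * x ^ i * z ^ m) (c0 ^ p * ξ ^ i * ζ ^ m) := by
    have := S.mul (S.mul (S.pow hc p) (S.pow hx i)) (S.pow hz m)
    simpa using this
  have hx' : S.Res e (x + c ^ p * x ^ i * z ^ m) ξ := by
    simpa using S.add hx (S.mono hlt hω)
  have key := h.oa c (S.ne_zero hc hc0) i m n q hnm (S.ne_zero hx' hξ)
  set ω := c ^ p * x ^ i * z ^ m with hωd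
  set ω0 := c0 ^ p * ξ ^ i * ζ ^ m with hω0
  set x' := x + ω with hxd
  have ha1 : S.Res N (a - i * n * b) α := by
    have := S.sub ha (S.mono hjN (S.natmul i (S.natmul n hb)))
    rw [sub_zero, ← mul_assoc] at this
    exact this
  set a1 := a - i * n * b with ha1d
  have hq : S.Res j (a1 * ω / x) (α * ω0 / ξ) := by
    have := S.div (S.mul ha1 hω) hx hξ
    rwa [hj] at this
  refine ⟨_, _, _, _, key, hx', ?_, ?_, ?_⟩
  · have h1 : S.Res 0 (x / x') 1 := by
      have := S.div hx hx' hξ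
      rwa [sub_self, div_self hξ] at this
    have := S.mul hz (S.pow h1 (i * n))
    simpa using this
  · have h1 : S.Res 0 (x' / x) 1 := by
      have := S.div hx' hx hξ
      rwa [sub_self, div_self hξ] at this
    have h2 := S.mul ha1 h1
    rw [add_zero, mul_one] at h2
    have h3 := S.mono hjN (S.natmul i (S.sub (S.natmul n hb) hq))
    have := S.add h2 h3
    rw [add_zero, ← mul_div_assoc] at this
    exact this
  · have := S.sub hb (S.natmul m hq)
    convert this using 1 <;> ring

theorem closure_move (G : k → Prop) (U : Set k) (hU : ∀ β γ, γ ∈ U → G β → G (β + γ)) {γ : k}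
    (hγ : γ ∈ AddSubmonoid.closure U) : ∀ β, G β → G (β + γ) := by
  induction hγ using AddSubmonoid.closure_induction with
  | mem x hx => exact fun β h => hU β x hx h
  | zero => simp
  | add x y _ _ h1 h2 => intro β h; rw [← add_assoc]; exact h2 _ (h1 _ h)

variable (p) in
/-- span of the monomials with exponent prime to `p` -/
def Vt (t : k) : AddSubmonoid k := AddSubmonoid.closure {y | ∃ (e : k) (i : ℕ), ¬ p ∣ i ∧ y = e ^ p * t ^ i}

variable (p) in
def Wt (t : k) : AddSubmonoid k := AddSubmonoid.closure {y | ∃ (e : k) (i : ℕ), y = e ^ p * t ^ i}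

variable (p) in
/-- `1, t, …, t^(p-1)` span `k` over `k^p` -/
def Hk (t : k) : Prop := ∀ α : k, ∃ c : ℕ → k, α = ∑ i ∈ Finset.range p, c i ^ p * t ^ i

variable (p) in
def GoodAt (t : k) : Prop := ∀ α : k, ∃ c : k, α - (c ^ p - c) ∈ Vt p t

theorem Hk.wt {t : k} (h : Hk p t) (α : k) : α ∈ Wt p t := by
  obtain ⟨c, rfl⟩ := h α
  exact sum_mem fun i _ => AddSubmonoid.subset_closure ⟨c i, i, rfl⟩

theorem Hk.vt {t : k} (h : Hk p t) (α : k) : ∃ c : k, α - c ^ p ∈ Vt p t := by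
  have hp : p.Prime := Fact.out
  obtain ⟨c, rfl⟩ := h α
  refine ⟨c 0, ?_⟩
  obtain ⟨p', hp'⟩ : ∃ p', p = p' + 1 := ⟨p - 1, by have := hp.pos; omega⟩
  rw [show Finset.range p = Finset.range (p' + 1) by rw [hp'], Finset.sum_range_succ']
  simp only [pow_zero, mul_one, add_sub_cancel_right]
  refine sum_mem fun i hi => AddSubmonoid.subset_closure ⟨c (i + 1), i + 1, ?_, rfl⟩
  intro hd
  have := Nat.le_of_dvd (by omega) hd
  have := Finset.mem_range.1 hi
  omega

theorem scale_pow (i : ℕ) (hi : ¬ p ∣ i) (e : k) : (i : k) * (e / i) ^ p = e ^ p := by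
  have hi' : (i : k) ≠ 0 := fun h => hi ((CharP.cast_eq_zero_iff k p i).1 h)
  rw [div_pow, natCast_pow_char]; field_simp

theorem theta_res {x z : F} {t : k} (hx : S.Res 0 x t) (hz : S.Res (-1) z 1) {c : F} {c0 : k} {e j : ℤ}
    (hc : S.Res e c c0) (i l : ℕ) (hj : p * e - l = j) : S.Res j (c ^ p * x ^ i * z ^ l) (c0 ^ p * t ^ i) := by
  have := S.mul (S.mul (S.pow hc p) (S.pow hx i)) (S.pow hz l)
  rw [one_pow, mul_one] at this
  convert this using 1
  rw [← hj]; ring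

/-- killing the residue of `a` at level `pM`, keeping everything else. -/
theorem killA {x b z a : F} {t α : k} (h : HasSt p R a x b z) (hx : S.Res 0 x t) (hz : S.Res (-1) z 1) (M : ℕ)
    (hk : Hk p t) (hg : GoodAt p t) (ha : S.Res (p * M : ℕ) a α) :
    ∃ a', HasSt p R a' x b z ∧ S.Res (p * M : ℕ) a' 0 := by
  have hp : p.Prime := Fact.out
  let G : k → Prop := fun α => ∃ a', HasSt p R a' x b z ∧ S.Res (p * M : ℕ) a' α
  have hV : ∀ γ ∈ Vt p t, ∀ α, G α → G (α + γ) := by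
    intro γ hγ
    refine closure_move G _ ?_ hγ
    rintro α _ ⟨e, i, hi, rfl⟩ ⟨a', h1, h2⟩
    obtain ⟨c, hc⟩ := S.lift M (e / i)
    have h3 := h1.oe c i 0
    have h4 := S.add h2 (S.natmul i (theta_res S hx hz hc i 0 (j := (p * M : ℕ)) (by push_cast; ring)))
    rw [← mul_assoc (i : k), scale_pow i hi] at h4
    exact ⟨_, by simpa using h3, by simpa using h4⟩
  have hG : G α := ⟨a, h, ha⟩
  rcases Nat.eq_zero_or_pos M with hM | hM
  · obtain ⟨c0, hc0⟩ := hg (-α)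
    obtain ⟨a1, h1, h2⟩ := hV _ hc0 _ hG
    obtain ⟨c, hc⟩ := S.lift 0 c0
    refine ⟨_, h1.pw c, ?_⟩
    subst hM
    have hcp : S.Res (p * 0 : ℕ) (c ^ p) (c0 ^ p) := by simpa using S.pow hc p
    have := S.add h2 (S.sub hcp (by simpa using hc))
    convert this using 1
    ring
  · obtain ⟨c0, hc0⟩ := hk.vt (-α)
    obtain ⟨a1, h1, h2⟩ := hV _ hc0 _ hG
    obtain ⟨c, hc⟩ := S.lift M c0
    refine ⟨_, h1.pw c, ?_⟩
    have hlt : (M : ℤ) < (p * M : ℕ) := by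
      have := hp.two_le
      exact_mod_cast (by nlinarith : M < p * M)
    have := S.add h2 (S.sub (S.pow hc p) (S.mono (n := p * M) (by exact_mod_cast hlt) hc))
    convert this using 1
    ring

theorem cast_pred_mul (j : ℕ) : (((p - 1) * j : ℕ) : k) = - j := by
  have hp : p.Prime := Fact.out
  rw [Nat.cast_mul, Nat.cast_sub hp.one_lt.le, CharP.cast_eq_zero]; simp

/-- moving at levels `j` prime to `p`. -/
theorem killB {x b z a : F} {t β : k} (h : HasSt p R a x b z) (hx : S.Res 0 x t) (hz : S.Res (-1) z 1) (j : ℕ)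
    (hj : ¬ p ∣ j) (hk : Hk p t) (P : F → Prop) (hP : ∀ a θ τ, P a → S.Res j θ τ → P (a + θ)) (ha : P a)
    (hb : S.Res j b β) : ∃ a' b', HasSt p R a' x b' z ∧ S.Res j b' 0 ∧ P a' := by
  have hp : p.Prime := Fact.out
  let G : k → Prop := fun β => ∃ a' b', HasSt p R a' x b' z ∧ S.Res j b' β ∧ P a'
  have hV : ∀ γ ∈ Wt p t, ∀ α, G α → G (α + γ) := by
    intro γ hγ
    refine closure_move G _ ?_ hγ
    rintro α _ ⟨e, i, rfl⟩ ⟨a', b', h1, h2, h3⟩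
    obtain ⟨c, hc⟩ := S.lift j (- (e / j))
    have hθ := theta_res S hx hz hc i ((p - 1) * j) (j := j) (by
      rw [Nat.cast_mul, Nat.cast_sub hp.one_lt.le]; push_cast; ring)
    refine ⟨_, _, h1.oe c i ((p - 1) * j), ?_, hP _ _ _ h3 (S.natmul i hθ)⟩
    have h4 := S.add h2 (S.natmul ((p - 1) * j) hθ)
    rw [cast_pred_mul (k := k)] at h4
    have h5 : e ^ p * t ^ i = -(j : k) * ((-(e / j)) ^ p * t ^ i) := by
      rw [← scale_pow j hj e, neg_pow, neg_one_pow_char]; ring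
    rw [h5]
    exact h4
  have hG : G β := ⟨a, b, h, hb, ha⟩
  have := hV (-β) (hk.wt _) _ hG
  rwa [add_neg_cancel] at this

theorem moveA {x b z a : F} {t α : k} (h : HasSt p R a x b z) (hx : S.Res 0 x t) (hz : S.Res (-1) z 1) (j : ℕ)
    (P : F → Prop) (hP : ∀ a θ τ, P a → S.Res j θ τ → P (a + θ)) (hb : P b)
    (ha : S.Res j a α) (hα : -α ∈ Vt p t) : ∃ a' b', HasSt p R a' x b' z ∧ S.Res j a' 0 ∧ P b' := by
  have hp : p.Prime := Fact.out
  let G : k → Prop := fun α => ∃ a' b', HasSt p R a' x b' z ∧ S.Res j a' α ∧ P b'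
  have hV : ∀ γ ∈ Vt p t, ∀ α, G α → G (α + γ) := by
    intro γ hγ
    refine closure_move G _ ?_ hγ
    rintro α _ ⟨e, i, hi, rfl⟩ ⟨a', b', h1, h2, h3⟩
    obtain ⟨c, hc⟩ := S.lift j (e / i)
    have hθ := theta_res S hx hz hc i ((p - 1) * j) (j := j) (by
      rw [Nat.cast_mul, Nat.cast_sub hp.one_lt.le]; push_cast; ring)
    refine ⟨_, _, h1.oe c i ((p - 1) * j), ?_, hP _ _ _ h3 (S.natmul _ hθ)⟩
    have h4 := S.add h2 (S.natmul i hθ)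
    rwa [← mul_assoc (i : k), scale_pow i hi] at h4
  have hG : G α := ⟨a, b, h, ha, hb⟩
  have := hV (-α) hα _ hG
  rwa [add_neg_cancel] at this

variable (R) in
/-- the possible outcomes of the descent -/
def Out (t : k) : Prop :=
  (∃ x z : F, HasSt p R 0 x 0 z) ∨ (∃ a x z : F, HasSt p R a x 0 z ∧ S.Res 0 x t) ∨
  (∃ (M : ℕ) (x b z : F) (g : k), HasSt p R 0 x b z ∧ S.Res (p * M : ℕ) b g ∧
    ((0 < M ∧ ∀ c, c ^ p ≠ g) ∨ (M = 0 ∧ ∀ c, c ^ p - c ≠ g)))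

theorem HasSt.killJ {x b z a : F} {α : k} (h : HasSt p R a x b z) (ha : S.Res (-1) a α) : HasSt p R 0 x b z := by
  obtain ⟨c, hc⟩ := S.wp (S.neg ha)
  have := h.pw c
  rwa [← hc, add_neg_cancel] at this

theorem caseI {t α : k} (ht : t ≠ 0) (hk : Hk p t) (N : ℕ) (hN : ¬ p ∣ N) (hα : α ≠ 0) (m : ℕ) (hm : m ≤ N) :
    ∀ a x b z β, HasSt p R a x b z → S.Res 0 x t → S.Res (-1) z 1 → S.Res N a α →
      S.Res (m - 1) b β → Out R S t := by
  have hp : p.Prime := Fact.out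
  induction m with
  | zero =>
    intro a x b z β h hx hz ha hb
    right; left
    exact ⟨a, x, z, ((h.swap).killJ S (by simpa using hb)).swap, hx⟩
  | succ j ih =>
    intro a x b z β h hx hz ha hb
    have hb : S.Res j b β := by simpa using hb
    by_cases hj : p ∣ j
    · let G : k → Prop := fun β => ∃ a x b z, HasSt p R a x b z ∧ S.Res 0 x t ∧ S.Res (-1) z 1 ∧
        S.Res N a α ∧ S.Res j b β
      have hmN : ¬ p ∣ (N - j) := by
        intro hd
        apply hN
        have := dvd_add hd hj
        rwa [Nat.sub_add_cancel (by omega)] at this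
      have hmk : ((N - j : ℕ) : k) ≠ 0 := fun h => hmN ((CharP.cast_eq_zero_iff k p _).1 h)
      have hG : ∀ γ ∈ Wt p t, ∀ β, G β → G (β + (N - j : ℕ) * α / t * γ) := by
        intro γ hγ
        induction hγ using AddSubmonoid.closure_induction with
        | mem y hy =>
          obtain ⟨e, i, rfl⟩ := hy
          rintro β ⟨a, x, b, z, h, hx, hz, ha, hb⟩
          by_cases he : e = 0
          · subst he
            rw [zero_pow hp.ne_zero, zero_mul, mul_zero, add_zero]
            exact ⟨a, x, b, z, h, hx, hz, ha, hb⟩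
          · obtain ⟨c, hc⟩ := S.lift 0 (-e)
            obtain ⟨a', x', b', z', h', hx', hz', ha', hb'⟩ := oa_res S h hx hz ht ha hb (by omega) hc (neg_ne_zero.2 he) i (N - j) hmN
              (by omega) (by omega)
            refine ⟨a', x', b', z', h', hx', hz', ha', ?_⟩
            convert hb' using 1
            rw [neg_pow, neg_one_pow_char]; ring
        | zero => intro β h; simpa using h
        | add y y' _ _ h1 h2 => intro β h; rw [mul_add, ← add_assoc]; exact h2 _ (h1 _ h)
      obtain ⟨a', x', b', z', h', hx', hz', ha', hb'⟩ := hG (-β / ((N - j : ℕ) * α / t)) (hk.wt _) β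
        ⟨a, x, b, z, h, hx, hz, ha, hb⟩
      rw [mul_div_cancel₀ _ (div_ne_zero (mul_ne_zero hmk hα) ht), add_neg_cancel] at hb'
      obtain ⟨β', hb''⟩ := S.zero_iff.1 hb'
      exact ih (by omega) a' x' b' z' β' h' hx' hz' ha' hb''
    · obtain ⟨a', b', h', hb', ha'⟩ := killB S h hx hz j hj hk (fun a => S.Res N a α) (by
        intro a θ τ h1 h2
        have := S.add h1 (S.mono (n := N) (by omega) h2)
        rwa [add_zero] at this) ha hb
      obtain ⟨β', hb''⟩ := S.zero_iff.1 hb'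
      exact ih (by omega) a' x b' z β' h' hx hz ha' hb''

theorem caseII {t β : k} (ht : t ≠ 0) (hk : Hk p t) (hg : GoodAt p t) (M : ℕ) (hM : 0 < M) (hβ : ∀ c, c ^ p ≠ β)
    (m : ℕ) (hm : m ≤ p * M) :
    ∀ a x b z α, HasSt p R a x b z → S.Res 0 x t → S.Res (-1) z 1 → S.Res (p * M : ℕ) b β →
      S.Res (m - 1) a α → Out R S t := by
  have hp : p.Prime := Fact.out
  induction m with
  | zero =>
    intro a x b z α h hx hz hb ha
    right; right
    exact ⟨M, x, b, z, β, h.killJ S (by simpa using ha), hb, Or.inl ⟨hM, hβ⟩⟩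
  | succ j ih =>
    intro a x b z α h hx hz hb ha
    have ha : S.Res j a α := by simpa using ha
    by_cases hj : p ∣ j
    · obtain ⟨j', rfl⟩ := hj
      obtain ⟨a', h', ha'⟩ := killA S h hx hz j' hk hg ha
      obtain ⟨α', ha''⟩ := S.zero_iff.1 ha'
      exact ih (by omega) a' x b z α' h' hx hz hb ha''
    · -- first kill the zeroth component
      obtain ⟨γ, hγ⟩ := hk β
      obtain ⟨i0, hi0, hγ0⟩ : ∃ i0 ∈ Finset.range p, i0 ≠ 0 ∧ γ i0 ≠ 0 := by
        by_contra hcon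
        push Not at hcon
        apply hβ (γ 0)
        rw [hγ, Finset.sum_eq_single 0]
        · simp
        · intro i hi hi0
          rw [hcon i hi hi0, zero_pow hp.ne_zero, zero_mul]
        · intro h0; exact absurd (Finset.mem_range.2 hp.pos) h0
      have hi0p := Finset.mem_range.1 hi0
      obtain ⟨α0, hα0⟩ := hk.vt (-α)
      -- we want `-(α - m β c^p t^m) ∈ V`
      have hmp : ¬ p ∣ (p - i0) := fun hd => by
        have := Nat.le_of_dvd (by omega) hd
        omega
      have hmk : ((p - i0 : ℕ) : k) ≠ 0 := fun h => hmp ((CharP.cast_eq_zero_iff k p _).1 h)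
      have step : ∃ a' x' b' z' α', HasSt p R a' x' b' z' ∧ S.Res 0 x' t ∧ S.Res (-1) z' 1 ∧
          S.Res (p * M : ℕ) b' β ∧ S.Res j a' α' ∧ -α' ∈ Vt p t := by
        by_cases h0 : α0 = 0
        · refine ⟨a, x, b, z, α, h, hx, hz, hb, ha, ?_⟩
          simpa [h0, zero_pow hp.ne_zero] using hα0
        · let c0 := - α0 / ((p - i0 : ℕ) * γ i0 * t)
          have hc0 : c0 ≠ 0 := div_ne_zero (neg_ne_zero.2 h0) (mul_ne_zero (mul_ne_zero hmk hγ0.2) ht)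
          obtain ⟨c, hc⟩ := S.lift 0 c0
          obtain ⟨b', z', a', x', h', hz', hx', hb', ha'⟩ := oa_res S h.swap hz hx one_ne_zero hb ha (by omega) hc hc0
            (p * M - j + 1) (p - i0) hmp (by omega) (by omega)
          refine ⟨a', x', b', z', _, h'.swap, hx', hz', hb', ha', ?_⟩
          rw [one_pow, mul_one, div_one]
          have e1 : ((p - i0 : ℕ) : k) * (c0 ^ p * γ i0 ^ p * t ^ p) = - α0 ^ p := by
            have : c0 * γ i0 * t = - α0 / (p - i0 : ℕ) := by
              simp only [c0]; have := hγ0.2; field_simp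
            rw [← mul_pow, ← mul_pow, this, scale_pow _ hmp, neg_pow, neg_one_pow_char]; ring
          have e2 : (p - i0 : ℕ) * β * (c0 ^ p * t ^ (p - i0)) =
              - α0 ^ p + ∑ i ∈ (Finset.range p).erase i0, ((p - i0 : ℕ) * γ i * c0) ^ p * t ^ (i + (p - i0)) := by
            rw [← e1]
            conv_lhs => rw [hγ]
            rw [← Finset.add_sum_erase _ _ hi0, mul_add, add_mul]
            congr 1
            · have : t ^ p = t ^ i0 * t ^ (p - i0) := by rw [← pow_add]; congr 1; omega
              rw [this]; ring
            · rw [Finset.mul_sum, Finset.sum_mul]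
              refine Finset.sum_congr rfl fun i _ => ?_
              rw [mul_pow, mul_pow, natCast_pow_char, pow_add]; ring
          rw [e2]
          have : -(α - (-α0 ^ p + ∑ i ∈ (Finset.range p).erase i0, ((p - i0 : ℕ) * γ i * c0) ^ p * t ^ (i + (p - i0)))) =
            (-α - α0 ^ p) + ∑ i ∈ (Finset.range p).erase i0, ((p - i0 : ℕ) * γ i * c0) ^ p * t ^ (i + (p - i0)) := by ring
          rw [this]
          refine add_mem hα0 (sum_mem fun i hi => AddSubmonoid.subset_closure ⟨_, _, ?_, rfl⟩)
          rw [Finset.mem_erase, Finset.mem_range] at hi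
          rintro ⟨q, hq⟩
          have : q = 1 := by
            have h1 : p * q < p * 2 := by omega
            have h2 : 0 < p * q := by omega
            have h3 : q < 2 := Nat.lt_of_mul_lt_mul_left h1
            have h4 : 0 < q := Nat.pos_of_mul_pos_left h2
            omega
          subst this
          omega
      obtain ⟨a', x', b', z', α', h', hx', hz', hb', ha', hα'⟩ := step
      obtain ⟨a'', b'', h'', ha'', hb''⟩ := moveA S h' hx' hz' j (fun b => S.Res (p * M : ℕ) b β) (by
        intro a θ τ h1 h2
        have := S.add h1 (S.mono (n := (p * M : ℕ)) (by omega) h2)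
        rwa [add_zero] at this) hb' ha' hα'
      obtain ⟨α'', ha3⟩ := S.zero_iff.1 ha''
      exact ih (by omega) a'' x' b'' z' α'' h'' hx' hz' hb'' ha3

theorem descent {t : k} (ht : t ≠ 0) (hk : Hk p t) (hg : GoodAt p t) (m : ℕ) :
    ∀ (a x b z : F) (α β : k), HasSt p R a x b z → S.Res 0 x t → S.Res (-1) z 1 → S.Res (m - 1) a α →
      S.Res (m - 1) b β → Out R S t := by
  have hp : p.Prime := Fact.out
  induction m with
  | zero =>
    intro a x b z α β h hx hz ha hb
    left
    exact ⟨x, z, ((h.killJ S (by simpa using ha)).swap.killJ S (by simpa using hb)).swap⟩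
  | succ N ih =>
    intro a x b z α β h hx hz ha hb
    have ha : S.Res N a α := by simpa using ha
    have hb : S.Res N b β := by simpa using hb
    by_cases hN : p ∣ N
    · obtain ⟨M, rfl⟩ := hN
      obtain ⟨a', h', ha'⟩ := killA S h hx hz M hk hg ha
      obtain ⟨α', ha''⟩ := S.zero_iff.1 ha'
      rcases Nat.eq_zero_or_pos M with hM | hM
      · subst hM
        by_cases hβ : ∃ c, c ^ p - c = β
        · obtain ⟨c0, rfl⟩ := hβ
          obtain ⟨c, hc⟩ := S.lift 0 (-c0)
          have h2 := (h'.swap.pw c).swap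
          have h3 := S.add hb (S.sub (by simpa using S.pow hc p) (by simpa using hc) : S.Res (p * 0 : ℕ) _ _)
          have h4 : c0 ^ p - c0 + ((-c0) ^ p - -c0) = 0 := by rw [neg_pow, neg_one_pow_char]; ring
          rw [h4] at h3
          obtain ⟨β', hb'⟩ := S.zero_iff.1 h3
          exact ih _ _ _ _ _ _ h2 hx hz ha'' hb'
        · right; right
          refine ⟨0, x, b, z, β, h'.killJ S (by simpa using ha''), hb, Or.inr ⟨rfl, fun c hc => hβ ⟨c, hc⟩⟩⟩
      · by_cases hβ : ∃ c, c ^ p = β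
        · obtain ⟨c0, rfl⟩ := hβ
          obtain ⟨c, hc⟩ := S.lift M (-c0)
          have h2 := (h'.swap.pw c).swap
          have hlt : (M : ℤ) < p * M := by
            have := hp.two_le
            exact_mod_cast (by nlinarith : M < p * M)
          have h3 := S.add hb (S.sub (by exact_mod_cast S.pow hc p) (by exact_mod_cast S.mono hlt hc) : S.Res (p * M : ℕ) _ _)
          have h4 : c0 ^ p + ((-c0) ^ p - 0) = 0 := by rw [neg_pow, neg_one_pow_char]; ring
          rw [h4] at h3
          obtain ⟨β', hb'⟩ := S.zero_iff.1 h3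
          exact ih _ _ _ _ _ _ h2 hx hz ha'' hb'
        · push Not at hβ
          exact caseII S ht hk hg M hM hβ (p * M) le_rfl a' x b z α' h' hx hz hb ha''
    · obtain ⟨a', b', h', hb', α', ha'⟩ := killB S h hx hz N hN hk (fun a => ∃ α, S.Res N a α) (by
        rintro a θ τ ⟨α, h1⟩ h2
        exact ⟨_, S.add h1 h2⟩) ⟨α, ha⟩ hb
      obtain ⟨β', hb''⟩ := S.zero_iff.1 hb'
      by_cases hα : α' = 0
      · subst hα
        obtain ⟨α'', ha''⟩ := S.zero_iff.1 ha'
        exact ih _ _ _ _ _ _ h' hx hz ha'' hb''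
      · exact caseI S ht hk N hN hα N le_rfl a' x b' z β' h' hx hz ha' hb''

theorem descent_main {t : k} (ht : t ≠ 0) (hk : Hk p t) (hg : GoodAt p t) {a x b z : F}
    (h : HasSt p R a x b z) (hx : S.Res 0 x t) (hz : S.Res (-1) z 1) : Out R S t := by
  obtain ⟨n, α, ha⟩ := S.exhaust a
  obtain ⟨m, β, hb⟩ := S.exhaust b
  refine descent S ht hk hg (n + m + 2) a x b z 0 0 h hx hz (S.mono ?_ ha) (S.mono ?_ hb) <;> push_cast <;> omega
end descent
end

noncomputable section

section mkres
variable (p : ℕ) [Fact p.Prime] (O F : Type) [CommRing O] [IsDomain O] [IsDiscreteValuationRing O] [Field F]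
  [Algebra O F] [IsFractionRing O F]

theorem artin_schreier_root [CharP O p] [IsAdicComplete (IsLocalRing.maximalIdeal O) O] (g : O) (hg : g ∈ IsLocalRing.maximalIdeal O) :
    ∃ c : O, g = c ^ p - c := by
  have hp : p.Prime := Fact.out
  have hH : HenselianRing O (IsLocalRing.maximalIdeal O) := inferInstance
  let f : Polynomial O := Polynomial.X ^ p - (Polynomial.X + Polynomial.C g)
  have hf : f.Monic := Polynomial.monic_X_pow_sub (by
    rw [Polynomial.degree_X_add_C]; exact_mod_cast hp.one_lt)
  obtain ⟨a, ha, -⟩ := hH.is_henselian f hf 0 (by simpa [f, hp.ne_zero] using hg) (by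
    simp [f, Polynomial.derivative_X_pow])
  refine ⟨a, ?_⟩
  have : a ^ p - (a + g) = 0 := by simpa [f, Polynomial.IsRoot] using ha
  linear_combination -this

open IsLocalRing in
def mkRes [CharP O p] [IsAdicComplete (IsLocalRing.maximalIdeal O) O] (ϖ : O) (hϖ : Irreducible ϖ) :
    ResSys p F (IsLocalRing.ResidueField O) :=
  have hw : algebraMap O F ϖ ≠ 0 := by
    simpa using hϖ.ne_zero
  have hdv : ∀ f : O, residue O f = 0 ↔ ∃ g, f = g * ϖ := by
    intro f
    rw [residue_eq_zero_iff, hϖ.maximalIdeal_eq, Ideal.mem_span_singleton']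
    simp [eq_comm]
  { Res := fun n a α => ∃ f : O, a = algebraMap O F f * (algebraMap O F ϖ) ^ (-n) ∧ residue O f = α
    add := by
      rintro n _ _ _ _ ⟨f, rfl, rfl⟩ ⟨g, rfl, rfl⟩
      exact ⟨f + g, by rw [map_add, add_mul], map_add _ _ _⟩
    mul := by
      rintro n m _ _ _ _ ⟨f, rfl, rfl⟩ ⟨g, rfl, rfl⟩
      refine ⟨f * g, ?_, map_mul _ _ _⟩
      rw [neg_add, zpow_add₀ hw, map_mul]; ring
    neg := by
      rintro n _ _ ⟨f, rfl, rfl⟩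
      exact ⟨-f, by rw [map_neg, neg_mul], map_neg _ _⟩
    inv := by
      rintro n _ _ ⟨f, rfl, rfl⟩ h
      rw [residue_ne_zero_iff_isUnit] at h
      obtain ⟨u, rfl⟩ := h
      have h1 : algebraMap O F ↑u⁻¹ = (algebraMap O F u)⁻¹ := by
        refine eq_inv_of_mul_eq_one_left ?_
        rw [← map_mul]; simp
      have h2 : residue O ↑u⁻¹ = (residue O u)⁻¹ := by
        refine eq_inv_of_mul_eq_one_left ?_
        rw [← map_mul]; simp
      exact ⟨↑u⁻¹, by rw [mul_inv, h1, zpow_neg _ (-n)], h2⟩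
    one := ⟨1, by simp, by simp⟩
    zero_iff := by
      intro n a
      constructor
      · rintro ⟨f, rfl, hf⟩
        obtain ⟨g, rfl⟩ := (hdv f).1 hf
        refine ⟨_, g, ?_, rfl⟩
        rw [neg_sub, sub_eq_add_neg, zpow_add₀ hw, map_mul, zpow_one]; ring
      · rintro ⟨_, g, rfl, rfl⟩
        refine ⟨g * ϖ, ?_, (hdv _).2 ⟨g, rfl⟩⟩
        rw [neg_sub, sub_eq_add_neg, zpow_add₀ hw, map_mul, zpow_one]; ring
    res_zero := by
      rintro n _ ⟨f, hf, rfl⟩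
      have : algebraMap O F f = 0 := by
        rcases mul_eq_zero.1 hf.symm with h | h
        · exact h
        · exact absurd h (zpow_ne_zero _ hw)
      have : f = 0 := by simpa using this
      simp [this]
    lift := by
      intro n α
      obtain ⟨f, rfl⟩ := residue_surjective α
      exact ⟨_, f, rfl, rfl⟩
    wp := by
      rintro _ _ ⟨f, rfl, rfl⟩
      obtain ⟨c, hc⟩ := artin_schreier_root p O (f * ϖ) (by
        rw [hϖ.maximalIdeal_eq, Ideal.mem_span_singleton']; exact ⟨f, rfl⟩)
      refine ⟨algebraMap O F c, ?_⟩
      rw [← map_pow, ← map_sub, ← hc, map_mul]; simp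
    exhaust := by
      intro a
      by_cases ha : a = 0
      · exact ⟨0, 0, 0, by simp [ha], by simp⟩
      · obtain ⟨n, u, hu⟩ := IsDiscreteValuationRing.exists_units_eq_smul_zpow_of_irreducible hϖ ha
        have ha' : a = algebraMap O F u * algebraMap O F ϖ ^ n := by
          rw [hu, Units.smul_def, Algebra.smul_def]
        by_cases hn : 0 ≤ n
        · obtain ⟨m, rfl⟩ := Int.eq_ofNat_of_zero_le hn
          exact ⟨0, _, u * ϖ ^ m, by rw [ha']; simp, rfl⟩
        · refine ⟨n.natAbs, _, u, ?_, rfl⟩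
          rw [ha']; congr 2; omega }

end mkres
end

noncomputable section

section deriv
variable {p : ℕ} [Fact p.Prime] {F K : Type} [Field F] [CharP F p] [Field K] [Algebra F K]
  {s r : K} {x z : F} (hs : s ^ p = algebraMap F K x) (hr : r ^ p = algebraMap F K z)
  (b : Module.Basis (Fin p × Fin p) F K) (hb : ∀ ij, b ij = s ^ (ij.1 : ℕ) * r ^ (ij.2 : ℕ))

def gradd (w : Fin p × Fin p → F) : K →ₗ[F] K := b.constr F (fun ij => w ij • b ij)

theorem gradd_basis (w : Fin p × Fin p → F) (ij) : gradd b w (b ij) = w ij • b ij := by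
  simp [gradd]

theorem gradd_repr (w : Fin p × Fin p → F) (f : K) (ij) : b.repr (gradd b w f) ij = w ij * b.repr f ij := by
  have : (Finsupp.lapply ij ∘ₗ b.repr.toLinearMap) ∘ₗ gradd b w = w ij • (Finsupp.lapply ij ∘ₗ b.repr.toLinearMap) := by
    refine b.ext fun i' => ?_
    simp only [LinearMap.comp_apply, gradd_basis, LinearMap.smul_apply]
    by_cases h : i' = ij
    · subst h; simp
    · simp [h]
  simpa using LinearMap.congr_fun this f

include hs hr hb in
theorem gradd_mon (w : ℕ → ℕ → F) (hw : ∀ i j, w (i + p) j = w i j) (hw' : ∀ i j, w i (j + p) = w i j) (m l : ℕ) :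
    gradd b (fun ij => w ij.1 ij.2) (s ^ m * r ^ l) = w m l • (s ^ m * r ^ l) := by
  have hp : p.Prime := Fact.out
  induction m using Nat.strong_induction_on generalizing l with
  | _ m ih =>
    rcases lt_or_ge m p with hm | hm
    · induction l using Nat.strong_induction_on with
      | _ l ih2 =>
        rcases lt_or_ge l p with hl | hl
        · have := gradd_basis b (fun ij => w ij.1 ij.2) (⟨m, hm⟩, ⟨l, hl⟩)
          simpa [hb] using this
        · obtain ⟨l', rfl⟩ := Nat.exists_eq_add_of_le' hl
          have h1 := ih2 l' (by have := hp.pos; omega)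
          have h2 : s ^ m * r ^ (l' + p) = z • (s ^ m * r ^ l') := by
            rw [Algebra.smul_def, ← hr]; ring
          rw [h2, map_smul, h1, hw', smul_comm]
    · obtain ⟨m', rfl⟩ := Nat.exists_eq_add_of_le' hm
      have h1 := ih m' (by have := hp.pos; omega) l
      have h2 : s ^ (m' + p) * r ^ l = x • (s ^ m' * r ^ l) := by
        rw [Algebra.smul_def, ← hs]; ring
      rw [h2, map_smul, h1, hw, smul_comm]

include hs hr hb in
theorem gradd_mul (w : ℕ → ℕ → F) (hw : ∀ i j, w (i + p) j = w i j) (hw' : ∀ i j, w i (j + p) = w i j)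
    (hadd : ∀ i j i' j', w (i + i') (j + j') = w i j + w i' j') (f g : K) :
    gradd b (fun ij => w ij.1 ij.2) (f * g) =
      gradd b (fun ij => w ij.1 ij.2) f * g + f * gradd b (fun ij => w ij.1 ij.2) g := by
  set δ := gradd b (fun ij => w ij.1 ij.2) with hδ
  have : (LinearMap.mul F K).compr₂ δ = (LinearMap.mul F K) ∘ₗ δ + (LinearMap.mul F K).compl₂ δ := by
    refine b.ext fun i => b.ext fun j => ?_
    simp only [LinearMap.compr₂_apply, LinearMap.mul_apply', LinearMap.add_apply, LinearMap.comp_apply, LinearMap.compl₂_apply]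
    rw [hδ, gradd_basis, gradd_basis, hb, hb]
    have e : s ^ (i.1 : ℕ) * r ^ (i.2 : ℕ) * (s ^ (j.1 : ℕ) * r ^ (j.2 : ℕ)) = s ^ (i.1 + j.1 : ℕ) * r ^ (i.2 + j.2 : ℕ) := by ring
    rw [e, gradd_mon hs hr b hb w hw hw', hadd, smul_mul_assoc, mul_smul_comm, ← add_smul, e]
  have := LinearMap.congr_fun₂ this f g
  simpa using this

/-- the two commuting logarithmic derivations -/
structure DD (p : ℕ) (F K : Type) [Field F] [Field K] [Algebra F K] (s r : K) where
  δ : K →ₗ[F] K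
  ε : K →ₗ[F] K
  δm : ∀ f g, δ (f * g) = δ f * g + f * δ g
  εm : ∀ f g, ε (f * g) = ε f * g + f * ε g
  δs : δ s = s
  δr : δ r = 0
  εs : ε s = 0
  εr : ε r = r
  comm : ∀ f, δ (ε f) = ε (δ f)
  δp : δ ^ p = δ
  εp : ε ^ p = ε
  ker : ∀ f, δ f = 0 → ε f = 0 → ∃ c, f = algebraMap F K c

theorem gradd_pow (w : Fin p × Fin p → F) (hw : ∀ ij, w ij ^ p = w ij) : gradd b w ^ p = gradd b w := by
  have h : ∀ m ij, (gradd b w ^ m) (b ij) = w ij ^ m • b ij := by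
    intro m ij
    induction m with
    | zero => simp
    | succ m ih => rw [pow_succ', Module.End.mul_apply, ih, map_smul, gradd_basis, smul_smul, pow_succ]
  exact b.ext fun ij => by rw [h, hw, gradd_basis]

include hs hr hb in
theorem exists_DD : Nonempty (DD p F K s r) := by
  have hp : p.Prime := Fact.out
  have hc : (p : F) = 0 := CharP.cast_eq_zero F p
  have hs' := gradd_mon hs hr b hb (fun i j => i) (by simp) (by simp) 1 0
  have hr' := gradd_mon hs hr b hb (fun i j => i) (by simp) (by simp) 0 1
  have hs2 := gradd_mon hs hr b hb (fun i j => j) (by simp) (by simp) 1 0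
  have hr2 := gradd_mon hs hr b hb (fun i j => j) (by simp) (by simp) 0 1
  refine ⟨⟨gradd b fun ij => ((ij.1 : ℕ) : F), gradd b fun ij => ((ij.2 : ℕ) : F),
    gradd_mul hs hr b hb (fun i j => i) (by simp) (by simp) (by simp),
    gradd_mul hs hr b hb (fun i j => j) (by simp) (by simp) (by simp), by simpa using hs', by simpa using hr',
    by simpa using hs2, by simpa using hr2, ?_, gradd_pow b _ (by simp [natCast_pow_char]), gradd_pow b _ (by simp [natCast_pow_char]), ?_⟩⟩
  · intro f
    apply b.repr.injective
    ext ij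
    rw [gradd_repr, gradd_repr, gradd_repr, gradd_repr]; ring
  · intro f h1 h2
    let o : Fin p × Fin p := (⟨0, hp.pos⟩, ⟨0, hp.pos⟩)
    have key : ∀ i : Fin p, ((i : ℕ) : F) = 0 → i = ⟨0, hp.pos⟩ := by
      intro i hi
      rw [CharP.cast_eq_zero_iff F p] at hi
      exact Fin.ext (Nat.eq_zero_of_dvd_of_lt hi i.2)
    have h : ∀ ij, ij ≠ o → b.repr f ij = 0 := by
      intro ij hij
      have e1 := gradd_repr b (fun ij => ((ij.1 : ℕ) : F)) f ij
      have e2 := gradd_repr b (fun ij => ((ij.2 : ℕ) : F)) f ij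
      rw [h1] at e1; rw [h2] at e2
      by_contra hne
      apply hij
      refine Prod.ext (key _ ?_) (key _ ?_)
      · simpa [hne] using e1.symm
      · simpa [hne] using e2.symm
    refine ⟨b.repr f o, ?_⟩
    conv_lhs => rw [← b.sum_repr f]
    rw [Finset.sum_eq_single o]
    · rw [hb, Algebra.smul_def]; simp [o]
    · intro ij _ hij; rw [h ij hij, zero_smul]
    · simp
end deriv
end

noncomputable section

section
variable {p : ℕ} [Fact p.Prime] {F K R : Type} [Field F] [CharP F p] [Field K] [Algebra F K] [Ring R] [Algebra F R] [Nontrivial R]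

theorem ad_pow_char (u w : R) :
    ((LinearMap.mulLeft F u - LinearMap.mulRight F u) ^ p) w = u ^ p * w - w * u ^ p := by
  haveI : CharP (Module.End F R) p := charP_of_injective_algebraMap (FaithfulSMul.algebraMap_injective F (Module.End F R)) p
  rw [sub_pow_char_of_commute p (LinearMap.commute_mulLeft_right u u), LinearMap.pow_mulLeft, LinearMap.pow_mulRight]
  simp

theorem ad_iter (ι : K →ₐ[F] R) (δ : K →ₗ[F] K) (u : R) (hu : ∀ f, u * ι f = ι f * u + ι (δ f)) (m : ℕ) (f : K) :
    ((LinearMap.mulLeft F u - LinearMap.mulRight F u) ^ m) (ι f) = ι ((δ ^ m) f) := by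
  induction m with
  | zero => simp
  | succ m ih =>
    rw [pow_succ', Module.End.mul_apply, ih, pow_succ', Module.End.mul_apply]
    simp [hu]

theorem map_sub_helper (a b c : R) (h : c = a - b) : a = b + c := by rw [h]; abel

theorem wp_scalar (ι : K →ₐ[F] R) (δ : K →ₗ[F] K) (hδ : δ ^ p = δ) (u : R) (hu : ∀ f, u * ι f = ι f * u + ι (δ f))
    (hcen : ∀ w : R, (∀ f, Commute w (ι f)) → ∃ g, w = ι g) : ∃ κ, u ^ p - u = ι κ := by
  apply hcen
  intro f
  have h1 := ad_pow_char (F := F) (p := p) u (ι f)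
  rw [ad_iter ι δ u hu, hδ] at h1
  have h2 := hu f
  rw [Commute, SemiconjBy, sub_mul, mul_sub]
  rw [h2, map_sub_helper _ _ _ h1]
  abel

theorem hasSt_of_DD {s r : K} {x z : F} (hx0 : x ≠ 0) (hz0 : z ≠ 0) (hs : s ^ p = algebraMap F K x) (hr : r ^ p = algebraMap F K z)
    (D : DD p F K s r) (ι : K →ₐ[F] R) (u v : R) (hu : ∀ f, u * ι f = ι f * u + ι (D.δ f))
    (hv : ∀ f, v * ι f = ι f * v + ι (D.ε f))
    (hcen : ∀ w : R, (∀ f, Commute w (ι f)) → ∃ g, w = ι g) : ∃ a b, HasSt p R a x b z := by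
  have hp : p.Prime := Fact.out
  have hinj : Function.Injective ι := ι.toRingHom.injective
  obtain ⟨κ, hκ⟩ := wp_scalar ι D.δ D.δp u hu hcen
  obtain ⟨c, hc⟩ : ∃ c, u * v - v * u = ι c := by
    apply hcen
    intro f
    have e1 : u * v * ι f = ι f * u * v + ι (D.δ f) * v + ι (D.ε f) * u + ι (D.δ (D.ε f)) := by
      rw [mul_assoc, hv, mul_add, ← mul_assoc, hu, hu]; noncomm_ring
    have e2 : v * u * ι f = ι f * v * u + ι (D.ε f) * u + ι (D.δ f) * v + ι (D.δ (D.ε f)) := by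
      rw [mul_assoc, hu, mul_add, ← mul_assoc, hv, hv, D.comm]; noncomm_ring
    rw [Commute, SemiconjBy, sub_mul, e1, e2]; noncomm_ring
  have key : c = (D.δ ^ (p - 1)) c + D.ε κ := by
    apply hinj
    have h1 := ad_pow_char (F := F) (p := p) u v
    obtain ⟨q, hq⟩ : ∃ q, p = q + 1 := ⟨p - 1, by have := hp.pos; omega⟩
    have h2 : ((LinearMap.mulLeft F u - LinearMap.mulRight F u) ^ p) v = ι ((D.δ ^ (p - 1)) c) := by
      conv_lhs => rw [hq, pow_succ, Module.End.mul_apply]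
      rw [← ad_iter ι D.δ u hu, ← hc, show p - 1 = q by omega]; simp
    have h3 : u ^ p = u + ι κ := by rw [← hκ]; abel
    rw [h2, h3] at h1
    have h4 := hv κ
    rw [map_add, h1, ← hc, add_mul, mul_add, h4]; noncomm_ring
  obtain ⟨q, hq⟩ : ∃ q, p - 1 = q + 1 := ⟨p - 2, by have := hp.two_le; omega⟩
  set g := - (D.δ ^ q) c with hg
  have hcg : c + D.δ g - D.ε κ = 0 := by
    have : D.δ g = - (D.δ ^ (p - 1)) c := by
      rw [hg, map_neg, hq, pow_succ', Module.End.mul_apply]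
    rw [this]; linear_combination key
  set u1 := u + ι κ with hu1
  set v1 := v + ι g with hv1
  have hu1' : ∀ f, u1 * ι f = ι f * u1 + ι (D.δ f) := by
    intro f
    rw [hu1, add_mul, hu, mul_add, ← map_mul, ← map_mul, mul_comm κ f]; abel
  have hv1' : ∀ f, v1 * ι f = ι f * v1 + ι (D.ε f) := by
    intro f
    rw [hv1, add_mul, hv, mul_add, ← map_mul, ← map_mul, mul_comm g f]; abel
  have huv : Commute u1 v1 := by
    have e : u1 * v1 - v1 * u1 = ι (c + D.δ g - D.ε κ) := by
      rw [hu1, hv1, map_sub, map_add, ← hc, add_mul, add_mul, mul_add, mul_add, mul_add, mul_add, hu g, hv κ, ← map_mul, ← map_mul, mul_comm g κ]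
      abel
    rw [hcg, map_zero] at e
    exact sub_eq_zero.1 e
  have desc : ∀ κ, Commute u1 (ι κ) → Commute v1 (ι κ) → ∃ a : F, ι κ = algebraMap F R a := by
    intro κ h1 h2
    have e1 : D.δ κ = 0 := by
      apply hinj
      have := hu1' κ
      rw [h1.eq] at this
      simpa using this
    have e2 : D.ε κ = 0 := by
      apply hinj
      have := hv1' κ
      rw [h2.eq] at this
      simpa using this
    obtain ⟨a, rfl⟩ := D.ker κ e1 e2
    exact ⟨a, by simp⟩
  obtain ⟨κ1, hκ1⟩ := wp_scalar ι D.δ D.δp u1 hu1' hcen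
  obtain ⟨κ2, hκ2⟩ := wp_scalar ι D.ε D.εp v1 hv1' hcen
  obtain ⟨a, ha⟩ := desc κ1 (by rw [← hκ1]; exact ((Commute.refl u1).pow_right p).sub_right (Commute.refl u1))
    (by rw [← hκ1]; exact (huv.symm.pow_right p).sub_right huv.symm)
  obtain ⟨b, hb⟩ := desc κ2 (by rw [← hκ2]; exact (huv.pow_right p).sub_right huv)
    (by rw [← hκ2]; exact ((Commute.refl v1).pow_right p).sub_right (Commute.refl v1))
  refine ⟨a, b, u1, ι s, v1, ι r, ?_⟩
  constructor
  · rw [hu1', D.δs]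
  · rw [hv1', D.εr]
  · exact huv
  · have := hu1' r
    rw [D.δr, map_zero, add_zero] at this
    exact this
  · have := hv1' s
    rw [D.εs, map_zero, add_zero] at this
    exact this
  · rw [Commute, SemiconjBy, ← map_mul, mul_comm, map_mul]
  · rw [← map_pow, hs]; simp
  · rw [← map_pow, hr]; simp
  · rw [hκ1, ha]
  · rw [hκ2, hb]
  · exact hx0
  · exact hz0
end
end

noncomputable section

section
variable {p : ℕ} [Fact p.Prime] {F K C : Type} [Field F] [CharP F p] [Field K] [Algebra F K] [Ring C] [Algebra F C]

/-- the action of an algebra on column vectors through a matrix representation -/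
def colAct {d : ℕ} (ρ : C →ₐ[F] Matrix (Fin d) (Fin d) K) : C →ₐ[F] Module.End F (Fin d → K) :=
  ((Algebra.lsmul F F (Fin d → K) : Module.End K (Fin d → K) →ₐ[F] Module.End F (Fin d → K)).comp
    ((Matrix.toLinAlgEquiv' : Matrix (Fin d) (Fin d) K ≃ₐ[K] _).toAlgHom.restrictScalars F)).comp ρ

theorem colAct_apply {d : ℕ} (ρ : C →ₐ[F] Matrix (Fin d) (Fin d) K) (c : C) (m : Fin d → K) :
    colAct ρ c m = (ρ c).mulVec m := by
  simp [colAct, Matrix.toLinAlgEquiv'_apply]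

def colMat {d : ℕ} (e0 : Fin d) : (Fin d → K) →ₗ[F] Matrix (Fin d) (Fin d) K where
  toFun m := Matrix.of fun i j => if j = e0 then m i else 0
  map_add' m m' := by ext i j; by_cases h : j = e0 <;> simp [h]
  map_smul' c m := by ext i j; by_cases h : j = e0 <;> simp [h]

def col0 {d : ℕ} (e0 : Fin d) : Matrix (Fin d) (Fin d) K →ₗ[F] (Fin d → K) where
  toFun X := fun i => X i e0
  map_add' m m' := by ext i; simp
  map_smul' c m := by ext i; simp

theorem col0_colMat {d : ℕ} (e0 : Fin d) (m : Fin d → K) : col0 (F := F) e0 (colMat (F := F) e0 m) = m := by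
  ext i; simp [col0, colMat]

theorem col0_smul {d : ℕ} (e0 : Fin d) (f : K) (X : Matrix (Fin d) (Fin d) K) :
    col0 (F := F) e0 (f • X) = f • col0 (F := F) e0 X := by
  ext i; simp [col0]

theorem col0_mul {d : ℕ} (e0 : Fin d) (A X : Matrix (Fin d) (Fin d) K) :
    col0 (F := F) e0 (A * X) = A.mulVec (col0 (F := F) e0 X) := by
  ext i; simp [col0, Matrix.mul_apply, Matrix.mulVec, dotProduct]

theorem colMat_smul {d : ℕ} (e0 : Fin d) (f : K) (m : Fin d → K) :
    colMat (F := F) e0 (f • m) = f • colMat (F := F) e0 m := by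
  ext i j; by_cases h : j = e0 <;> simp [h, colMat]

theorem colMat_mulVec {d : ℕ} (e0 : Fin d) (A : Matrix (Fin d) (Fin d) K) (m : Fin d → K) :
    colMat (F := F) e0 (A.mulVec m) = A * colMat (F := F) e0 m := by
  ext i j; by_cases h : j = e0 <;> simp [h, colMat, Matrix.mul_apply, Matrix.mulVec, dotProduct]

theorem exists_conn {d : ℕ} (e0 : Fin d) (ρ : C →ₐ[F] Matrix (Fin d) (Fin d) K)
    (hb : Function.Bijective (extMap (E := K) ρ)) (δ : K →ₗ[F] K) (hδ : ∀ f g, δ (f * g) = δ f * g + f * δ g) :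
    ∃ u : Module.End F (Fin d → K), (∀ c m, u ((ρ c).mulVec m) = (ρ c).mulVec (u m)) ∧
      (∀ (f : K) m, u (f • m) = f • u m + δ f • m) := by
  let Φ : K ⊗[F] C ≃ₐ[K] Matrix (Fin d) (Fin d) K := AlgEquiv.ofBijective _ hb
  have hΦ : ∀ f c, Φ (f ⊗ₜ c) = f • ρ c := fun f c => extMap_tmul (E := K) ρ f c
  let D : Matrix (Fin d) (Fin d) K →ₗ[F] Matrix (Fin d) (Fin d) K :=
    (Φ.toLinearEquiv.toLinearMap.restrictScalars F) ∘ₗ (TensorProduct.map δ LinearMap.id) ∘ₗ (Φ.symm.toLinearEquiv.toLinearMap.restrictScalars F)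
  have hD : ∀ y, D (Φ y) = Φ (TensorProduct.map δ LinearMap.id y) := by
    intro y; simp [D]
  have hD1 : ∀ c X, D (ρ c * X) = ρ c * D X := by
    intro c X
    obtain ⟨y, rfl⟩ := Φ.surjective X
    have hc : ρ c = Φ (1 ⊗ₜ c) := by rw [hΦ, one_smul]
    rw [hc, ← map_mul, hD, hD, ← map_mul]
    congr 1
    induction y using TensorProduct.induction_on with
    | zero => simp
    | tmul f c' => simp
    | add a b ha hb => rw [mul_add, map_add, ha, hb, map_add, mul_add]
  have hD2 : ∀ (f : K) X, D (f • X) = f • D X + δ f • X := by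
    intro f X
    obtain ⟨y, rfl⟩ := Φ.surjective X
    rw [← map_smul Φ, hD, hD, ← map_smul Φ, ← map_smul Φ, ← map_add Φ]
    congr 1
    induction y using TensorProduct.induction_on with
    | zero => simp
    | tmul g c' => simp [TensorProduct.smul_tmul', hδ, TensorProduct.add_tmul, add_comm]
    | add a b ha hb => rw [smul_add, map_add, ha, hb, map_add, smul_add, smul_add]; abel
  refine ⟨col0 e0 ∘ₗ D ∘ₗ colMat e0, fun c m => ?_, fun f m => ?_⟩
  · simp only [LinearMap.comp_apply]
    rw [colMat_mulVec, hD1, col0_mul]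
  · simp only [LinearMap.comp_apply]
    rw [colMat_smul, hD2, map_add, col0_smul, col0_smul, col0_colMat]

theorem exists_hasSt {s r : K} {x z : F} (hx0 : x ≠ 0) (hz0 : z ≠ 0) (hs : s ^ p = algebraMap F K x) (hr : r ^ p = algebraMap F K z)
    (D : DD p F K s r) {d : ℕ} (hd0 : 0 < d) (hC : IsCSA F C) (hd : Module.finrank F C = d ^ 2)
    (hsp : SplitBy F K C d) :
    ∃ (act : C →ₐ[F] Module.End F (Fin d → K)),
      ∃ a b, HasSt p (Subalgebra.centralizer F (Set.range act)) a x b z := by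
  obtain ⟨ρ⟩ := hsp
  haveI : Nonempty (Fin d) := ⟨⟨0, hd0⟩⟩
  have hb : Function.Bijective (extMap (E := K) ρ) := csa_ext_bijective hC ρ (by rw [hd, finrank_matrix_self, Fintype.card_fin])
  obtain ⟨u, hu1, hu2⟩ := exists_conn ⟨0, hd0⟩ ρ hb D.δ D.δm
  obtain ⟨v, hv1, hv2⟩ := exists_conn ⟨0, hd0⟩ ρ hb D.ε D.εm
  refine ⟨colAct ρ, ?_⟩
  set R := Subalgebra.centralizer F (Set.range (colAct ρ)) with hR
  have mem : ∀ w : Module.End F (Fin d → K), (∀ c m, w ((ρ c).mulVec m) = (ρ c).mulVec (w m)) → w ∈ R := by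
    intro w hw
    rw [hR, Subalgebra.mem_centralizer_iff]
    rintro _ ⟨c, rfl⟩
    refine LinearMap.ext fun m => ?_
    rw [Module.End.mul_apply, Module.End.mul_apply, colAct_apply, colAct_apply, hw]
  let ι : K →ₐ[F] R := AlgHom.codRestrict (Algebra.lsmul F F (Fin d → K)) R (by
    intro f
    refine mem _ fun c m => ?_
    simp [Matrix.mulVec_smul])
  have hι : ∀ f m, (ι f : Module.End F (Fin d → K)) m = f • m := fun f m => rfl
  haveI : Nontrivial R := inferInstance
  refine hasSt_of_DD hx0 hz0 hs hr D ι ⟨u, mem u hu1⟩ ⟨v, mem v hv1⟩ ?_ ?_ ?_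
  · intro f
    refine Subtype.ext (LinearMap.ext fun m => ?_)
    simpa [hι] using hu2 f m
  · intro f
    refine Subtype.ext (LinearMap.ext fun m => ?_)
    simpa [hι] using hv2 f m
  · rintro ⟨w, hw⟩ hcomm
    have hlin : ∀ (f : K) m, w (f • m) = f • w m := by
      intro f m
      have := congrArg Subtype.val (hcomm f).eq
      exact LinearMap.congr_fun this m
    let w' : Module.End K (Fin d → K) := { toFun := w, map_add' := map_add w, map_smul' := hlin }
    let W := LinearMap.toMatrix' w'
    have hW : ∀ c, Commute (ρ c) W := by
      intro c
      rw [hR, Subalgebra.mem_centralizer_iff] at hw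
      have h1 := hw _ ⟨c, rfl⟩
      have h2 : Matrix.toLin' (ρ c) * w' = w' * Matrix.toLin' (ρ c) := by
        refine LinearMap.ext fun m => ?_
        have := LinearMap.congr_fun h1 m
        rw [Module.End.mul_apply, Module.End.mul_apply, colAct_apply, colAct_apply] at this
        rw [Module.End.mul_apply, Module.End.mul_apply, Matrix.toLin'_apply, Matrix.toLin'_apply]
        exact this
      have h3 := congrArg LinearMap.toMatrix' h2
      rw [LinearMap.toMatrix'_mul, LinearMap.toMatrix'_mul, LinearMap.toMatrix'_toLin'] at h3
      exact h3
    have hall : ∀ X, Commute X W := by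
      intro X
      obtain ⟨y, rfl⟩ := hb.2 X
      induction y using TensorProduct.induction_on with
      | zero => simp
      | tmul f c => rw [extMap_tmul]; exact (hW c).smul_left f
      | add a b ha hb => rw [map_add]; exact ha.add_left hb
    obtain ⟨g, hg⟩ := Matrix.mem_range_scalar_of_commute_single (M := W) (fun i j _ => hall _)
    refine ⟨g, Subtype.ext (LinearMap.ext fun m => ?_)⟩
    rw [hι]
    show w' m = g • m
    rw [← LinearMap.toMatrix'_mulVec, show w'.toMatrix' = _ from hg.symm]
    simp [Matrix.scalar_apply, Matrix.mulVec_diagonal, funext_iff]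
end
end

noncomputable section

section
open Polynomial
variable {p : ℕ} [Fact p.Prime] {F M : Type} [Field F] [CharP F p] [AddCommGroup M] [Module F M] [FiniteDimensional F M]

theorem finrank_ker_prod {I : Type} (s : Finset I) (c : I → F) (hc : Function.Injective c) (v : Module.End F M) :
    Module.finrank F (LinearMap.ker (aeval v (∏ i ∈ s, (X - C (c i))))) =
      ∑ i ∈ s, Module.finrank F (LinearMap.ker (v - algebraMap F (Module.End F M) (c i))) := by
  classical
  induction s using Finset.induction_on with
  | empty => 
    have : LinearMap.ker (aeval v (∏ i ∈ (∅ : Finset I), (X - C (c i)))) = ⊥ := by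
      rw [Finset.prod_empty, map_one]; exact LinearMap.ker_id
    rw [this, finrank_bot]; simp
  | insert i s hi ih =>
    rw [Finset.prod_insert hi, Finset.sum_insert hi]
    have hco : IsCoprime (X - C (c i)) (∏ i ∈ s, (X - C (c i))) :=
      IsCoprime.prod_right fun j hj => pairwise_coprime_X_sub_C hc (fun h => hi (h ▸ hj))
    have h1 := sup_ker_aeval_eq_ker_aeval_mul_of_coprime v hco
    have h2 := disjoint_ker_aeval_of_isCoprime v hco
    have h3 := Submodule.finrank_sup_add_finrank_inf_eq (LinearMap.ker (aeval v (X - C (c i)))) (LinearMap.ker (aeval v (∏ i ∈ s, (X - C (c i)))))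
    rw [h1, h2.eq_bot, finrank_bot, add_zero, ih] at h3
    have e : aeval v (X - C (c i)) = v - algebraMap F _ (c i) := by simp
    rw [e] at h3
    rw [h3]

theorem shift_comm {R : Type} [Ring R] (v r : R) (hvr : v * r = r * v + r) (j : ℕ) : v * r ^ j = r ^ j * v + j * r ^ j := by
  induction j with
  | zero => simp
  | succ j ih =>
    rw [pow_succ, ← mul_assoc, ih, add_mul, mul_assoc (r ^ j), hvr]; push_cast; noncomm_ring

theorem finrank_ker_le (v r : Module.End F M) (hvr : v * r = r * v + r) (hr : Function.Injective r) (i j : ℕ) :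
    Module.finrank F (LinearMap.ker (v - algebraMap F (Module.End F M) i)) ≤
    Module.finrank F (LinearMap.ker (v - algebraMap F (Module.End F M) (i + j : ℕ))) := by
  have hrj : Function.Injective (r ^ j) := by
    rw [Module.End.coe_pow]; exact hr.iterate j
  let g : LinearMap.ker (v - algebraMap F (Module.End F M) i) →ₗ[F] LinearMap.ker (v - algebraMap F (Module.End F M) (i + j : ℕ)) :=
    (r ^ j).restrict (by
      intro m hm
      rw [LinearMap.mem_ker, LinearMap.sub_apply, sub_eq_zero] at hm ⊢
      have := LinearMap.congr_fun (shift_comm v r hvr j) m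
      rw [Module.End.mul_apply] at this
      rw [this, LinearMap.add_apply, Module.End.mul_apply, hm]
      simp [add_smul, Nat.cast_smul_eq_nsmul])
  apply LinearMap.finrank_le_finrank_of_injective (f := g)
  intro a b h
  have := congrArg Subtype.val h
  exact Subtype.ext (hrj this)

theorem finrank_ker_mul (v r : Module.End F M) (hv : v ^ p - v = 0) (hvr : v * r = r * v + r) (hr : Function.Injective r) :
    p * Module.finrank F (LinearMap.ker v) = Module.finrank F M := by
  have hp : p.Prime := Fact.out
  have hprod : ∏ j : Fin p, (X - C ((j : ℕ) : F)) = X ^ p - X := by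
    have := congrArg (Polynomial.map (ZMod.castHom (dvd_refl p) F)) (prod_X_sub_zmod' p 1 one_ne_zero)
    rw [Polynomial.map_prod] at this
    rw [Fin.prod_univ_eq_prod_range (fun j => (X - C ((j : ℕ) : F))) p]
    simpa using this
  have hinj : Function.Injective (fun j : Fin p => ((j : ℕ) : F)) := by
    intro a b h
    have := CharP.natCast_injOn_Iio F p a.2 b.2 h
    exact Fin.ext this
  have h1 := finrank_ker_prod Finset.univ _ hinj v
  rw [hprod] at h1
  have h2 : aeval v (X ^ p - X : F[X]) = 0 := by simpa using hv
  rw [h2, LinearMap.ker_zero, finrank_top] at h1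
  rw [h1, Finset.sum_const_nat (m := Module.finrank F (LinearMap.ker v))]
  · simp
  · intro j _
    have a1 := finrank_ker_le v r hvr hr 0 j
    have a2 := finrank_ker_le v r hvr hr j (p - j)
    have e : (j : ℕ) + (p - j) = p := by omega
    rw [e, CharP.cast_eq_zero F p] at a2
    have e0 : v - algebraMap F (Module.End F M) 0 = v := by rw [map_zero, sub_zero]
    rw [Nat.cast_zero, e0, zero_add] at a1
    rw [e0] at a2
    exact le_antisymm a2 a1

def restrictHom {A : Type} [Ring A] [Algebra F A] (f : A →ₐ[F] Module.End F M) (W : Submodule F M)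
    (h : ∀ a, ∀ m ∈ W, f a m ∈ W) : A →ₐ[F] Module.End F W where
  toFun a := (f a).restrict (h a)
  map_one' := by ext m; simp
  map_mul' a b := by ext m; simp
  map_zero' := by ext m; simp
  map_add' a b := by ext m; simp
  commutes' c := by ext m; simp

/-- a splitting field from a commuting action -/
theorem splitBy_of_commuting_field {E C : Type} [Field E] [Algebra F E] [Ring C] [Algebra F C] {d : ℕ} (hd0 : 0 < d)
    (ψ : E →ₐ[F] Module.End F M) (f : C →ₐ[F] Module.End F M) (hc : ∀ e c, Commute (ψ e) (f c))
    (hM : Module.finrank F M = Module.finrank F E * d) (hE : 0 < Module.finrank F E) : SplitBy F E C d := by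
  letI : Module E M := Module.compHom M ψ.toRingHom
  have hsm : ∀ (e : E) (m : M), e • m = ψ e m := fun _ _ => rfl
  haveI : IsScalarTower F E M := ⟨fun a e m => by rw [hsm, hsm, map_smul, LinearMap.smul_apply]⟩
  refine splitBy_of_module (W := M) hd0 ?_ ?_
  · have := Module.finrank_mul_finrank F E M
    rw [hM] at this
    exact Nat.eq_of_mul_eq_mul_left hE this
  · exact
    { toFun := fun c => { toFun := f c, map_add' := map_add _, map_smul' := fun e m => by
                            have := LinearMap.congr_fun (hc e c).eq m
                            exact this.symm }
      map_one' := by ext m; simp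
      map_mul' := fun a b => by ext m; simp
      map_zero' := by ext m; simp
      map_add' := fun a b => by ext m; simp
      commutes' := fun c => by ext m; simp }

variable {C : Type} [Ring C] [Algebra F C]

theorem inj_of_pow (r : Module.End F M) {z : F} (hz : z ≠ 0) (hr : r ^ p = algebraMap F _ z) : Function.Injective r := by
  have hp : p.Prime := Fact.out
  intro a b h
  have : (r ^ p) a = (r ^ p) b := by
    obtain ⟨q, hq⟩ : ∃ q, p = q + 1 := ⟨p - 1, by have := hp.pos; omega⟩
    rw [hq, pow_succ, Module.End.mul_apply, Module.End.mul_apply, h]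
  rw [hr] at this
  simpa [hz] using this

theorem outcome_split {d : ℕ} (hd0 : 0 < d) (act : C →ₐ[F] Module.End F M) (hM : Module.finrank F M = d * p ^ 2) {x z : F}
    (h : HasSt p (Subalgebra.centralizer F (Set.range act)) 0 x 0 z) : SplitBy F F C d := by
  have hp : p.Prime := Fact.out
  obtain ⟨⟨u, hu⟩, ⟨s, hs⟩, ⟨v, hv⟩, ⟨r, hr⟩, h⟩ := h
  have us : u * s = s * u + s := congrArg Subtype.val h.us
  have vr : v * r = r * v + r := congrArg Subtype.val h.vr
  have sp : s ^ p = algebraMap F _ x := congrArg Subtype.val h.sp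
  have rp : r ^ p = algebraMap F _ z := congrArg Subtype.val h.rp
  have ua : u ^ p - u = 0 := by
    have : u ^ p - u = algebraMap F _ 0 := congrArg Subtype.val h.ua
    simpa using this
  have vb : v ^ p - v = 0 := by
    have : v ^ p - v = algebraMap F _ 0 := congrArg Subtype.val h.vb
    simpa using this
  have uv : u * v = v * u := congrArg Subtype.val h.uv.eq
  have vs : v * s = s * v := congrArg Subtype.val h.vs.eq
  have h1 := finrank_ker_mul v r vb vr (inj_of_pow r h.z0 rp)
  set W := LinearMap.ker v
  have hu' : ∀ m ∈ W, u m ∈ W := by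
    intro m hm
    rw [LinearMap.mem_ker] at hm ⊢
    have := LinearMap.congr_fun uv m
    rw [Module.End.mul_apply, Module.End.mul_apply, hm, map_zero] at this
    exact this.symm
  have hs' : ∀ m ∈ W, s m ∈ W := by
    intro m hm
    rw [LinearMap.mem_ker] at hm ⊢
    have := LinearMap.congr_fun vs m
    rw [Module.End.mul_apply, Module.End.mul_apply, hm, map_zero] at this
    exact this
  have hua : (u.restrict hu') ^ p - u.restrict hu' = 0 := by
    have e : u ^ p = u := sub_eq_zero.1 ua
    rw [Module.End.pow_restrict, sub_eq_zero]
    ext m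
    simp [e]
  have h2 := finrank_ker_mul (p := p) (u.restrict hu') (s.restrict hs') hua (by
      ext m
      have := LinearMap.congr_fun us m
      simpa using this) (by
      intro a b hab
      exact Subtype.ext (inj_of_pow s h.x0 sp (congrArg Subtype.val hab)))
  -- the common kernel
  let W2 : Submodule F M := W ⊓ LinearMap.ker u
  have hW2 : Module.finrank F W2 = d := by
    have e : Module.finrank F W2 = Module.finrank F (LinearMap.ker (u.restrict hu')) := by
      have : W2 = (LinearMap.ker (u.restrict hu')).map W.subtype := by
        ext m
        constructor
        · rintro ⟨h1, h2⟩
          exact ⟨⟨m, h1⟩, by rw [SetLike.mem_coe, LinearMap.mem_ker]; exact Subtype.ext h2, rfl⟩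
        · rintro ⟨⟨m, h1⟩, h2, rfl⟩
          refine ⟨h1, ?_⟩
          rw [SetLike.mem_coe, LinearMap.mem_ker] at h2
          exact congrArg Subtype.val h2
      rw [this]
      exact (Submodule.equivMapOfInjective _ W.injective_subtype _).finrank_eq.symm
    rw [e]
    have h3 : p * p * Module.finrank F (LinearMap.ker (u.restrict hu')) = p * p * d := by
      rw [mul_assoc, h2, h1, hM]; ring
    exact Nat.eq_of_mul_eq_mul_left (by have := hp.pos; positivity) h3
  have hact : ∀ c, ∀ m ∈ W2, act c m ∈ W2 := by
    rintro c m ⟨h1, h2⟩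
    have e1 := LinearMap.congr_fun ((Subalgebra.mem_centralizer_iff F).1 hv _ ⟨c, rfl⟩) m
    have e2 := LinearMap.congr_fun ((Subalgebra.mem_centralizer_iff F).1 hu _ ⟨c, rfl⟩) m
    rw [SetLike.mem_coe, LinearMap.mem_ker] at h1 h2
    rw [Module.End.mul_apply, Module.End.mul_apply, h1, map_zero] at e1
    rw [Module.End.mul_apply, Module.End.mul_apply, h2, map_zero] at e2
    exact ⟨e1.symm, e2.symm⟩
  exact splitBy_of_module (W := W2) hd0 hW2 (restrictHom act W2 hact)

/-- splitting by the field generated by an operator commuting with everything. -/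
theorem outcome_field {d : ℕ} (hd0 : 0 < d) (act : C →ₐ[F] Module.End F M) (hM : Module.finrank F M = d * p ^ 2) {z : F} (hz : z ≠ 0)
    (v r T : Subalgebra.centralizer F (Set.range act)) (vb : v ^ p - v = 0) (vr : v * r = r * v + r) (rp : r ^ p = algebraMap F _ z)
    (hT : Commute T v) (g : F[X]) (hg : aeval T g = 0) {E : Type} [Field E] [Algebra F E] (e : E ≃ₐ[F] AdjoinRoot g)
    (hE : Module.finrank F E = p) : SplitBy F E C d := by
  have hp : p.Prime := Fact.out
  obtain ⟨v, hv⟩ := v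
  obtain ⟨r, hr⟩ := r
  obtain ⟨T, hT'⟩ := T
  have vr : v * r = r * v + r := congrArg Subtype.val vr
  have rp : r ^ p = algebraMap F _ z := congrArg Subtype.val rp
  have vb : v ^ p - v = 0 := congrArg Subtype.val vb
  have Tv : T * v = v * T := congrArg Subtype.val hT.eq
  have hg : aeval T g = 0 := by
    have := congrArg (Subalgebra.val _) hg
    rw [← aeval_algHom_apply] at this
    simpa using this
  have h1 := finrank_ker_mul v r vb vr (inj_of_pow r hz rp)
  set W := LinearMap.ker v
  let ψ0 : AdjoinRoot g →ₐ[F] Module.End F M := Ideal.Quotient.liftₐ (Ideal.span {g}) (aeval T) (by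
    intro a ha
    obtain ⟨q, rfl⟩ := Ideal.mem_span_singleton'.1 ha
    rw [map_mul, hg, mul_zero])
  have hψ0 : ∀ q : F[X], ψ0 (AdjoinRoot.mk g q) = aeval T q := fun q => rfl
  have hcomm : ∀ (y : Module.End F M), Commute T y → ∀ a, Commute (ψ0 a) y := by
    intro y hy a
    obtain ⟨q, rfl⟩ := AdjoinRoot.mk_surjective a
    rw [hψ0]
    induction q using Polynomial.induction_on' with
    | add q q' h h' => rw [map_add]; exact h.add_left h'
    | monomial n c => 
      rw [aeval_monomial]
      exact (show Commute (algebraMap F _ c) y from Algebra.commutes c y).mul_left (hy.pow_left n)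
  have stable : ∀ y : Module.End F M, Commute y v → ∀ m ∈ W, y m ∈ W := by
    intro y hy m hm
    rw [LinearMap.mem_ker] at hm ⊢
    have := LinearMap.congr_fun hy.eq m
    rw [Module.End.mul_apply, Module.End.mul_apply, hm, map_zero] at this
    exact this.symm
  have hact : ∀ c, ∀ w ∈ Subalgebra.centralizer F (Set.range act), Commute (act c) w := fun c w hw =>
    (Subalgebra.mem_centralizer_iff F).1 hw _ ⟨c, rfl⟩
  let ψ := (ψ0.comp e.toAlgHom)
  refine splitBy_of_commuting_field (M := W) hd0 (restrictHom ψ W fun a => stable _ (hcomm v Tv _))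
    (restrictHom act W fun c => stable _ (hact c v hv)) ?_ ?_ (by rw [hE]; exact hp.pos)
  · intro a c
    have := hcomm (act c) (hact c T hT').symm (e a)
    ext m
    exact LinearMap.congr_fun this.eq m
  · rw [hE]
    have h3 : p * Module.finrank F W = p * (p * d) := by rw [h1, hM]; ring
    exact Nat.eq_of_mul_eq_mul_left hp.pos h3
end
end

noncomputable section

section frobbasis
open IsLocalRing
variable {p : ℕ} [Fact p.Prime] {O : Type} [CommRing O] [IsDomain O] [IsDiscreteValuationRing O] [CharP O p]
  {ϖ : O} (hϖ : Irreducible ϖ)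

include hϖ in
theorem residue_zero_iff (f : O) : residue O f = 0 ↔ ϖ ∣ f := by
  rw [residue_eq_zero_iff, hϖ.maximalIdeal_eq, Ideal.mem_span_singleton]

include hϖ in
theorem eq_zero_of_dvd_all (f : O) (h : ∀ N : ℕ, ϖ ^ N ∣ f) : f = 0 := by
  by_contra hf
  have := FiniteMultiplicity.of_not_isUnit hϖ.not_isUnit hf
  exact (FiniteMultiplicity.not_iff_forall.2 h) this

include hϖ in
theorem exists_limit [IsAdicComplete (maximalIdeal O) O] (g : ℕ → O) :
    ∃ G : O, ∀ N : ℕ, ϖ ^ N ∣ G - ∑ n ∈ Finset.range N, ϖ ^ n * g n := by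
  have hpre : IsPrecomplete (maximalIdeal O) O := inferInstance
  obtain ⟨G, hG⟩ := hpre.prec (f := fun N => ∑ n ∈ Finset.range N, ϖ ^ n * g n) (by
    intro m n hmn
    rw [SModEq.sub_mem, hϖ.maximalIdeal_eq, Ideal.span_singleton_pow, smul_eq_mul, Ideal.mul_top, Ideal.mem_span_singleton]
    rw [← neg_sub, dvd_neg, ← Finset.sum_range_add_sum_Ico _ hmn, add_sub_cancel_left]
    refine Finset.dvd_sum fun i hi => Dvd.dvd.mul_right (pow_dvd_pow _ (Finset.mem_Ico.1 hi).1) _)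
  refine ⟨G, fun N => ?_⟩
  have := hG N
  rw [SModEq.sub_mem, hϖ.maximalIdeal_eq, Ideal.span_singleton_pow, smul_eq_mul, Ideal.mul_top, Ideal.mem_span_singleton] at this
  rw [← neg_sub, dvd_neg]; exact this

variable (p) in
def Ind {k : Type} [Field k] (t : k) : Prop := ∀ c : ℕ → k, ∑ i ∈ Finset.range p, c i ^ p * t ^ i = 0 → ∀ i < p, c i = 0

include hϖ in
theorem ind_step {f0 : O} (hind : Ind p (residue O f0)) (a : ℕ → ℕ → O)
    (h : ∑ j ∈ Finset.range p, ∑ i ∈ Finset.range p, a i j ^ p * f0 ^ i * ϖ ^ j = 0) (i j : ℕ) (hi : i < p) (hj : j < p) : ϖ ∣ a i j := by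
  induction j using Nat.strong_induction_on generalizing i with
  | _ j ih =>
    have hw : ϖ ^ j ≠ 0 := pow_ne_zero _ hϖ.ne_zero
    have hsplit := Finset.sum_range_add_sum_Ico (fun j => ∑ i ∈ Finset.range p, a i j ^ p * f0 ^ i * ϖ ^ j) hj.le
    rw [h, Finset.sum_eq_sum_Ico_succ_bot hj] at hsplit
    have h1 : ϖ ^ (j + 1) ∣ ∑ j ∈ Finset.range j, ∑ i ∈ Finset.range p, a i j ^ p * f0 ^ i * ϖ ^ j := by
      refine Finset.dvd_sum fun j' hj' => Finset.dvd_sum fun i' hi' => ?_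
      rw [Finset.mem_range] at hi' hj'
      have := ih j' hj' i' hi' (by omega)
      exact (((pow_dvd_pow _ (by omega)).trans (pow_dvd_pow_of_dvd this p)).mul_right _).mul_right _
    have h2 : ϖ ^ (j + 1) ∣ ∑ j ∈ Finset.Ico (j + 1) p, ∑ i ∈ Finset.range p, a i j ^ p * f0 ^ i * ϖ ^ j := by
      refine Finset.dvd_sum fun j' hj' => Finset.dvd_sum fun i' hi' => ?_
      exact (pow_dvd_pow _ (Finset.mem_Ico.1 hj').1).mul_left _
    have h3 : ϖ ^ (j + 1) ∣ ∑ i ∈ Finset.range p, a i j ^ p * f0 ^ i * ϖ ^ j := by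
      have : ∑ i ∈ Finset.range p, a i j ^ p * f0 ^ i * ϖ ^ j = - (∑ j ∈ Finset.range j, ∑ i ∈ Finset.range p, a i j ^ p * f0 ^ i * ϖ ^ j)
          - ∑ j ∈ Finset.Ico (j + 1) p, ∑ i ∈ Finset.range p, a i j ^ p * f0 ^ i * ϖ ^ j := by
        linear_combination hsplit
      rw [this]
      exact (h1.neg_right).sub h2
    rw [← Finset.sum_mul, pow_succ', mul_dvd_mul_iff_right hw] at h3
    rw [← residue_zero_iff hϖ] at h3 ⊢
    refine hind (fun i => residue O (a i j)) ?_ i hi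
    rw [map_sum] at h3
    simpa using h3

include hϖ in
theorem ind_all {f0 : O} (hind : Ind p (residue O f0)) (N : ℕ) : ∀ (a : ℕ → ℕ → O)
    (h : ∑ j ∈ Finset.range p, ∑ i ∈ Finset.range p, a i j ^ p * f0 ^ i * ϖ ^ j = 0) (i j : ℕ) (hi : i < p) (hj : j < p), ϖ ^ N ∣ a i j := by
  induction N with
  | zero => intros; simp
  | succ N ih =>
    intro a h i j hi hj
    have h1 := ind_step hϖ hind a h
    have : ∀ i j, ∃ b, i < p → j < p → a i j = ϖ * b := by
      intro i j
      by_cases hh : i < p ∧ j < p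
      · obtain ⟨b, hb⟩ := h1 i j hh.1 hh.2
        exact ⟨b, fun _ _ => hb⟩
      · exact ⟨0, fun h h' => absurd ⟨h, h'⟩ hh⟩
    choose b hb using this
    have h2 := ih b (by
      have hw : ϖ ^ p ≠ 0 := pow_ne_zero _ hϖ.ne_zero
      refine (mul_eq_zero.1 (?_ : ϖ ^ p * _ = 0)).resolve_left hw
      rw [← h, Finset.mul_sum]
      refine Finset.sum_congr rfl fun j hj => ?_
      rw [Finset.mul_sum]
      refine Finset.sum_congr rfl fun i hi => ?_
      rw [hb i j (Finset.mem_range.1 hi) (Finset.mem_range.1 hj)]; ring) i j hi hj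
    rw [hb i j hi hj, pow_succ']
    exact mul_dvd_mul_left _ h2

include hϖ in
theorem span_step {f0 : O} (hk : Hk p (residue O f0)) (f : O) (J : ℕ) : ∃ (c : ℕ → ℕ → O) (g : O),
    f = ∑ j ∈ Finset.range J, ∑ i ∈ Finset.range p, c i j ^ p * f0 ^ i * ϖ ^ j + ϖ ^ J * g := by
  induction J with
  | zero => exact ⟨0, f, by simp⟩
  | succ J ih =>
    obtain ⟨c, g, h⟩ := ih
    obtain ⟨γ, hγ⟩ := hk (residue O g)
    choose e he using fun i => residue_surjective (γ i)
    have : ϖ ∣ g - ∑ i ∈ Finset.range p, e i ^ p * f0 ^ i := by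
      rw [← residue_zero_iff hϖ, map_sub, hγ, map_sum, sub_eq_zero]
      simp [he]
    obtain ⟨g', hg'⟩ := this
    refine ⟨fun i j => if j = J then e i else c i j, g', ?_⟩
    rw [Finset.sum_range_succ]
    have e1 : ∑ j ∈ Finset.range J, ∑ i ∈ Finset.range p, (if j = J then e i else c i j) ^ p * f0 ^ i * ϖ ^ j =
      ∑ j ∈ Finset.range J, ∑ i ∈ Finset.range p, c i j ^ p * f0 ^ i * ϖ ^ j := by
      refine Finset.sum_congr rfl fun j hj => Finset.sum_congr rfl fun i hi => ?_
      rw [if_neg (Finset.mem_range.1 hj).ne]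
    rw [e1]
    simp only [if_true]
    rw [← Finset.sum_mul]
    linear_combination h + ϖ ^ J * hg'

include hϖ in
theorem span_all [IsAdicComplete (maximalIdeal O) O] {f0 : O} (hk : Hk p (residue O f0)) (f : O) : ∃ (c : ℕ → ℕ → O),
    f = ∑ j ∈ Finset.range p, ∑ i ∈ Finset.range p, c i j ^ p * f0 ^ i * ϖ ^ j := by
  choose c g h using fun f => span_step hϖ hk f p
  let gs : ℕ → O := fun n => g^[n] f
  choose G hG using fun i j => exists_limit hϖ (fun n => c (gs n) i j)
  refine ⟨G, ?_⟩
  have hN : ∀ N : ℕ, f = ∑ j ∈ Finset.range p, ∑ i ∈ Finset.range p, (∑ n ∈ Finset.range N, ϖ ^ n * c (gs n) i j) ^ p * f0 ^ i * ϖ ^ j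
      + ϖ ^ (p * N) * gs N := by
    intro N
    induction N with
    | zero => simp [gs, (Fact.out : p.Prime).ne_zero]
    | succ N ih =>
      have e1 := h (gs N)
      have e2 : g (gs N) = gs (N + 1) := (Function.iterate_succ_apply' g N f).symm
      rw [e2] at e1
      have e3 : ∑ j ∈ Finset.range p, ∑ i ∈ Finset.range p, (∑ n ∈ Finset.range (N + 1), ϖ ^ n * c (gs n) i j) ^ p * f0 ^ i * ϖ ^ j =
        ∑ j ∈ Finset.range p, ∑ i ∈ Finset.range p, (∑ n ∈ Finset.range N, ϖ ^ n * c (gs n) i j) ^ p * f0 ^ i * ϖ ^ j + 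
        ϖ ^ (p * N) * ∑ j ∈ Finset.range p, ∑ i ∈ Finset.range p, c (gs N) i j ^ p * f0 ^ i * ϖ ^ j := by
        rw [Finset.mul_sum, ← Finset.sum_add_distrib]
        refine Finset.sum_congr rfl fun j hj => ?_
        rw [Finset.mul_sum, ← Finset.sum_add_distrib]
        refine Finset.sum_congr rfl fun i hi => ?_
        rw [Finset.sum_range_succ, add_pow_char, mul_pow, ← pow_mul, mul_comm N p]; ring
      rw [e3, mul_add p, mul_one, pow_add]
      linear_combination ih + ϖ ^ (p * N) * e1
  rw [← sub_eq_zero]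
  refine eq_zero_of_dvd_all hϖ _ fun N => ?_
  have h1 := hN N
  have : f - ∑ j ∈ Finset.range p, ∑ i ∈ Finset.range p, G i j ^ p * f0 ^ i * ϖ ^ j = 
      ϖ ^ (p * N) * gs N - ∑ j ∈ Finset.range p, ∑ i ∈ Finset.range p, (G i j - ∑ n ∈ Finset.range N, ϖ ^ n * c (gs n) i j) ^ p * f0 ^ i * ϖ ^ j := by
    have e3 : ∑ j ∈ Finset.range p, ∑ i ∈ Finset.range p, (G i j - ∑ n ∈ Finset.range N, ϖ ^ n * c (gs n) i j) ^ p * f0 ^ i * ϖ ^ j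
       = ∑ j ∈ Finset.range p, ∑ i ∈ Finset.range p, G i j ^ p * f0 ^ i * ϖ ^ j - 
         ∑ j ∈ Finset.range p, ∑ i ∈ Finset.range p, (∑ n ∈ Finset.range N, ϖ ^ n * c (gs n) i j) ^ p * f0 ^ i * ϖ ^ j := by
      rw [← Finset.sum_sub_distrib]
      refine Finset.sum_congr rfl fun j hj => ?_
      rw [← Finset.sum_sub_distrib]
      refine Finset.sum_congr rfl fun i hi => ?_
      rw [sub_pow_char]; ring
    rw [e3]; linear_combination h1
  rw [this]
  have hp : 0 < p := (Fact.out : p.Prime).pos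
  refine dvd_sub ((pow_dvd_pow _ (Nat.le_mul_of_pos_left N hp)).mul_right _) ?_
  refine Finset.dvd_sum fun j _ => Finset.dvd_sum fun i _ => ?_
  exact (((hG i j N).trans (dvd_pow_self _ hp.ne')).mul_right _).mul_right _

variable {F : Type} [Field F] [CharP F p] [Algebra O F] [IsFractionRing O F]

omit [Fact p.Prime] in
theorem sum_fin_pair {M : Type} [AddCommMonoid M] (f : ℕ → ℕ → M) :
    ∑ ij : Fin p × Fin p, f ij.1 ij.2 = ∑ j ∈ Finset.range p, ∑ i ∈ Finset.range p, f i j := by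
  rw [Fintype.sum_prod_type_right, Finset.sum_range]
  refine Finset.sum_congr rfl fun j _ => ?_
  rw [Finset.sum_range]

include hϖ in
theorem frob_basis [IsAdicComplete (maximalIdeal O) O] {f0 : O} (hk : Hk p (residue O f0)) (hind : Ind p (residue O f0)) :
    ∃ b : Module.Basis (Fin p × Fin p) F (Frob p F), ∀ ij : Fin p × Fin p,
      b ij = (Frob.mk p (algebraMap O F f0)) ^ (ij.1 : ℕ) * (Frob.mk p (algebraMap O F ϖ)) ^ (ij.2 : ℕ) := by
  have hsm : ∀ (a : F) (i j : ℕ), a • ((Frob.mk p (algebraMap O F f0)) ^ i * (Frob.mk p (algebraMap O F ϖ)) ^ j) =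
      Frob.mk p (a ^ p * algebraMap O F f0 ^ i * algebraMap O F ϖ ^ j) := by
    intro a i j
    rw [Algebra.smul_def, Frob.algebraMap_apply]
    simp only [map_mul, map_pow, mul_assoc]
  have hli : LinearIndependent F (fun ij : Fin p × Fin p => (Frob.mk p (algebraMap O F f0)) ^ (ij.1 : ℕ) * (Frob.mk p (algebraMap O F ϖ)) ^ (ij.2 : ℕ)) := by
    rw [Fintype.linearIndependent_iff]
    intro g hg
    simp only [hsm] at hg
    rw [← map_sum, map_eq_zero_iff _ (Frob.mk p).injective] at hg
    obtain ⟨d, hd⟩ := IsLocalization.exist_integer_multiples_of_finite (nonZeroDivisors O) g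
    choose a ha using hd
    have hp : 0 < p := (Fact.out : p.Prime).pos
    let a' : ℕ → ℕ → O := fun i j => if h : i < p ∧ j < p then a (⟨i, h.1⟩, ⟨j, h.2⟩) else 0
    have ha' : ∀ ij : Fin p × Fin p, a' ij.1 ij.2 = a ij := by
      rintro ⟨i, j⟩; simp [a']
    have hd0 : algebraMap O F d ≠ 0 := by
      simpa using nonZeroDivisors.ne_zero d.2
    have hz : ∑ j ∈ Finset.range p, ∑ i ∈ Finset.range p, a' i j ^ p * f0 ^ i * ϖ ^ j = 0 := by
      apply IsFractionRing.injective O F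
      rw [← sum_fin_pair (fun i j => a' i j ^ p * f0 ^ i * ϖ ^ j), map_zero, map_sum]
      have := congrArg (fun y => (algebraMap O F d) ^ p * y) hg
      simp only [mul_zero, Finset.mul_sum] at this
      rw [← this]
      refine Finset.sum_congr rfl fun ij _ => ?_
      rw [ha', map_mul, map_mul, map_pow, ha, Algebra.smul_def, map_pow, map_pow]
      ring
    intro ij
    have h0 : a ij = 0 := by
      rw [← ha']
      exact eq_zero_of_dvd_all hϖ _ fun N => ind_all hϖ hind N a' hz _ _ ij.1.2 ij.2.2
    have := ha ij
    rw [h0, map_zero, Algebra.smul_def] at this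
    exact (mul_eq_zero.1 this.symm).resolve_left hd0
  have hsp : ⊤ ≤ Submodule.span F (Set.range (fun ij : Fin p × Fin p => (Frob.mk p (algebraMap O F f0)) ^ (ij.1 : ℕ) * (Frob.mk p (algebraMap O F ϖ)) ^ (ij.2 : ℕ))) := by
    intro y _
    obtain ⟨y, rfl⟩ := (Frob.mk p).surjective y
    obtain ⟨g, h, hh, rfl⟩ := IsFractionRing.div_surjective (A := O) y
    have hp : p - 1 + 1 = p := Nat.sub_add_cancel (Fact.out : p.Prime).pos
    have h0 : algebraMap O F h ≠ 0 := by simpa using nonZeroDivisors.ne_zero hh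
    obtain ⟨c, hc⟩ := span_all hϖ hk (g * h ^ (p - 1))
    have e : algebraMap O F g / algebraMap O F h = ∑ ij : Fin p × Fin p, (algebraMap O F (c ij.1 ij.2) / algebraMap O F h) ^ p * algebraMap O F f0 ^ (ij.1 : ℕ) * algebraMap O F ϖ ^ (ij.2 : ℕ) := by
      have h1 := congrArg (algebraMap O F) hc
      rw [← sum_fin_pair (fun i j => c i j ^ p * f0 ^ i * ϖ ^ j), map_sum, map_mul, map_pow] at h1
      have h2 : algebraMap O F g / algebraMap O F h = (algebraMap O F g * algebraMap O F h ^ (p - 1)) / algebraMap O F h ^ p := by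
        have h3 : algebraMap O F h ^ p = algebraMap O F h ^ (p - 1) * algebraMap O F h := by rw [← pow_succ, hp]
        rw [h3]; field_simp
      rw [h2, h1, Finset.sum_div]
      refine Finset.sum_congr rfl fun ij _ => ?_
      simp only [map_mul, map_pow, div_pow]; ring
    rw [e, map_sum]
    refine Submodule.sum_mem _ fun ij _ => ?_
    rw [← hsm]
    exact Submodule.smul_mem _ _ (Submodule.subset_span ⟨ij, rfl⟩)
  exact ⟨Module.Basis.mk hli hsp, fun ij => by rw [Module.Basis.mk_apply]⟩
end frobbasis
end

noncomputable section

section resfield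
variable {p : ℕ} [Fact p.Prime] 

theorem base_frob {k : Type} [Field k] [CharP k p] (h : pDegree k p = p) : Module.finrank k (Frob p k) = p := by
  have hmem : ∀ x : k, x ^ p ∈ pthPowers k p := fun x => Subfield.subset_closure ⟨x, rfl⟩
  let f : k →+* pthPowers k p := (frobenius k p).codRestrict _ hmem
  have hf : Function.Bijective f := by
    refine ⟨f.injective, ?_⟩
    have : pthPowers k p ≤ (frobenius k p).fieldRange := by
      rw [pthPowers, Subfield.closure_le]
      rintro _ ⟨x, rfl⟩
      exact ⟨x, rfl⟩
    rintro ⟨y, hy⟩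
    obtain ⟨x, hx⟩ := this hy
    exact ⟨x, Subtype.ext hx⟩
  refine Eq.trans ?_ h
  rw [pDegree]
  refine (Algebra.finrank_eq_of_equiv_equiv (RingEquiv.ofBijective f hf).symm (Frob.mk p) ?_).symm
  ext y
  obtain ⟨x, hx⟩ := hf.2 y
  subst hx
  have : (RingEquiv.ofBijective f hf).symm (f x) = x := (RingEquiv.ofBijective f hf).symm_apply_apply x
  simp [this, Frob.algebraMap_apply]
  rfl

theorem ext_frob {k l : Type} [Field k] [CharP k p] [Field l] [CharP l p] [Algebra k l] [FiniteDimensional k l]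
    (h : Module.finrank k (Frob p k) = p) : Module.finrank l (Frob p l) = p := by
  have hp : p.Prime := Fact.out
  let j : Frob p k →+* Frob p l := ((Frob.mk p : l ≃+* Frob p l) : l →+* Frob p l).comp ((algebraMap k l).comp ((Frob.mk p : k ≃+* Frob p k).symm : Frob p k →+* k))
  letI : Algebra (Frob p k) (Frob p l) := j.toAlgebra
  letI : Algebra k (Frob p l) := ((algebraMap l (Frob p l)).comp (algebraMap k l)).toAlgebra
  haveI : IsScalarTower k l (Frob p l) := IsScalarTower.of_algebraMap_eq fun x => rfl
  haveI : IsScalarTower k (Frob p k) (Frob p l) := IsScalarTower.of_algebraMap_eq fun x => by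
    show algebraMap l (Frob p l) (algebraMap k l x) = j (algebraMap k (Frob p k) x)
    rw [Frob.algebraMap_apply, Frob.algebraMap_apply]
    simp [j]
  have h1 : Module.finrank (Frob p k) (Frob p l) = Module.finrank k l := by
    refine (Algebra.finrank_eq_of_equiv_equiv (Frob.mk p) (Frob.mk p) ?_).symm
    ext x
    show j (Frob.mk p x) = _
    simp [j]
  have h2 := Module.finrank_mul_finrank k l (Frob p l)
  have h3 := Module.finrank_mul_finrank k (Frob p k) (Frob p l)
  rw [← h2, h1, h, mul_comm] at h3
  exact (Nat.eq_of_mul_eq_mul_left Module.finrank_pos h3).symm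

theorem exists_not_pth {l : Type} [Field l] [CharP l p] (h : Module.finrank l (Frob p l) = p) : ∃ t : l, ∀ c, c ^ p ≠ t := by
  have hp : p.Prime := Fact.out
  by_contra! hc
  have : Module.finrank l (Frob p l) = 1 := by
    rw [finrank_eq_one_iff']
    refine ⟨1, one_ne_zero, fun w => ?_⟩
    obtain ⟨y, rfl⟩ := (Frob.mk p).surjective w
    obtain ⟨c, rfl⟩ := hc y
    exact ⟨c, by rw [Algebra.smul_def, Frob.algebraMap_apply, mul_one]⟩
  exact hp.one_lt.ne' (h.symm.trans this)

theorem minpoly_frob {l : Type} [Field l] [CharP l p] {t : l} (ht : ∀ c, c ^ p ≠ t) :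
    minpoly l (Frob.mk p t) = Polynomial.X ^ p - Polynomial.C t := by
  have hp : p.Prime := Fact.out
  refine (minpoly.eq_of_irreducible_of_monic (X_pow_sub_C_irreducible_of_prime hp ht) ?_ (Polynomial.monic_X_pow_sub_C _ hp.ne_zero)).symm
  simp [Frob.algebraMap_apply]

theorem pow_li {l : Type} [Field l] [CharP l p] {t : l} (ht : ∀ c, c ^ p ≠ t) :
    LinearIndependent l (fun i : Fin p => (Frob.mk p t) ^ (i : ℕ)) := by
  have h := linearIndependent_pow (K := l) (Frob.mk p t)
  rw [minpoly_frob ht, Polynomial.natDegree_X_pow_sub_C] at h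
  exact h

theorem frob_smul_pow {l : Type} [Field l] [CharP l p] (c t : l) (i : ℕ) : c • (Frob.mk p t) ^ i = Frob.mk p (c ^ p * t ^ i) := by
  rw [Algebra.smul_def, Frob.algebraMap_apply, map_mul, map_pow (Frob.mk p) t]

theorem ind_of_aux {l : Type} [Field l] [CharP l p] {t : l} (c : ℕ → l) (hc : ∑ i ∈ Finset.range p, c i ^ p * t ^ i = 0) :
    ∑ i : Fin p, c i • (Frob.mk p t) ^ (i : ℕ) = 0 := by
  rw [Finset.sum_range] at hc
  have := congrArg (Frob.mk p) hc
  rw [map_sum, map_zero] at this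
  rw [← this]
  exact Finset.sum_congr rfl fun i _ => frob_smul_pow _ _ _

theorem ind_of {l : Type} [Field l] [CharP l p] {t : l} (ht : ∀ c, c ^ p ≠ t) : Ind p t := by
  have h0 := pow_li ht
  rw [Fintype.linearIndependent_iff] at h0
  unfold Ind
  intro c hc i hi
  have h1 : ∀ i : Fin p, c i = 0 := by
    intro i
    refine h0 (fun i : Fin p => c i) ?_ i
    exact ind_of_aux c hc
  exact h1 ⟨i, hi⟩

theorem hk_of {l : Type} [Field l] [CharP l p] (h : Module.finrank l (Frob p l) = p) {t : l} (ht : ∀ c, c ^ p ≠ t) : Hk p t := by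
  intro α
  haveI : NeZero p := ⟨(Fact.out : p.Prime).ne_zero⟩
  let b := basisOfLinearIndependentOfCardEqFinrank (pow_li ht) (by rw [h, Fintype.card_fin])
  have hb := b.sum_repr (Frob.mk p α)
  have hbi : ∀ i, b i = (Frob.mk p t) ^ (i : ℕ) := fun i => by rw [coe_basisOfLinearIndependentOfCardEqFinrank]
  generalize b.repr (Frob.mk p α) = c at hb
  refine ⟨fun i => c (Fin.ofNat p i), ?_⟩
  apply (Frob.mk p).injective
  rw [← hb, Finset.sum_range, map_sum]
  refine Finset.sum_congr rfl fun i _ => ?_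
  rw [hbi, frob_smul_pow]
  simp only [Fin.ofNat_eq_cast, Fin.cast_val_eq_self]
end resfield
end

noncomputable section

section good
variable {p : ℕ} [Fact p.Prime] 

theorem neg_pow_char' {l : Type} [Field l] [CharP l p] (e : l) : (-e) ^ p = - e ^ p := by
  have := sub_pow_char (p := p) (0 : l) e
  rw [zero_sub, zero_pow (Fact.out : p.Prime).ne_zero, zero_sub] at this
  exact this

theorem wp_sum {l R : Type} [Field l] [CharP l p] [Ring R] [Algebra l R] [Nontrivial R] {u s : R} {t α : l} (ht : t ≠ 0)
    (us : u * s = s * u + s) (sp : s ^ p = algebraMap l R t) (ua : u ^ p - u = algebraMap l R α) (e : ℕ → l) (m : ℕ) (hm : m ≤ p) :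
    (u + ∑ i ∈ Finset.range m, e i • s ^ i) * s = s * (u + ∑ i ∈ Finset.range m, e i • s ^ i) + s ∧
    ∃ β c, (u + ∑ i ∈ Finset.range m, e i • s ^ i) ^ p - (u + ∑ i ∈ Finset.range m, e i • s ^ i) = algebraMap l R β ∧
      α - β - (c ^ p - c) ∈ Vt p t := by
  have hp : p.Prime := Fact.out
  haveI : CharP R p := charP_of_injective_algebraMap (algebraMap l R).injective p
  induction m with
  | zero => 
    refine ⟨by simpa using us, α, 0, by simpa using ua, ?_⟩
    simp [hp.ne_zero]
  | succ m ih =>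
    obtain ⟨h1, β, c, h2, h3⟩ := ih (by omega)
    rw [Finset.sum_range_succ, ← add_assoc]
    generalize u + ∑ i ∈ Finset.range m, e i • s ^ i = U at h1 h2 ⊢
    constructor
    · rw [add_mul, h1, mul_add, smul_mul_assoc, mul_smul_comm, ← pow_succ, ← pow_succ']; abel
    rcases Nat.eq_zero_or_pos m with rfl | hm0
    · refine ⟨β + (e 0 ^ p - e 0), c - e 0, ?_, ?_⟩
      · have hc : Commute U (algebraMap l R (e 0)) := (Algebra.commutes (e 0) U).symm
        rw [pow_zero, ← Algebra.algebraMap_eq_smul_one, add_pow_char_of_commute p hc, map_add, ← h2, map_sub, map_pow]; abel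
      · rw [sub_pow_char]
        convert h3 using 1; ring
    · by_cases he : e m = 0
      · refine ⟨β, c, ?_, h3⟩
        rw [he, zero_smul, add_zero]; exact h2
      · have hpm : ¬ p ∣ m := fun h => by have := Nat.le_of_dvd hm0 h; omega
        have hs : IsUnit s := (isUnit_pow_iff hp.ne_zero).1 (by
          rw [sp]; exact (isUnit_iff_ne_zero.2 ht).map _)
        have hw : IsUnit (e m • s ^ m) := by
          rw [Algebra.smul_def]
          exact ((isUnit_iff_ne_zero.2 he).map _).mul (hs.pow m)
        obtain ⟨w, hw⟩ := hw
        have h4 := wp_add_one (p := p) w U m hpm (by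
          rw [hw, mul_smul_comm, shift_comm U s h1, smul_mul_assoc, mul_add, (Nat.cast_commute m (s ^ m)).eq])
        rw [← hw, h4, h2]
        refine ⟨β + e m ^ p * t ^ m, c, ?_, ?_⟩
        · rw [hw, smul_pow, ← pow_mul, mul_comm m p, pow_mul, sp, Algebra.smul_def]; simp
        · have : α - (β + e m ^ p * t ^ m) - (c ^ p - c) = (α - β - (c ^ p - c)) + (-e m) ^ p * t ^ m := by
            rw [neg_pow_char']; ring
          rw [this]
          exact (Vt p t).add_mem h3 (AddSubmonoid.subset_closure ⟨-e m, m, hpm, rfl⟩)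

/-- extraction of the decomposition from a split symbol algebra -/
theorem good_extract {l W : Type} [Field l] [CharP l p] [AddCommGroup W] [Module l W] (hW : Module.finrank l W = p)
    (u s : Module.End l W) {t α : l} (ht : ∀ c, c ^ p ≠ t)
    (us : u * s = s * u + s) (sp : s ^ p = algebraMap l _ t) (ua : u ^ p - u = algebraMap l _ α) :
    ∃ c : l, α - (c ^ p - c) ∈ Vt p t := by
  have hp : p.Prime := Fact.out
  haveI : FiniteDimensional l W := Module.finite_of_finrank_pos (by rw [hW]; exact hp.pos)
  haveI : Nontrivial W := Module.nontrivial_of_finrank_pos (R := l) (by rw [hW]; exact hp.pos)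
  haveI : Nontrivial (Module.End l W) := inferInstance
  have ht0 : t ≠ 0 := by rintro rfl; exact ht 0 (zero_pow hp.ne_zero)
  obtain ⟨w, hw⟩ := exists_ne (0 : W)
  have hirr := X_pow_sub_C_irreducible_of_prime hp ht
  have hli : LinearIndependent l (fun i : Fin p => (s ^ (i : ℕ)) w) := by
    rw [Fintype.linearIndependent_iff]
    intro g hg
    let q : Polynomial l := ∑ i : Fin p, Polynomial.C (g i) * Polynomial.X ^ (i : ℕ)
    have hq : Polynomial.aeval s q w = 0 := by
      rw [← hg]; simp [q, map_sum, LinearMap.sum_apply]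
    have hdeg : q.degree < p := by
      refine (Polynomial.degree_sum_le _ _).trans_lt ?_
      rw [Finset.sup_lt_iff (by exact WithBot.bot_lt_coe p)]
      intro i _
      exact (Polynomial.degree_C_mul_X_pow_le _ _).trans_lt (by exact_mod_cast i.2)
    have hq0 : q = 0 := by
      by_contra hq0
      have hnd : ¬ (Polynomial.X ^ p - Polynomial.C t) ∣ q := by
        intro hd
        have := Polynomial.degree_le_of_dvd hd hq0
        rw [Polynomial.degree_X_pow_sub_C hp.pos] at this
        exact absurd hdeg (not_lt.2 this)
      obtain ⟨a, b, hab⟩ := (hirr.coprime_iff_not_dvd.2 hnd)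
      have := congrArg (fun y => Polynomial.aeval s y w) hab
      simp only [map_add, map_mul, map_sub, map_pow, Polynomial.aeval_X, Polynomial.aeval_C, sp, sub_self, mul_zero, zero_add, map_one] at this
      rw [Module.End.mul_apply, hq, map_zero] at this
      exact hw this.symm
    intro i
    have := congrArg (fun y => Polynomial.coeff y i) hq0
    simpa [q, Polynomial.finset_sum_coeff, Polynomial.coeff_X_pow, Fin.val_inj] using this
  haveI : NeZero p := ⟨hp.ne_zero⟩
  let b := basisOfLinearIndependentOfCardEqFinrank hli (by rw [hW, Fintype.card_fin])
  have hb := b.sum_repr (u w)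
  have hbi : ∀ i, b i = (s ^ (i : ℕ)) w := fun i => by rw [coe_basisOfLinearIndependentOfCardEqFinrank]
  generalize b.repr (u w) = θ at hb
  simp only [hbi] at hb
  obtain ⟨-, β, c, h1, h2⟩ := wp_sum ht0 us sp ua (fun i => - θ (Fin.ofNat p i)) p le_rfl
  set U := u + ∑ i ∈ Finset.range p, (- θ (Fin.ofNat p i)) • s ^ i with hU
  have hUw : U w = 0 := by
    rw [hU, LinearMap.add_apply, ← hb, LinearMap.sum_apply, Finset.sum_range, ← Finset.sum_add_distrib]
    refine Finset.sum_eq_zero fun i _ => ?_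
    simp
  have hβ : β = 0 := by
    have := LinearMap.congr_fun h1 w
    obtain ⟨q, hq⟩ : ∃ q, p = q + 1 := ⟨p - 1, by have := hp.pos; omega⟩
    have e : (U ^ p) w = 0 := by
      conv_lhs => rw [hq]
      rw [pow_succ, Module.End.mul_apply, hUw, map_zero]
    rw [LinearMap.sub_apply, e, hUw, sub_zero, Module.algebraMap_end_apply] at this
    exact (smul_eq_zero.1 this.symm).resolve_right hw
  exact ⟨c, by simpa [hβ] using h2⟩
end good
end

noncomputable section

section symb
variable {p : ℕ} [Fact p.Prime] {K : Type} [Field K] [CharP K p]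

variable (p K) in
def shiftP : Matrix (ZMod p) (ZMod p) K := Matrix.of fun i j => if i = j + 1 then 1 else 0

variable (p K) in
def numN : Matrix (ZMod p) (ZMod p) K := Matrix.diagonal fun i => ZMod.castHom (dvd_refl p) K i

omit [CharP K p] in
theorem shiftP_pow (m : ℕ) : shiftP p K ^ m = Matrix.of fun i j : ZMod p => if i = j + (m : ZMod p) then 1 else 0 := by
  induction m with
  | zero => ext i j; simp [Matrix.one_apply]
  | succ m ih =>
    rw [pow_succ, ih]
    ext i j
    simp [Matrix.mul_apply, shiftP, add_assoc, add_comm, add_left_comm]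

omit [CharP K p] in
theorem shiftP_pow_p : shiftP p K ^ p = 1 := by
  rw [shiftP_pow]; ext i j; simp [Matrix.one_apply]

theorem numN_pow_p : numN p K ^ p = numN p K := by
  rw [numN, Matrix.diagonal_pow]
  congr 1
  ext i
  rw [Pi.pow_apply, ← map_pow, ZMod.pow_card]

theorem numN_shiftP : numN p K * shiftP p K = shiftP p K * numN p K + shiftP p K := by
  ext i j
  rw [numN, Matrix.diagonal_mul, Matrix.add_apply, Matrix.mul_diagonal]
  simp only [shiftP, Matrix.of_apply]
  split_ifs with h
  · rw [h]; simp
  · simp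

theorem gen_top (B : Subalgebra K (Matrix (ZMod p) (ZMod p) K)) (hN : numN p K ∈ B) (hP : shiftP p K ∈ B) : B = ⊤ := by
  have hE : ∀ i, Matrix.diagonal (Pi.single i (1 : K)) ∈ B := by
    intro i
    have hinj : Set.InjOn (fun i : ZMod p => ZMod.castHom (dvd_refl p) K i) (Finset.univ : Finset (ZMod p)) :=
      fun a _ b _ h => (ZMod.castHom (dvd_refl p) K).injective h
    let q := Lagrange.interpolate Finset.univ (fun i : ZMod p => ZMod.castHom (dvd_refl p) K i) (Pi.single i 1)
    have hq : Polynomial.aeval (numN p K) q = Matrix.diagonal (Pi.single i (1 : K)) := by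
      have : numN p K = Matrix.diagonalAlgHom K (fun i => ZMod.castHom (dvd_refl p) K i) := rfl
      rw [this, Polynomial.aeval_algHom_apply]
      show Matrix.diagonal _ = _
      congr 1
      ext j
      have h1 : (Polynomial.aeval (fun i => ZMod.castHom (dvd_refl p) K i) q) j = Polynomial.aeval (ZMod.castHom (dvd_refl p) K j) q :=
        (Polynomial.aeval_algHom_apply (Pi.evalAlgHom K (fun _ : ZMod p => K) j) _ q).symm
      rw [h1, Polynomial.coe_aeval_eq_eval]
      exact Lagrange.eval_interpolate_at_node _ hinj (Finset.mem_univ j)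
    rw [← hq]
    exact (Algebra.adjoin_le (Set.singleton_subset_iff.2 hN)) (Polynomial.aeval_mem_adjoin_singleton _ _)
  rw [eq_top_iff]
  intro M _
  rw [Matrix.matrix_eq_sum_single M]
  refine B.sum_mem fun i _ => B.sum_mem fun j _ => ?_
  have : Matrix.single i j (M i j) = M i j • (Matrix.diagonal (Pi.single i (1 : K)) * shiftP p K ^ (i - j).val) := by
    rw [shiftP_pow]
    ext a b
    rw [Matrix.smul_apply, Matrix.diagonal_mul, Matrix.of_apply, ZMod.natCast_zmod_val, Matrix.single_apply]
    by_cases ha : i = a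
    · subst ha
      by_cases hb : j = b
      · subst hb; simp
      · have : i ≠ b + (i - j) := by
          intro h; apply hb; linear_combination h
        simp [hb, this]
    · simp [ha, Pi.single_apply, Ne.symm ha]
  rw [this]
  exact B.smul_mem (B.mul_mem (hE i) (B.pow_mem hP _)) _

theorem symbol_rel {l : Type} [Field l] [CharP l p] (α t : l) :
    let U := numN p (Frob p l) + Frob.mk p α • shiftP p (Frob p l)
    let S := Frob.mk p t • shiftP p (Frob p l)
    U * S = S * U + S ∧ S ^ p = algebraMap l _ t ∧ U ^ p - U = algebraMap l _ α := by
  intro U S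
  have hp : p.Prime := Fact.out
  have key := numN_shiftP (p := p) (K := Frob p l)
  haveI : CharP (Matrix (ZMod p) (ZMod p) (Frob p l)) p := 
    charP_of_injective_algebraMap (algebraMap (Frob p l) (Matrix (ZMod p) (ZMod p) (Frob p l))).injective p
  have hF : ∀ a : l, (Frob.mk p a • shiftP p (Frob p l)) ^ p = algebraMap l _ a := by
    intro a
    rw [smul_pow, shiftP_pow_p, ← map_pow, ← Frob.algebraMap_apply, algebraMap_smul, ← Algebra.algebraMap_eq_smul_one]
  refine ⟨?_, hF t, ?_⟩
  · simp only [U, S]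
    rw [mul_smul_comm, add_mul, key, smul_mul_assoc, smul_mul_assoc, mul_add, mul_smul_comm, smul_add, smul_add, smul_add]
    abel
  · by_cases ha : α = 0
    · simp only [U, ha, map_zero, zero_smul, add_zero, numN_pow_p, sub_self]
    · have hw : IsUnit (Frob.mk p α • shiftP p (Frob p l)) := (isUnit_pow_iff hp.ne_zero).1 (by
        rw [hF]; exact (isUnit_iff_ne_zero.2 ha).map _)
      obtain ⟨w, hw⟩ := hw
      have h4 := wp_add_one (p := p) w (numN p (Frob p l)) 1 (by simpa using hp.one_lt.ne') (by
        rw [hw, mul_smul_comm, key, smul_mul_assoc, mul_add, Nat.cast_one, mul_one])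
      simp only [U]
      rw [← hw, h4, numN_pow_p, sub_self, zero_add, hw, hF]
end symb
end

noncomputable section

section symb2
variable {p : ℕ} [Fact p.Prime] 

theorem adjoin_le_span {l R : Type} [Field l] [Ring R] [Algebra l R] {U S : R} {α t : l}
    (us : U * S = S * U + S) (sp : S ^ p = algebraMap l R t) (ua : U ^ p - U = algebraMap l R α) :
    Subalgebra.toSubmodule (Algebra.adjoin l {U, S}) ≤ Submodule.span l (Set.range fun ij : Fin p × Fin p => S ^ (ij.1 : ℕ) * U ^ (ij.2 : ℕ)) := by
  have hp : p.Prime := Fact.out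
  set V := Submodule.span l (Set.range fun ij : Fin p × Fin p => S ^ (ij.1 : ℕ) * U ^ (ij.2 : ℕ)) with hV
  have hm : ∀ i j, i < p → j < p → S ^ i * U ^ j ∈ V := fun i j hi hj =>
    Submodule.subset_span ⟨(⟨i, hi⟩, ⟨j, hj⟩), rfl⟩
  have hS : ∀ v ∈ V, S * v ∈ V := by
    intro v hv
    induction hv using Submodule.span_induction with
    | mem v hv =>
      obtain ⟨⟨⟨i, hi⟩, ⟨j, hj⟩⟩, rfl⟩ := hv
      simp only
      rw [← mul_assoc, ← pow_succ']
      by_cases h : i + 1 < p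
      · exact hm _ _ h hj
      · have : i + 1 = p := by omega
        rw [this, sp, ← Algebra.smul_def]
        have := hm 0 j hp.pos hj
        rw [pow_zero, one_mul] at this
        exact V.smul_mem _ this
    | zero => simp
    | add a b _ _ ha hb => rw [mul_add]; exact V.add_mem ha hb
    | smul c a _ ha => rw [mul_smul_comm]; exact V.smul_mem _ ha
  have hU : ∀ v ∈ V, U * v ∈ V := by
    intro v hv
    induction hv using Submodule.span_induction with
    | mem v hv =>
      obtain ⟨⟨⟨i, hi⟩, ⟨j, hj⟩⟩, rfl⟩ := hv
      simp only
      rw [← mul_assoc, shift_comm U S us, add_mul, mul_assoc, mul_assoc, ← pow_succ', ← nsmul_eq_mul]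
      refine V.add_mem ?_ (V.nsmul_mem (hm i j hi hj) _)
      by_cases h : j + 1 < p
      · exact hm _ _ hi h
      · have : j + 1 = p := by omega
        rw [this, show U ^ p = U + algebraMap l R α by rw [← ua]; abel, mul_add, ← Algebra.commutes, ← Algebra.smul_def]
        have h1 := hm i 1 hi hp.one_lt
        have h0 := hm i 0 hi hp.pos
        rw [pow_one] at h1
        rw [pow_zero, mul_one] at h0
        exact V.add_mem h1 (V.smul_mem _ h0)
    | zero => simp
    | add a b _ _ ha hb => rw [mul_add]; exact V.add_mem ha hb
    | smul c a _ ha => rw [mul_smul_comm]; exact V.smul_mem _ ha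
  have hA : ∀ a ∈ Algebra.adjoin l {U, S}, ∀ v ∈ V, a * v ∈ V := by
    intro a ha
    induction ha using Algebra.adjoin_induction with
    | mem a ha =>
      rcases ha with rfl | rfl
      · exact hU
      · exact hS
    | algebraMap c => intro v hv; rw [← Algebra.smul_def]; exact V.smul_mem _ hv
    | add a b _ _ ha hb => intro v hv; rw [add_mul]; exact V.add_mem (ha v hv) (hb v hv)
    | mul a b _ _ ha hb => intro v hv; rw [mul_assoc]; exact ha _ (hb v hv)
  intro a ha
  have h1 := hm 0 0 hp.pos hp.pos
  rw [pow_zero, pow_zero, mul_one] at h1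
  have := hA a ha 1 h1
  rwa [mul_one] at this

/-- the symbol algebra -/
theorem exists_symbol {l : Type} [Field l] [CharP l p] (α t : l) (ht : t ≠ 0) :
    ∃ (A : Type) (_ : Ring A) (_ : Algebra l A), IsCSA l A ∧ Module.finrank l A = p ^ 2 ∧ ∃ u s : A,
      u * s = s * u + s ∧ s ^ p = algebraMap l A t ∧ u ^ p - u = algebraMap l A α := by
  have hp : p.Prime := Fact.out
  obtain ⟨us, sp, ua⟩ := symbol_rel (p := p) α t
  set U := numN p (Frob p l) + Frob.mk p α • shiftP p (Frob p l) with hU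
  set S := Frob.mk p t • shiftP p (Frob p l) with hS
  let A := Algebra.adjoin l {U, S}
  have hUA : U ∈ A := Algebra.subset_adjoin (by simp)
  have hSA : S ∈ A := Algebra.subset_adjoin (by simp)
  have hle := adjoin_le_span us sp ua
  haveI : Module.Finite l (Submodule.span l (Set.range fun ij : Fin p × Fin p => S ^ (ij.1 : ℕ) * U ^ (ij.2 : ℕ))) :=
    FiniteDimensional.span_of_finite l (Set.finite_range _)
  have hfin : Module.Finite l A := Submodule.finiteDimensional_of_le hle
  have hdim : Module.finrank l A ≤ p ^ 2 := by
    refine (Submodule.finrank_mono hle).trans ?_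
    refine (finrank_range_le_card _).trans ?_
    simp [sq]
  have hsurj : Function.Surjective (extMap (E := Frob p l) A.val) := by
    rw [← AlgHom.range_eq_top]
    have hmem : ∀ a ∈ A, a ∈ (extMap (E := Frob p l) A.val).range := fun a ha =>
      ⟨1 ⊗ₜ ⟨a, ha⟩, by
        show extMap (E := Frob p l) A.val _ = _
        rw [extMap_tmul]; simp⟩
    have hP : shiftP p (Frob p l) ∈ (extMap (E := Frob p l) A.val).range := by
      have h0 : Frob.mk p t ≠ 0 := by simpa using ht
      have := Subalgebra.smul_mem _ (hmem S hSA) (Frob.mk p t)⁻¹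
      rwa [hS, smul_smul, inv_mul_cancel₀ h0, one_smul] at this
    refine gen_top _ ?_ hP
    have := Subalgebra.sub_mem _ (hmem U hUA) (Subalgebra.smul_mem _ hP (Frob.mk p α))
    rwa [hU, add_sub_cancel_right] at this
  have hfr : Module.finrank (Frob p l) (Matrix (ZMod p) (ZMod p) (Frob p l)) = p ^ 2 := by
    rw [finrank_matrix_self, ZMod.card]
  have h1 : Module.finrank (Frob p l) (Frob p l ⊗[l] A) = Module.finrank l A := Module.finrank_baseChange
  have h2 : p ^ 2 ≤ Module.finrank l A := by
    rw [← hfr, ← h1]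
    exact LinearMap.finrank_le_finrank_of_surjective (f := (extMap (E := Frob p l) A.val).toLinearMap) hsurj
  have h3 : Module.finrank l A = p ^ 2 := le_antisymm hdim h2
  have hinj : Function.Injective (extMap (E := Frob p l) A.val) :=
    (LinearMap.injective_iff_surjective_of_finrank_eq_finrank (f := (extMap (E := Frob p l) A.val).toLinearMap) (by rw [h1, h3, hfr])).2 hsurj
  refine ⟨A, inferInstance, inferInstance, csa_of_ext_bijective A.val ⟨hinj, hsurj⟩, h3, ⟨U, hUA⟩, ⟨S, hSA⟩, Subtype.ext us, Subtype.ext sp, Subtype.ext ua⟩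

theorem period_dvd {F A : Type} [Field F] [Ring A] [Algebra F A] (hA : IsCSA F A) {d : ℕ}
    (hd : Module.finrank F A = d ^ 2) (N : ℕ) (hN0 : 0 < N) (hN : IsSplit F (⨂[F] _ : Fin N, A)) : period F A ∣ N := by
  have hne : {n : ℕ | 0 < n ∧ IsSplit F (⨂[F] _ : Fin n, A)}.Nonempty := ⟨N, hN0, hN⟩
  have hm := Nat.sInf_mem hne
  change 0 < period F A ∧ IsSplit F (⨂[F] _ : Fin (period F A), A) at hm
  have hle : ∀ n, 0 < n → IsSplit F (⨂[F] _ : Fin n, A) → period F A ≤ n := fun n h h' => Nat.sInf_le ⟨h, h'⟩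
  generalize period F A = m at hm hle
  induction N using Nat.strong_induction_on with
  | _ N ih =>
    obtain ⟨b, rfl⟩ := Nat.exists_eq_add_of_le (hle N hN0 hN)
    have hb := sub_split hA hd hN hm.2
    rcases Nat.eq_zero_or_pos b with rfl | hb0
    · simp
    · exact (dvd_refl m).add (ih b (by omega) hb0 hb)

theorem good_of {l : Type} [Field l] [CharP l p] 
    (hBr : ∀ (B : Type) [Ring B] [Algebra l B], IsCSA l B → (∃ m : ℕ, period l B = p ^ m) → IsSplit l B)
    {t : l} (ht : ∀ c, c ^ p ≠ t) : GoodAt p t := by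
  have hp : p.Prime := Fact.out
  intro α
  have ht0 : t ≠ 0 := by rintro rfl; exact ht 0 (zero_pow hp.ne_zero)
  obtain ⟨A, _, _, hA, hd, u, s, us, sp, ua⟩ := exists_symbol (p := p) α t ht0
  have hps := pow_split (p := p) (j := 1) hA (by rw [pow_one]; exact hd)
  have hdv := period_dvd hA hd _ (by have := hp.pos; positivity) hps
  obtain ⟨m, -, hm⟩ := (Nat.dvd_prime_pow hp).1 hdv
  have hs := hBr A hA ⟨m, hm⟩
  obtain ⟨τ⟩ := hs.splitBy hd
  let f : A →ₐ[l] Module.End l (Fin p → l) := (Matrix.toLinAlgEquiv' (R := l) (n := Fin p)).toAlgHom.comp τ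
  refine good_extract (W := Fin p → l) (by simp) (f u) (f s) ht ?_ ?_ ?_
  · rw [← map_mul, us, map_add, map_mul]
  · rw [← map_pow, sp, AlgHom.commutes]
  · rw [← map_pow, ← map_sub, ua, AlgHom.commutes]
end symb2
end

noncomputable section

section levelG
open IsLocalRing Polynomial
variable (p : ℕ) [Fact p.Prime] 

/-- hereditary condition on the residue field -/
def Adm (l : Type) [Field l] : Prop := ∀ (m : Type) [Field m] [CharP m p] [Algebra l m] [FiniteDimensional l m],
  Module.finrank m (Frob p m) = p ∧ ∀ t : m, (∀ c, c ^ p ≠ t) → GoodAt p t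

theorem Adm.ext {l m : Type} [Field l] [Field m] [Algebra l m] [FiniteDimensional l m] (h : Adm p l) : Adm p m := by
  intro m' _ _ _ _
  letI : Algebra l m' := ((algebraMap m m').comp (algebraMap l m)).toAlgebra
  haveI : IsScalarTower l m m' := IsScalarTower.of_algebraMap_eq fun x => rfl
  haveI : FiniteDimensional l m' := FiniteDimensional.trans l m m'
  exact h m'

theorem Adm.of_surj {l m : Type} [Field l] [Field m] (f : l →+* m) (hf : Function.Surjective f) (h : Adm p l) : Adm p m := by
  letI := f.toAlgebra
  haveI : FiniteDimensional l m := Module.Finite.of_surjective (Algebra.linearMap l m) hf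
  exact h.ext p

theorem charP_residue (O : Type) [CommRing O] [IsLocalRing O] [CharP O p] : CharP (ResidueField O) p := by
  have hp : p.Prime := Fact.out
  obtain ⟨q, hq⟩ := CharP.exists (ResidueField O)
  have h0 : (p : ResidueField O) = 0 := by
    rw [← map_natCast (residue O), CharP.cast_eq_zero, map_zero]
  have h1 := (CharP.cast_eq_zero_iff (ResidueField O) q p).1 h0
  rcases (Nat.dvd_prime hp).1 h1 with h | h
  · subst h; exact absurd rfl (CharP.char_ne_one (ResidueField O) 1)
  · rwa [h] at hq

def gpol {O : Type} [CommRing O] (c f0 : O) : O[X] := X ^ p - C c * X - C f0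

/-- the two kinds of admissible polynomials -/
def GoodPair {O : Type} [CommRing O] [IsLocalRing O] (c f0 : O) : Prop :=
  (residue O c = 0 ∧ ∀ e, e ^ p ≠ residue O f0) ∨ (residue O c = 1 ∧ ∀ e, e ^ p - e ≠ residue O f0)

variable {p}

theorem levelG {O F : Type} [CommRing O] [IsDomain O] [IsDiscreteValuationRing O] [CharP O p] [IsAdicComplete (maximalIdeal O) O]
    [Field F] [CharP F p] [Algebra O F] [IsFractionRing O F] (hadm : Adm p (ResidueField O))
    {C : Type} [Ring C] [Algebra F C] (hC : IsCSA F C) {d : ℕ} (hd : Module.finrank F C = d ^ 2) (hsp : SplitBy F (Frob p F) C d) :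
    IsSplit F C ∨ ∃ c f0 : O, GoodPair p c f0 ∧ ∀ (E : Type) [Field E] [Algebra F E],
      (E ≃ₐ[F] AdjoinRoot ((gpol p c f0).map (algebraMap O F))) → Module.finrank F E = p → SplitBy F E C d := by
  have hp : p.Prime := Fact.out
  haveI := charP_residue p O
  obtain ⟨hd0, -⟩ := csa_form hC hd
  obtain ⟨ϖ, hϖ⟩ := IsDiscreteValuationRing.exists_irreducible O
  obtain ⟨h1, h2⟩ := hadm (ResidueField O)
  obtain ⟨t, ht⟩ := exists_not_pth h1
  have ht0 : t ≠ 0 := by rintro rfl; exact ht 0 (zero_pow hp.ne_zero)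
  obtain ⟨ft, hft⟩ := residue_surjective t
  have hk : Hk p t := hk_of h1 ht
  have hind : Ind p t := ind_of ht
  obtain ⟨b, hb⟩ := frob_basis (F := F) hϖ (f0 := ft) (by rw [hft]; exact hk) (by rw [hft]; exact hind)
  have hfr : ∀ y : F, (Frob.mk p y) ^ p = algebraMap F (Frob p F) y := fun y => by
    rw [Frob.algebraMap_apply, map_pow]
  have hft0 : algebraMap O F ft ≠ 0 := by
    intro h
    have : ft = 0 := by simpa using h
    rw [this, map_zero] at hft
    exact ht0 hft.symm
  have hϖ0 : algebraMap O F ϖ ≠ 0 := by simpa using hϖ.ne_zero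
  obtain ⟨D⟩ := exists_DD (hfr _) (hfr _) b hb
  obtain ⟨act, a, b', hst⟩ := exists_hasSt hft0 hϖ0 (hfr _) (hfr _) D hd0 hC hd hsp
  haveI : FiniteDimensional F (Frob p F) := Module.Finite.of_basis b
  have hM : Module.finrank F (Fin d → Frob p F) = d * p ^ 2 := by
    rw [Module.finrank_pi_fintype]
    simp [Module.finrank_eq_card_basis b, sq]
  haveI : Nonempty (Fin d) := ⟨⟨0, hd0⟩⟩
  haveI : Nontrivial (Module.End F (Fin d → Frob p F)) := inferInstance
  haveI : Nontrivial (Subalgebra.centralizer F (Set.range act)) := inferInstance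
  have hout := descent_main (mkRes p O F ϖ hϖ) ht0 hk (h2 t ht) hst ⟨ft, by simp, hft⟩ ⟨1, by simp, by simp⟩
  rcases hout with ⟨x, z, h⟩ | ⟨a, x, z, h, hx⟩ | ⟨M, x, b, z, g, h, hb, hg⟩
  · exact Or.inl ((outcome_split hd0 act hM h).isSplit hd0 hC hd)
  · right
    obtain ⟨f, hf, hf'⟩ := hx
    refine ⟨0, f, Or.inl ⟨by simp, by rwa [hf']⟩, ?_⟩
    intro E _ _ e hE
    obtain ⟨u, s, v, r, h⟩ := h
    refine outcome_field hd0 act hM h.z0 v r s (by rw [h.vb, map_zero]) h.vr h.rp h.vs.symm _ ?_ e hE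
    have : x = algebraMap O F f := by simpa using hf
    simp [gpol, h.sp, this]
  · right
    obtain ⟨f, hf, hf'⟩ := hb
    refine ⟨ϖ ^ (M * (p - 1)), f, ?_, ?_⟩
    · rcases hg with ⟨hM0, hg⟩ | ⟨rfl, hg⟩
      · left
        refine ⟨?_, by rwa [hf']⟩
        have hne : M * (p - 1) ≠ 0 := Nat.mul_ne_zero hM0.ne' (by have := hp.one_lt; omega)
        rw [residue_zero_iff hϖ]
        exact dvd_pow_self _ hne
      · right
        exact ⟨by simp, by rwa [hf']⟩
    · intro E _ _ e hE
      obtain ⟨u, s, v, r, h⟩ := h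
      refine outcome_field hd0 act hM h.x0 u s (algebraMap O F ϖ ^ M • v) (by rw [h.ua, map_zero]) h.us h.sp (h.uv.symm.smul_left _) _ ?_ e hE
      have hvp : v ^ p = v + algebraMap F _ b := by rw [← h.vb]; abel
      have hb : (algebraMap O F ϖ ^ M) ^ p * b = algebraMap O F f := by
        rw [hf, zpow_neg, zpow_natCast, ← pow_mul, mul_comm M p]; field_simp
      have hpw : (algebraMap O F ϖ ^ M) ^ p = (algebraMap O F ϖ ^ M) ^ (p - 1) * algebraMap O F ϖ ^ M := by
        rw [← pow_succ, Nat.sub_add_cancel hp.pos]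
      simp only [gpol, Polynomial.map_sub, Polynomial.map_mul, Polynomial.map_pow, Polynomial.map_X, Polynomial.map_C, map_sub, map_mul, map_pow, aeval_X, aeval_C]
      rw [_root_.smul_pow, hvp, smul_add, ← hb]
      rw [hpw]
      simp only [Algebra.smul_def, map_mul, map_pow, pow_mul]
      noncomm_ring
end levelG
end

noncomputable section

section irr
open IsLocalRing Polynomial
variable {p : ℕ} [hpp : Fact p.Prime]

theorem gpol_natDegree {O : Type} [CommRing O] [Nontrivial O] (c f0 : O) : (gpol p c f0).natDegree = p := by
  have h2 := hpp.out.two_le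
  unfold gpol
  rw [natDegree_sub_C, natDegree_sub_eq_left_of_natDegree_lt, natDegree_X_pow]
  rw [natDegree_X_pow]
  exact lt_of_le_of_lt ((natDegree_C_mul_le c X).trans natDegree_X_le) (by omega)

theorem gpol_monic {O : Type} [CommRing O] [Nontrivial O] (c f0 : O) : (gpol p c f0).Monic := by
  have h2 := hpp.out.two_le
  have : gpol p c f0 = X ^ p - (C c * X + C f0) := by unfold gpol; ring
  rw [this]
  apply monic_X_pow_sub
  refine (degree_add_le _ _).trans_lt (max_lt ?_ ?_)
  · refine (degree_C_mul_X_le c).trans_lt ?_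
    exact_mod_cast (by omega : 1 < p)
  · refine degree_C_le.trans_lt ?_
    exact_mod_cast (by omega : 0 < p)

theorem gpol_map {O R : Type} [CommRing O] [CommRing R] (f : O →+* R) (c f0 : O) : (gpol p c f0).map f = gpol p (f c) (f f0) := by
  simp [gpol]

theorem artin_schreier_irr {l : Type} [Field l] [CharP l p] {a : l} (ha : ∀ e, e ^ p - e ≠ a) : Irreducible (gpol p 1 a) := by
  have hm := gpol_monic (p := p) (1 : l) a
  have hdeg := gpol_natDegree (p := p) (1 : l) a
  have h2 := hpp.out.two_le
  have hne : gpol p 1 a ≠ 1 := by intro h; rw [h] at hdeg; simp at hdeg; omega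
  rw [hm.irreducible_iff_natDegree']; refine ⟨hne, ?_⟩
  intro f g hf hg hfg hmem
  rw [hdeg, Finset.mem_Ioc] at hmem
  obtain ⟨h0, h1⟩ := hmem
  let K := AlgebraicClosure l
  haveI : CharP K p := charP_of_injective_algebraMap (algebraMap l K).injective p
  have hsp : (g.map (algebraMap l K)).Splits := IsAlgClosed.splits _
  have hgm : (g.map (algebraMap l K)).Monic := hg.map _
  have hroot : ∀ x ∈ (g.map (algebraMap l K)).roots, x ^ p - x = algebraMap l K a := by
    intro x hx
    have hx' : (g.map (algebraMap l K)).eval x = 0 := (mem_roots'.1 hx).2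
    have : ((gpol p 1 a).map (algebraMap l K)).eval x = 0 := by
      rw [← hfg, Polynomial.map_mul, eval_mul, hx', mul_zero]
    rw [gpol_map] at this
    simp [gpol] at this
    rw [sub_eq_zero] at this; exact this
  have hcard : (g.map (algebraMap l K)).roots.card = g.natDegree := by
    rw [← natDegree_map (algebraMap l K)]; exact hsp.natDegree_eq_card_roots.symm
  have hpos : 0 < (g.map (algebraMap l K)).roots.card := by omega
  obtain ⟨θ, hθ⟩ := Multiset.card_pos_iff_exists_mem.1 hpos
  have hmem : ∀ x ∈ (g.map (algebraMap l K)).roots, x - θ ∈ (algebraMap l K).fieldRange := by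
    intro x hx
    have e1 := hroot x hx
    have e2 := hroot θ hθ
    have : (x - θ) ^ p = x - θ := by
      rw [sub_pow_char]; linear_combination e1 - e2
    exact (bot_le : (⊥ : Subfield K) ≤ _) ((Subfield.mem_bot_iff_pow_eq_self K p).2 this)
  have hsum : (g.map (algebraMap l K)).roots.sum ∈ (algebraMap l K).fieldRange := by
    have := hsp.nextCoeff_eq_neg_sum_roots_of_monic hgm
    rw [nextCoeff_map (algebraMap l K).injective] at this
    have e : (g.map (algebraMap l K)).roots.sum = algebraMap l K (- g.nextCoeff) := by rw [map_neg, this, neg_neg]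
    rw [e]; exact ⟨_, rfl⟩
  have hgen : ∀ s : Multiset K, (∀ x ∈ s, x - θ ∈ (algebraMap l K).fieldRange) → s.sum - s.card * θ ∈ (algebraMap l K).fieldRange := by
    intro s
    induction s using Multiset.induction_on with
    | empty => intro _; simp
    | cons a s ih =>
      intro h
      have i1 := h a (Multiset.mem_cons_self a s)
      have i2 := ih fun x hx => h x (Multiset.mem_cons_of_mem hx)
      have : (a ::ₘ s).sum - (a ::ₘ s).card * θ = (a - θ) + (s.sum - s.card * θ) := by
        simp; ring
      rw [this]; exact add_mem i1 i2
  have h3 := hgen _ hmem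
  have h4 := sub_mem hsum h3
  rw [sub_sub_cancel, hcard] at h4
  have hd : (g.natDegree : K) ≠ 0 := by
    rw [Ne, CharP.cast_eq_zero_iff K p]
    intro h; have := Nat.le_of_dvd h0 h; omega
  have h5 : θ ∈ (algebraMap l K).fieldRange := by
    have : θ = (g.natDegree : K)⁻¹ * (g.natDegree * θ) := by rw [← mul_assoc, inv_mul_cancel₀ hd, one_mul]
    rw [this]; exact mul_mem (inv_mem (natCast_mem _ _)) h4
  obtain ⟨e, he⟩ := h5
  apply ha e
  apply (algebraMap l K).injective
  rw [map_sub, map_pow, he]; exact hroot θ hθ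

theorem goodPair_irr {O : Type} [CommRing O] [IsLocalRing O] [CharP O p] {c f0 : O} (h : GoodPair p c f0) :
    Irreducible ((gpol p c f0).map (residue O)) := by
  haveI := charP_residue p O
  rw [gpol_map]
  rcases h with ⟨h1, h2⟩ | ⟨h1, h2⟩
  · rw [h1]
    have := X_pow_sub_C_irreducible_of_prime hpp.out h2
    simpa [gpol] using this
  · rw [h1]; exact artin_schreier_irr h2

end irr
end

noncomputable section

section ext
open IsLocalRing Polynomial

theorem adic_of {S : Type} [CommRing S] {x : S} (h1 : ∀ f : S, (∀ N : ℕ, x ^ N ∣ f) → f = 0)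
    (h2 : ∀ g : ℕ → S, ∃ G : S, ∀ N : ℕ, x ^ N ∣ G - ∑ n ∈ Finset.range N, x ^ n * g n) : IsAdicComplete (Ideal.span {x}) S := by
  have key : ∀ (N : ℕ) (a b : S), a ≡ b [SMOD (Ideal.span {x} ^ N • ⊤ : Submodule S S)] ↔ x ^ N ∣ a - b := by
    intro N a b
    rw [SModEq.sub_mem, Ideal.smul_top_eq_map, Ideal.span_singleton_pow]
    simp [Ideal.mem_span_singleton]
  haveI : IsHausdorff (Ideal.span {x}) S := ⟨fun f hf => h1 f fun N => by simpa using (key N f 0).1 (hf N)⟩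
  haveI : IsPrecomplete (Ideal.span {x}) S := by
    refine ⟨fun f hf => ?_⟩
    have h3 : ∀ n, ∃ g, f (n+1) - f n = x ^ n * g := fun n => by
      have := (key n _ _).1 (hf (Nat.le_succ n))
      rw [← dvd_neg, neg_sub] at this
      exact this
    choose g hg using h3
    obtain ⟨G, hG⟩ := h2 g
    refine ⟨G + f 0, fun N => (key N _ _).2 ?_⟩
    have h4 : f N - f 0 = ∑ n ∈ Finset.range N, x ^ n * g n := by
      rw [← Finset.sum_range_sub]; exact Finset.sum_congr rfl fun i _ => hg i
    have : f N - (G + f 0) = -(G - ∑ n ∈ Finset.range N, x ^ n * g n) := by rw [← h4]; ring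
    rw [this, dvd_neg]; exact hG N
  exact {}

variable {O : Type} [CommRing O] [IsDomain O] [IsDiscreteValuationRing O] {g : O[X]} (hg : g.Monic) (hi : Irreducible (g.map (residue O)))

/-- reduction map -/
def redMap (g : O[X]) : AdjoinRoot g →+* AdjoinRoot (g.map (residue O)) := AdjoinRoot.map (residue O) g _ dvd_rfl

theorem redMap_mk (g q : O[X]) : redMap g (AdjoinRoot.mk g q) = AdjoinRoot.mk _ (q.map (residue O)) := by
  have : (redMap g).comp (AdjoinRoot.mk g) = (AdjoinRoot.mk _).comp (mapRingHom (residue O)) := by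
    ext <;> simp [redMap]
  exact congrArg (fun f => f q) this

theorem redMap_surj (g : O[X]) : Function.Surjective (redMap g) := by
  intro y
  obtain ⟨q, rfl⟩ := AdjoinRoot.mk_surjective y
  obtain ⟨q', rfl⟩ := Polynomial.map_surjective _ residue_surjective q
  exact ⟨_, redMap_mk g q'⟩

theorem redMap_zero_iff (g : O[X]) {ϖ : O} (hϖ : Irreducible ϖ) (y : AdjoinRoot g) : redMap g y = 0 ↔ algebraMap O (AdjoinRoot g) ϖ ∣ y := by
  constructor
  · intro h
    obtain ⟨q, rfl⟩ := AdjoinRoot.mk_surjective y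
    rw [redMap_mk, AdjoinRoot.mk_eq_zero] at h
    obtain ⟨r, hr⟩ := h
    obtain ⟨r', rfl⟩ := Polynomial.map_surjective _ residue_surjective r
    have h2 : (q - g * r').map (residue O) = 0 := by simp [hr]
    have h3 : C ϖ ∣ q - g * r' := by
      rw [C_dvd_iff_dvd_coeff]
      intro i
      rw [← residue_zero_iff hϖ, ← coeff_map, h2, coeff_zero]
    obtain ⟨s, hs⟩ := h3
    refine ⟨AdjoinRoot.mk g s, ?_⟩
    have : q = g * r' + C ϖ * s := by rw [← hs]; ring
    rw [this]; simp
  · rintro ⟨z, rfl⟩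
    have : redMap g (algebraMap O (AdjoinRoot g) ϖ) = 0 := by
      have : residue O ϖ = 0 := by rw [residue_zero_iff hϖ]
      change redMap g (AdjoinRoot.of g ϖ) = 0
      simp [redMap, this]
    rw [map_mul, this, zero_mul]

include hg hi in
theorem ext_irr : Irreducible g := Monic.irreducible_of_irreducible_map (residue O) g hg hi

include hg hi in
theorem ext_domain : IsDomain (AdjoinRoot g) :=
  AdjoinRoot.isDomain_of_prime (UniqueFactorizationMonoid.irreducible_iff_prime.1 (ext_irr hg hi))

theorem redMap_ker (g : O[X]) {ϖ : O} (hϖ : Irreducible ϖ) : RingHom.ker (redMap g) = Ideal.span {algebraMap O (AdjoinRoot g) ϖ} := by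
  ext y; rw [RingHom.mem_ker, redMap_zero_iff g hϖ, Ideal.mem_span_singleton]

include hi in
theorem redMap_max : (RingHom.ker (redMap g)).IsMaximal := by
  haveI := Fact.mk hi
  exact RingHom.ker_isMaximal_of_surjective _ (redMap_surj g)

include hg hi in
theorem ext_local : IsLocalRing (AdjoinRoot g) := by
  obtain ⟨ϖ, hϖ⟩ := IsDiscreteValuationRing.exists_irreducible O
  haveI := hg.finite_adjoinRoot
  refine IsLocalRing.of_unique_max_ideal ⟨RingHom.ker (redMap g), redMap_max hi, ?_⟩
  intro I hI
  haveI : I.IsMaximal := hI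
  have h1 : (I.comap (algebraMap O (AdjoinRoot g))).IsMaximal := Ideal.isMaximal_comap_of_isIntegral_of_isMaximal I
  have h2 := IsLocalRing.eq_maximalIdeal h1
  have h3 : algebraMap O (AdjoinRoot g) ϖ ∈ I := by
    change ϖ ∈ I.comap (algebraMap O (AdjoinRoot g))
    rw [h2, mem_maximalIdeal]; exact hϖ.not_isUnit
  refine ((redMap_max hi).eq_of_le hI.ne_top ?_).symm
  rw [redMap_ker g hϖ, Ideal.span_singleton_le_iff_mem]; exact h3

include hi in
theorem ext_maxIdeal [IsLocalRing (AdjoinRoot g)] : maximalIdeal (AdjoinRoot g) = RingHom.ker (redMap g) :=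
  (IsLocalRing.eq_maximalIdeal (redMap_max hi)).symm

include hg hi in
theorem ext_alg_inj : Function.Injective (algebraMap O (AdjoinRoot g)) := by
  haveI := ext_domain hg hi
  have hdeg : g.degree ≠ 0 := by
    rw [← hg.degree_map (residue O)]
    exact (degree_pos_of_irreducible hi).ne'
  exact AdjoinRoot.of.injective_of_degree_ne_zero hdeg

include hg hi in
theorem ext_dvr : ∃ (_ : IsDomain (AdjoinRoot g)), IsDiscreteValuationRing (AdjoinRoot g) := by
  haveI := ext_domain hg hi
  haveI := ext_local hg hi
  haveI := hg.finite_adjoinRoot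
  haveI : IsNoetherianRing (AdjoinRoot g) := IsNoetherianRing.of_finite O _
  obtain ⟨ϖ, hϖ⟩ := IsDiscreteValuationRing.exists_irreducible O
  have h1 : maximalIdeal (AdjoinRoot g) = Ideal.span {algebraMap O (AdjoinRoot g) ϖ} := (ext_maxIdeal hi).trans (redMap_ker g hϖ)
  have hf : ¬ IsField (AdjoinRoot g) := by
    rw [isField_iff_maximalIdeal_eq, h1, Ideal.span_singleton_eq_bot, map_eq_zero_iff _ (ext_alg_inj hg hi)]
    exact hϖ.ne_zero
  have hpr : (maximalIdeal (AdjoinRoot g)).IsPrincipal := ⟨_, h1⟩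
  exact ⟨inferInstance, ((IsDiscreteValuationRing.TFAE (AdjoinRoot g) hf).out 0 4).2 hpr⟩

include hg hi in
theorem ext_complete [IsDomain (AdjoinRoot g)] [IsDiscreteValuationRing (AdjoinRoot g)] [IsAdicComplete (maximalIdeal O) O] :
    IsAdicComplete (maximalIdeal (AdjoinRoot g)) (AdjoinRoot g) := by
  obtain ⟨ϖ, hϖ⟩ := IsDiscreteValuationRing.exists_irreducible O
  have h1 : maximalIdeal (AdjoinRoot g) = Ideal.span {algebraMap O (AdjoinRoot g) ϖ} := (ext_maxIdeal hi).trans (redMap_ker g hϖ)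
  have hirr : Irreducible (algebraMap O (AdjoinRoot g) ϖ) := (IsDiscreteValuationRing.irreducible_iff_uniformizer _).2 h1
  rw [h1]
  apply adic_of (eq_zero_of_dvd_all hirr)
  intro s
  let b := (AdjoinRoot.powerBasis' hg).basis
  choose G hG using fun i => exists_limit hϖ (fun n => b.repr (s n) i)
  choose H hH using hG
  refine ⟨∑ i, G i • b i, fun N => ⟨∑ i, H i N • b i, ?_⟩⟩
  have e : ∀ n, s n = ∑ i, b.repr (s n) i • b i := fun n => (b.sum_repr _).symm
  calc _ = ∑ i, G i • b i - ∑ n ∈ Finset.range N, algebraMap O (AdjoinRoot g) ϖ ^ n * ∑ i, b.repr (s n) i • b i := by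
        congr 1; exact Finset.sum_congr rfl fun n _ => by rw [← e n]
    _ = ∑ i, (G i - ∑ n ∈ Finset.range N, ϖ ^ n * b.repr (s n) i) • b i := by
        simp_rw [sub_smul, Finset.sum_sub_distrib, Finset.sum_smul, Finset.mul_sum]
        rw [Finset.sum_comm]
        congr 1
        refine Finset.sum_congr rfl fun i _ => Finset.sum_congr rfl fun n _ => ?_
        rw [mul_smul, ← map_pow, ← Algebra.smul_def]
    _ = _ := by
        rw [← map_pow, ← Algebra.smul_def, Finset.smul_sum]
        refine Finset.sum_congr rfl fun i _ => ?_
        rw [hH i N, mul_smul]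

end ext
end

noncomputable section

section ext
open IsLocalRing Polynomial
variable {p : ℕ} [hpp : Fact p.Prime]

/-- the residue extension of `O → O'` is of the wanted kind -/
def RStep (p : ℕ) (O O' : Type) [CommRing O] [CommRing O'] [IsLocalRing O] [IsLocalRing O'] [Algebra O O'] : Prop :=
  ∃ φ : ResidueField O →+* ResidueField O', (∀ x, φ (residue O x) = residue O' (algebraMap O O' x)) ∧
    (letI := φ.toAlgebra; Module.finrank (ResidueField O) (ResidueField O') = p) ∧
    ((∀ x : ResidueField O', x ^ p ∈ φ.range) ∨ (∃ α : ResidueField O', α ∉ φ.range ∧ α ^ p - α ∈ φ.range))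

theorem finrank_toAlgebra {l K M : Type} [Field l] [CommRing K] [CommRing M] [Algebra l K] (e : K ≃+* M) :
    (letI := (e.toRingHom.comp (algebraMap l K)).toAlgebra; Module.finrank l M) = Module.finrank l K := by
  letI := (e.toRingHom.comp (algebraMap l K)).toAlgebra
  exact (LinearEquiv.finrank_eq (e.toAddEquiv.toLinearEquiv fun r x => by
    rw [Algebra.smul_def, Algebra.smul_def]; exact map_mul e _ _ : K ≃ₗ[l] M)).symm

theorem RStep.adm {O O' : Type} [CommRing O] [CommRing O'] [IsLocalRing O] [IsLocalRing O'] [Algebra O O'] (h : RStep p O O')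
    (ha : Adm p (ResidueField O)) : Adm p (ResidueField O') := by
  obtain ⟨φ, -, h1, -⟩ := h
  letI := φ.toAlgebra
  haveI : FiniteDimensional (ResidueField O) (ResidueField O') :=
    FiniteDimensional.of_finrank_pos (by rw [h1]; exact hpp.out.pos)
  exact ha.ext p

variable {O : Type} [CommRing O] [IsDomain O] [IsDiscreteValuationRing O] [CharP O p]

theorem rstep_ext {c f0 : O} (h : GoodPair p c f0) [IsLocalRing (AdjoinRoot (gpol p c f0))] : RStep p O (AdjoinRoot (gpol p c f0)) := by
  have hi := goodPair_irr h
  haveI := charP_residue p O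
  have hm : ((gpol p c f0).map (residue O)).Monic := (gpol_monic c f0).map _
  have hmap := gpol_map (p := p) (residue O) c f0
  let ε : ResidueField (AdjoinRoot (gpol p c f0)) ≃+* AdjoinRoot ((gpol p c f0).map (residue O)) :=
    (Ideal.quotEquivOfEq (ext_maxIdeal hi)).trans (RingHom.quotientKerEquivOfSurjective (redMap_surj _))
  have hε : ∀ y, ε (residue _ y) = redMap _ y := fun y => rfl
  haveI := Fact.mk hi
  have hinj : Function.Injective (algebraMap (ResidueField O) (AdjoinRoot ((gpol p c f0).map (residue O)))) := RingHom.injective _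
  haveI : CharP (AdjoinRoot ((gpol p c f0).map (residue O))) p := charP_of_injective_algebraMap hinj p
  have hmem : ∀ y, y ∈ (ε.symm.toRingHom.comp (algebraMap (ResidueField O) (AdjoinRoot ((gpol p c f0).map (residue O))))).range ↔
      ε y ∈ (algebraMap (ResidueField O) (AdjoinRoot ((gpol p c f0).map (residue O)))).range := by
    intro y
    constructor
    · rintro ⟨z, rfl⟩; exact ⟨z, by simp⟩
    · rintro ⟨z, hz⟩; exact ⟨z, by rw [RingHom.comp_apply, hz]; exact ε.symm_apply_apply y⟩
  have hroot : (AdjoinRoot.root ((gpol p c f0).map (residue O))) ^ p =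
      algebraMap (ResidueField O) _ (residue O c) * AdjoinRoot.root ((gpol p c f0).map (residue O)) + algebraMap (ResidueField O) _ (residue O f0) := by
    have := AdjoinRoot.eval₂_root ((gpol p c f0).map (residue O))
    rw [eval₂_map] at this
    unfold gpol at this ⊢
    simp only [eval₂_sub, eval₂_mul, eval₂_pow, eval₂_X, eval₂_C, RingHom.comp_apply] at this
    rw [AdjoinRoot.algebraMap_eq]
    linear_combination this
  refine ⟨ε.symm.toRingHom.comp (algebraMap _ _), ?_, ?_, ?_⟩
  · intro x
    apply ε.injective
    rw [hε]
    simp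
    exact (AdjoinRoot.map_of _ _ _ _ _).symm
  · refine (finrank_toAlgebra ε.symm).trans ?_
    rw [(AdjoinRoot.powerBasis' hm).finrank, AdjoinRoot.powerBasis'_dim, hmap, gpol_natDegree]
  · rcases h with ⟨h1, h2⟩ | ⟨h1, h2⟩
    · left
      intro x
      rw [hmem, map_pow]
      generalize ε x = y
      obtain ⟨q, rfl⟩ := AdjoinRoot.mk_surjective y
      have : ∀ q, AdjoinRoot.mk ((gpol p c f0).map (residue O)) q ^ p ∈ (algebraMap (ResidueField O) (AdjoinRoot ((gpol p c f0).map (residue O)))).range := by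
        intro q
        induction q using Polynomial.induction_on' with
        | add a b ha hb => rw [map_add, add_pow_char]; exact add_mem ha hb
        | monomial n a =>
          rw [← C_mul_X_pow_eq_monomial, map_mul, map_pow, mul_pow, AdjoinRoot.mk_X, ← pow_mul, mul_comm n p, pow_mul, hroot, h1, map_zero, zero_mul, zero_add]
          refine mul_mem (pow_mem ?_ _) (pow_mem ?_ _)
          · exact ⟨a, rfl⟩
          · exact ⟨_, rfl⟩
      exact this q
    · right
      refine ⟨ε.symm (AdjoinRoot.root _), ?_, ?_⟩
      · rw [hmem, RingEquiv.apply_symm_apply]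
        rintro ⟨e, he⟩
        apply h2 e
        apply hinj
        rw [map_sub, map_pow, he, hroot, h1, map_one]; ring
      · rw [hmem, map_sub, map_pow, RingEquiv.apply_symm_apply, hroot, h1, map_one]
        exact ⟨residue O f0, by ring⟩

theorem levelExt [IsAdicComplete (maximalIdeal O) O] {F : Type} [Field F] [CharP F p] [Algebra O F] [IsFractionRing O F] {c f0 : O} (h : GoodPair p c f0)
    (ha : Adm p (ResidueField O)) :
    ∃ (O' E : Type) (_ : CommRing O') (_ : IsDomain O') (_ : IsDiscreteValuationRing O') (_ : CharP O' p)
      (_ : IsAdicComplete (maximalIdeal O') O') (_ : Field E) (_ : CharP E p) (_ : Algebra O' E) (_ : IsFractionRing O' E)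
      (_ : Algebra O O') (_ : Algebra F E),
      (∀ x : O, algebraMap F E (algebraMap O F x) = algebraMap O' E (algebraMap O O' x)) ∧ Algebra.IsIntegral O O' ∧
      Module.finrank F E = p ∧ Nonempty (E ≃ₐ[F] AdjoinRoot ((gpol p c f0).map (algebraMap O F))) ∧ RStep p O O' ∧ Adm p (ResidueField O') := by
  have hi := goodPair_irr h
  have hg := gpol_monic (p := p) c f0
  have hgF : ((gpol p c f0).map (algebraMap O F)).Monic := hg.map _
  have hinjF : Function.Injective (algebraMap O F) := IsFractionRing.injective O F
  have hiF : Irreducible ((gpol p c f0).map (algebraMap O F)) := (hg.irreducible_iff_irreducible_map_fraction_map).1 (ext_irr hg hi)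
  haveI := Fact.mk hiF
  obtain ⟨_, _⟩ := ext_dvr hg hi
  have hcomp := ext_complete hg hi
  have hOi := ext_alg_inj hg hi
  have hr := rstep_ext h
  haveI := hg.finite_adjoinRoot
  let ι : AdjoinRoot (gpol p c f0) →+* AdjoinRoot ((gpol p c f0).map (algebraMap O F)) := AdjoinRoot.map (algebraMap O F) _ _ dvd_rfl
  have hι : ∀ q, ι (AdjoinRoot.mk _ q) = AdjoinRoot.mk _ (q.map (algebraMap O F)) := by
    intro q
    have : ι.comp (AdjoinRoot.mk _) = (AdjoinRoot.mk _).comp (mapRingHom (algebraMap O F)) := by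
      ext <;> simp [ι]
    exact congrArg (fun f => f q) this
  have hιinj : Function.Injective ι := by
    rw [injective_iff_map_eq_zero]
    intro y hy
    obtain ⟨q, rfl⟩ := AdjoinRoot.mk_surjective y
    rw [hι, AdjoinRoot.mk_eq_zero] at hy
    rw [AdjoinRoot.mk_eq_zero]
    exact (Polynomial.map_dvd_map _ hinjF hg).1 hy
  have hbase : ∀ x : O, algebraMap F (AdjoinRoot ((gpol p c f0).map (algebraMap O F))) (algebraMap O F x) = ι (algebraMap O _ x) := fun x =>
      (AdjoinRoot.map_of (algebraMap O F) (gpol p c f0) _ dvd_rfl x).symm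
  letI alg : Algebra (AdjoinRoot (gpol p c f0)) (AdjoinRoot ((gpol p c f0).map (algebraMap O F))) := ι.toAlgebra
  haveI : FaithfulSMul (AdjoinRoot (gpol p c f0)) (AdjoinRoot ((gpol p c f0).map (algebraMap O F))) :=
    (faithfulSMul_iff_algebraMap_injective _ _).2 hιinj
  have hfr : IsFractionRing (AdjoinRoot (gpol p c f0)) (AdjoinRoot ((gpol p c f0).map (algebraMap O F))) := by
    apply IsFractionRing.of_field
    intro z
    obtain ⟨q, rfl⟩ := AdjoinRoot.mk_surjective z
    obtain ⟨⟨b, hb⟩, hq⟩ := IsLocalization.integerNormalization_map_to_map (nonZeroDivisors O) q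
    refine ⟨AdjoinRoot.mk _ (IsLocalization.integerNormalization (nonZeroDivisors O) q), algebraMap O _ b, ?_⟩
    have hb0 : b ≠ 0 := nonZeroDivisors.ne_zero hb
    have hne : ι (algebraMap O (AdjoinRoot (gpol p c f0)) b) ≠ 0 := by
      rw [map_ne_zero_iff _ hιinj, map_ne_zero_iff _ hOi]; exact hb0
    change _ = ι _ / ι _
    rw [eq_div_iff hne, hι, hq, ← hbase, Algebra.smul_def, map_mul, mul_comm]
    rfl
  refine ⟨AdjoinRoot (gpol p c f0), AdjoinRoot ((gpol p c f0).map (algebraMap O F)), inferInstance, inferInstance, inferInstance,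
    charP_of_injective_algebraMap hOi p, hcomp, inferInstance,
    charP_of_injective_algebraMap (algebraMap F (AdjoinRoot ((gpol p c f0).map (algebraMap O F)))).injective p, alg, hfr, inferInstance, inferInstance,
    hbase, inferInstance, ?_, ⟨AlgEquiv.refl⟩, hr, hr.adm ha⟩
  rw [(AdjoinRoot.powerBasis' hgF).finrank, AdjoinRoot.powerBasis'_dim, gpol_map, gpol_natDegree]

end ext
end

noncomputable section

theorem csa_baseChange {F A : Type} (E : Type) [Field F] [Ring A] [Algebra F A] [Field E] [Algebra F E] (hA : IsCSA F A) : IsCSA E (E ⊗[F] A) := by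
  obtain ⟨d, hd0, hd, ⟨τ⟩⟩ := csa_exists_form hA
  haveI := hA.2.2
  haveI : NeZero d := ⟨hd0.ne'⟩
  let K := AlgebraicClosure E
  let j : AlgebraicClosure F →ₐ[F] K := IsAlgClosed.lift
  let τ1 : A →ₐ[F] Matrix (Fin d) (Fin d) K := (j.mapMatrix).comp τ
  let τ2 : E ⊗[F] A →ₐ[E] Matrix (Fin d) (Fin d) K := extMap (E := E) τ1
  refine csa_of_ext_bijective τ2 ?_
  have hdK : Module.finrank F A = Module.finrank K (Matrix (Fin d) (Fin d) K) := by
    rw [hd, finrank_matrix_self, Fintype.card_fin]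
  have hb := csa_ext_bijective (E := K) hA τ1 hdK
  have hsurj : Function.Surjective (extMap (E := K) τ2) := by
    intro y
    obtain ⟨w, rfl⟩ := hb.2 y
    induction w using TensorProduct.induction_on with
    | zero => exact ⟨0, by simp⟩
    | add a b ha hb =>
      obtain ⟨u, hu⟩ := ha
      obtain ⟨v, hv⟩ := hb
      exact ⟨u + v, by rw [map_add, map_add, hu, hv]⟩
    | tmul e a =>
      refine ⟨e ⊗ₜ (1 ⊗ₜ a), ?_⟩
      rw [extMap_tmul (E := K), extMap_tmul (E := K), extMap_tmul (E := E), one_smul]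
  refine ⟨?_, hsurj⟩
  have hfr : Module.finrank K (K ⊗[E] (E ⊗[F] A)) = Module.finrank K (Matrix (Fin d) (Fin d) K) := by
    rw [Module.finrank_baseChange, Module.finrank_baseChange, hd, finrank_matrix_self, Fintype.card_fin]
  exact (LinearMap.injective_iff_surjective_of_finrank_eq_finrank (f := (extMap (E := K) τ2).toLinearMap) hfr).2 hsurj

theorem SplitBy.trans {F E L A : Type} [Field F] [Field E] [Field L] [Ring A] [Algebra F A] [Algebra F E] [Algebra E L] [Algebra F L] [IsScalarTower F E L] {d : ℕ}
    (h : SplitBy E L (E ⊗[F] A) d) : SplitBy F L A d := by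
  obtain ⟨τ⟩ := h
  exact ⟨(τ.restrictScalars F).comp Algebra.TensorProduct.includeRight⟩

theorem residueStep_range {p : ℕ} {O O' L : Type} [CommRing O] [CommRing O'] [IsLocalRing O] [IsLocalRing O'] [Algebra O O'] [Field L]
    (f : O →+* L) (f' : O' →+* L) (hf : Function.Injective f) (hf' : Function.Injective f') (hc : ∀ x, f x = f' (algebraMap O O' x))
    (h : RStep p O O') : ResidueStep p f.range f'.range := by
  obtain ⟨φ, h1, h2, h3⟩ := h
  let e : O ≃+* f.range := RingEquiv.ofBijective f.rangeRestrict ⟨fun x y hxy => hf (congrArg Subtype.val hxy), f.rangeRestrict_surjective⟩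
  let e' : O' ≃+* f'.range := RingEquiv.ofBijective f'.rangeRestrict ⟨fun x y hxy => hf' (congrArg Subtype.val hxy), f'.rangeRestrict_surjective⟩
  have he : ∀ x, (e x : L) = f x := fun x => rfl
  have he' : ∀ x, (e' x : L) = f' x := fun x => rfl
  haveI i1 : IsLocalRing f.range := e.isLocalRing
  haveI i2 : IsLocalRing f'.range := e'.isLocalRing
  let r := IsLocalRing.ResidueField.mapEquiv e
  let r' := IsLocalRing.ResidueField.mapEquiv e'
  have hr : ∀ x, r (IsLocalRing.residue O x) = IsLocalRing.residue _ (e x) := fun x => rfl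
  have hr' : ∀ x, r' (IsLocalRing.residue O' x) = IsLocalRing.residue _ (e' x) := fun x => rfl
  let ψ := (r'.toRingHom.comp φ).comp r.symm.toRingHom
  have hψ : ∀ y, ψ (r y) = r' (φ y) := fun y => by
    change r' (φ (r.symm (r y))) = _
    rw [r.symm_apply_apply]
  have hran : ∀ y, r' y ∈ ψ.range ↔ y ∈ φ.range := by
    intro y
    constructor
    · rintro ⟨z, hz⟩; exact ⟨r.symm z, r'.injective hz⟩
    · rintro ⟨z, rfl⟩; exact ⟨r z, hψ z⟩
  refine ⟨i1, i2, ψ, ?_, ?_, ?_⟩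
  · intro x y hxy
    obtain ⟨x, rfl⟩ := e.surjective x
    obtain ⟨y, rfl⟩ := e'.surjective y
    rw [he, he', hc] at hxy
    rw [← hr, ← hr', hψ, h1, hf' hxy]
  · letI a1 := φ.toAlgebra
    letI a2 := ψ.toAlgebra
    refine Eq.trans ?_ h2
    have := Algebra.finrank_eq_of_equiv_equiv r r' (by ext y; exact (hψ y))
    exact this.symm
  · rcases h3 with h3 | ⟨α, h4, h5⟩
    · left
      intro x
      obtain ⟨x, rfl⟩ := r'.surjective x
      rw [← map_pow, hran]; exact h3 x
    · right
      refine ⟨r' α, by rwa [hran], ?_⟩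
      rw [← map_pow, ← map_sub, hran]; exact h5

/-- integral closure along a ring map -/
def icl {O L : Type} [CommRing O] [Field L] (f : O →+* L) : Subring L := letI := f.toAlgebra; (integralClosure O L).toSubring

theorem icl_eq {O O' L : Type} [CommRing O] [CommRing O'] [Field L] [Algebra O O'] [Algebra.IsIntegral O O'] (f : O →+* L) (f' : O' →+* L)
    (hc : ∀ x, f x = f' (algebraMap O O' x)) : icl f = icl f' := by
  letI := f.toAlgebra
  letI := f'.toAlgebra
  haveI : IsScalarTower O O' L := IsScalarTower.of_algebraMap_eq hc
  ext y
  change IsIntegral O y ↔ IsIntegral O' y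
  exact ⟨fun h => h.tower_top, fun h => isIntegral_trans y h⟩

theorem icl_bot {O F L : Type} [CommRing O] [IsDomain O] [IsIntegrallyClosed O] [Field F] [Algebra O F] [IsFractionRing O F] [Field L] [Algebra F L] :
    icl ((algebraMap F L).comp (algebraMap O F)) ⊓ (⊥ : IntermediateField F L).toSubfield.toSubring = ((algebraMap F L).comp (algebraMap O F)).range := by
  letI : Algebra O L := ((algebraMap F L).comp (algebraMap O F)).toAlgebra
  haveI : IsScalarTower O F L := IsScalarTower.of_algebraMap_eq fun _ => rfl
  ext y
  constructor
  · rintro ⟨h1, h2⟩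
    have h1 : IsIntegral O y := h1
    have h2 : y ∈ (⊥ : IntermediateField F L) := h2
    obtain ⟨x, rfl⟩ := IntermediateField.mem_bot.1 h2
    rw [isIntegral_algebraMap_iff (algebraMap F L).injective] at h1
    obtain ⟨z, rfl⟩ := IsIntegrallyClosed.isIntegral_iff.1 h1
    exact ⟨z, rfl⟩
  · rintro ⟨z, rfl⟩
    refine ⟨?_, ?_⟩
    · change IsIntegral O (algebraMap O L z)
      exact isIntegral_algebraMap
    · change _ ∈ (⊥ : IntermediateField F L)
      exact IntermediateField.mem_bot.2 ⟨algebraMap O F z, rfl⟩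

/-- chains of degree-`p` steps -/
def PChain (p m : ℕ) (F L : Type) [Field F] [Field L] [Algebra F L] (S : Subring L) : Prop :=
  ∃ c : Fin (m + 1) → IntermediateField F L,
        c 0 = ⊥ ∧ c (Fin.last m) = ⊤ ∧ Monotone c ∧
        (∀ i : Fin m, Module.finrank F (c i.succ) = p * Module.finrank F (c i.castSucc)) ∧
        (∀ i : Fin m, ResidueStep p (S ⊓ (c i.castSucc).toSubfield.toSubring) (S ⊓ (c i.succ).toSubfield.toSubring))

theorem PChain.cons {p m : ℕ} {F E L : Type} [Field F] [Field E] [Field L] [Algebra F E] [Algebra E L] [Algebra F L] [IsScalarTower F E L] (hp : Module.finrank F E = p)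
    (S : Subring L) (h0 : ResidueStep p (S ⊓ (⊥ : IntermediateField F L).toSubfield.toSubring) (S ⊓ (⊥ : IntermediateField E L).toSubfield.toSubring))
    (h : PChain p m E L S) : PChain p (m + 1) F L S := by
  obtain ⟨c, c0, c1, c2, c3, c4⟩ := h
  have hfr : ∀ K : IntermediateField E L, Module.finrank F (K.restrictScalars F) = p * Module.finrank E K := by
    intro K
    rw [← hp]
    exact (Module.finrank_mul_finrank F E K).symm
  refine ⟨Fin.cons ⊥ fun i => (c i).restrictScalars F, rfl, ?_, ?_, ?_, ?_⟩
  · rw [← Fin.succ_last, Fin.cons_succ, c1]; rfl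
  · intro i j hij
    induction i using Fin.cases with
    | zero => rw [Fin.cons_zero]; exact bot_le
    | succ i =>
      induction j using Fin.cases with
      | zero => exact absurd hij (by simp)
      | succ j => rw [Fin.cons_succ, Fin.cons_succ]; exact c2 (Fin.succ_le_succ_iff.1 hij)
  · intro i
    induction i using Fin.cases with
    | zero =>
      rw [Fin.cons_succ, Fin.castSucc_zero, Fin.cons_zero]
      refine (hfr _).trans ?_
      rw [c0]
      have e1 : Module.finrank E (⊥ : IntermediateField E L) = 1 := IntermediateField.finrank_bot
      have e2 : Module.finrank F (⊥ : IntermediateField F L) = 1 := IntermediateField.finrank_bot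
      rw [e1]; exact congrArg (p * ·) e2.symm
    | succ i =>
      rw [Fin.cons_succ, Fin.castSucc_succ, Fin.cons_succ]
      refine (hfr _).trans ?_
      refine Eq.trans ?_ (congrArg (p * ·) (hfr _)).symm
      exact congrArg (p * ·) (c3 i)
  · intro i
    induction i using Fin.cases with
    | zero =>
      rw [Fin.cons_succ, Fin.castSucc_zero, Fin.cons_zero, c0]
      exact h0
    | succ i =>
      rw [Fin.cons_succ, Fin.castSucc_succ, Fin.cons_succ]
      exact c4 i

theorem PChain.nil {p : ℕ} {F : Type} [Field F] (S : Subring F) : PChain p 0 F F S := by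
  refine ⟨fun _ => ⊥, rfl, ?_, fun _ _ _ => le_rfl, fun i => i.elim0, fun i => i.elim0⟩
  rw [eq_top_iff]
  intro x _
  exact IntermediateField.mem_bot.2 ⟨x, rfl⟩
end

noncomputable section

open IsLocalRing in
theorem main_tower {p : ℕ} [hpp : Fact p.Prime] (n : ℕ) : ∀ (O F : Type) [CommRing O] [IsDomain O] [IsDiscreteValuationRing O] [CharP O p]
    [IsAdicComplete (maximalIdeal O) O] [Field F] [CharP F p] [Algebra O F] [IsFractionRing O F] (hadm : Adm p (ResidueField O))
    (B : Type) [Ring B] [Algebra F B] (hB : IsCSA F B) (d : ℕ) (hd : Module.finrank F B = d ^ 2) (hs : IsSplit F (⨂[F] _ : Fin (p ^ n), B)),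
    ∃ m, m ≤ n ∧ ∃ (L : Type) (_ : Field L) (_ : Algebra F L), SplitBy F L B d ∧ Module.finrank F L = p ^ m ∧
      PChain p m F L (icl ((algebraMap F L).comp (algebraMap O F))) := by
  induction n with
  | zero =>
    intro O F _ _ _ _ _ _ _ _ _ hadm B _ _ hB d hd hs
    haveI := hB.2.2
    refine ⟨0, le_rfl, F, inferInstance, inferInstance, ?_, by simp, PChain.nil _⟩
    have h1 : Module.finrank F (⨂[F] _ : Fin (p ^ 0), B) = d ^ 2 := by
      rw [finrank_piTensor, hd]; simp
    obtain ⟨τ⟩ := hs.splitBy h1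
    exact ⟨τ.comp (PiTensorProduct.singleAlgHom (R := F) (A := fun _ : Fin (p ^ 0) => B) ⟨0, by simp⟩)⟩
  | succ n ih =>
    intro O F _ _ _ _ _ _ _ _ _ hadm B _ _ hB d hd hs
    haveI := hB.2.2
    haveI : NeZero p := ⟨hpp.out.ne_zero⟩
    have hC := csa_piTensor hB (Fin (p ^ n))
    have hCd : Module.finrank F (⨂[F] _ : Fin (p ^ n), B) = (d ^ (p ^ n)) ^ 2 := by
      rw [finrank_piTensor, hd, Fintype.card_fin, ← pow_mul, ← pow_mul, mul_comm]
    obtain ⟨e⟩ := nest_equiv (F := F) (A := B) (ι := ZMod p) (κ := Fin (p ^ n)) (N := Fin (p ^ (n + 1))) hB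
      (by rw [ZMod.card, Fintype.card_fin, Fintype.card_fin, pow_succ, mul_comm])
    have hsC : IsSplit F (⨂[F] _ : ZMod p, ⨂[F] _ : Fin (p ^ n), B) := hs.congr e.symm
    have hsp := frob_split hC hCd hsC
    rcases levelG (O := O) hadm hC hCd hsp with h | ⟨c, f0, hgp, hE⟩
    · obtain ⟨m, hm, h⟩ := ih O F hadm B hB d hd h
      exact ⟨m, by omega, h⟩
    · obtain ⟨O', E, _, _, _, _, _, _, _, _, _, _, _, hcomp, hint, hfr, ⟨ε⟩, hstep, hadm'⟩ := levelExt (F := F) hgp hadm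
      have hsE := hE E ε hfr
      have hBE := csa_baseChange E hB
      have hsE' : IsSplit E (⨂[E] _ : Fin (p ^ n), E ⊗[F] B) := baseChange_split hB hBE hd (by rw [Fintype.card_fin]; exact hsE)
      obtain ⟨m, hm, L, _, _, hL1, hL2, hL3⟩ := ih O' E hadm' (E ⊗[F] B) hBE d (by rw [Module.finrank_baseChange, hd]) hsE'
      letI : Algebra F L := ((algebraMap E L).comp (algebraMap F E)).toAlgebra
      haveI : IsScalarTower F E L := IsScalarTower.of_algebraMap_eq fun _ => rfl
      refine ⟨m + 1, by omega, L, inferInstance, inferInstance, hL1.trans, ?_, ?_⟩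
      · rw [← Module.finrank_mul_finrank F E L, hfr, hL2, pow_succ, mul_comm]
      · have hc : ∀ x, ((algebraMap F L).comp (algebraMap O F)) x = ((algebraMap E L).comp (algebraMap O' E)) (algebraMap O O' x) := fun x =>
          congrArg (algebraMap E L) (hcomp x)
        have hi := icl_eq _ _ hc
        rw [hi]
        refine PChain.cons hfr _ ?_ hL3
        rw [icl_bot, ← hi, icl_bot]
        exact residueStep_range _ _ ((algebraMap F L).injective.comp (IsFractionRing.injective O F))
          ((algebraMap E L).injective.comp (IsFractionRing.injective O' E)) hc hstep

theorem base_adm {p : ℕ} [hpp : Fact p.Prime] {k : Type} [Field k] [CharP k p]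
    (hres : pDegree k p = p)
    (hBr : ∀ (l : Type) [Field l] [Algebra k l] [FiniteDimensional k l]
      (B : Type) [Ring B] [Algebra l B],
        IsCSA l B → (∃ m : ℕ, period l B = p ^ m) → IsSplit l B) : Adm p k := by
  intro m _ _ _ _
  refine ⟨ext_frob (k := k) (base_frob hres), fun t ht => good_of (fun B _ _ h1 h2 => hBr m B h1 h2) ht⟩

theorem split_dvd {F L Δ : Type} [Field F] [Field L] [Algebra F L] [DivisionRing Δ] [Algebra F Δ] {d : ℕ} (hd0 : 0 < d)
    (hd : Module.finrank F Δ = d ^ 2) (h : SplitBy F L Δ d) : d ∣ Module.finrank F L := by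
  obtain ⟨τ⟩ := h
  let f : Δ →ₐ[F] Module.End F (Fin d → L) :=
      { toFun := fun x => ((Matrix.toLinAlgEquiv' (τ x)) : (Fin d → L) →ₗ[L] (Fin d → L)).restrictScalars F
        map_one' := by ext; simp
        map_mul' := fun x y => by ext; simp
        map_zero' := by ext; simp
        map_add' := fun x y => by ext; simp
        commutes' := fun r => by
          ext i x j
          simp [Matrix.algebraMap_matrix_apply, Pi.single_apply]
          split_ifs <;> simp [Algebra.smul_def] }
  have h1 := division_dvd f
  have h2 : Module.finrank F (Fin d → L) = d * Module.finrank F L := by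
    rw [← Module.finrank_mul_finrank F L (Fin d → L), Module.finrank_fintype_fun_eq_card, Fintype.card_fin, mul_comm]
  rw [hd, h2, pow_two] at h1
  exact Nat.dvd_of_mul_dvd_mul_left hd0 h1

theorem division_algebra_over_laurent_series_splitting_tower
    (p : ℕ) [Fact p.Prime] (n : ℕ)
    (k : Type) [Field k] [CharP k p]
    (hres : pDegree k p = p)
    (hBr : ∀ (l : Type) [Field l] [Algebra k l] [FiniteDimensional k l]
      (B : Type) [Ring B] [Algebra l B],
        IsCSA l B → (∃ m : ℕ, period l B = p ^ m) → IsSplit l B)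
    (D : Type) [DivisionRing D] [Algebra (LaurentSeries k) D]
    (hcentral : Subalgebra.center (LaurentSeries k) D = ⊥)
    (hfin : FiniteDimensional (LaurentSeries k) D)
    (hper : period (LaurentSeries k) D = p ^ n) :
    Module.finrank (LaurentSeries k) D = (p ^ n) ^ 2 ∧
    ∃ (L : Type) (_ : Field L) (_ : Algebra (LaurentSeries k) L)
      (_ : Algebra (PowerSeries k) L)
      (_ : IsScalarTower (PowerSeries k) (LaurentSeries k) L),
      Nonempty ((L ⊗[LaurentSeries k] D) ≃ₐ[L] Matrix (Fin (p ^ n)) (Fin (p ^ n)) L) ∧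
      ∃ c : Fin (n + 1) → IntermediateField (LaurentSeries k) L,
        c 0 = ⊥ ∧ c (Fin.last n) = ⊤ ∧ Monotone c ∧
        (∀ i : Fin n,
          Module.finrank (LaurentSeries k) (c i.succ) =
            p * Module.finrank (LaurentSeries k) (c i.castSucc)) ∧
        (∀ i : Fin n,
          ResidueStep p
            ((integralClosure (PowerSeries k) L).toSubring ⊓
              (c i.castSucc).toSubfield.toSubring)
            ((integralClosure (PowerSeries k) L).toSubring ⊓
              (c i.succ).toSubfield.toSubring)) := by
  have hp : p.Prime := Fact.out
  have hD : IsCSA (LaurentSeries k) D := ⟨hcentral, inferInstance, hfin⟩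
  obtain ⟨d, hd0, hd, -⟩ := csa_exists_form hD
  have hmem : ∀ N, 0 < N → IsSplit (LaurentSeries k) (⨂[LaurentSeries k] _ : Fin N, D) → p ^ n ≤ N := by
    intro N h0 h1
    refine hper.symm.le.trans (Nat.sInf_le ⟨h0, h1⟩)
  have hs : IsSplit (LaurentSeries k) (⨂[LaurentSeries k] _ : Fin (p ^ n), D) := by
    have hne : {n : ℕ | 0 < n ∧ IsSplit (LaurentSeries k) (⨂[LaurentSeries k] _ : Fin n, D)}.Nonempty := by
      by_contra h
      rw [Set.not_nonempty_iff_eq_empty] at h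
      have h1 := hper
      unfold period at h1
      rw [h, Nat.sInf_empty] at h1
      exact (pow_pos hp.pos n).ne h1
    have := Nat.sInf_mem hne
    have h2 := this.2
    have h3 := hper
    unfold period at h3
    rwa [h3] at h2
  haveI : CharP (PowerSeries k) p := charP_of_injective_algebraMap (algebraMap k (PowerSeries k)).injective p
  haveI : CharP (LaurentSeries k) p := charP_of_injective_algebraMap (algebraMap k (LaurentSeries k)).injective p
  haveI : IsAdicComplete (IsLocalRing.maximalIdeal (PowerSeries k)) (PowerSeries k) := by
    rw [PowerSeries.maximalIdeal_eq_span_X]; infer_instance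
  have hadm : Adm p (IsLocalRing.ResidueField (PowerSeries k)) :=
    (base_adm hres hBr).of_surj p (PowerSeries.residueFieldOfPowerSeries (k := k)).symm.toRingHom (RingEquiv.surjective _)
  obtain ⟨m, hmn, L, _, _, hL1, hL2, hL3⟩ := main_tower n (PowerSeries k) (LaurentSeries k) hadm D hD d hd hs
  have hdvd : d ∣ p ^ m := by
    have := split_dvd hd0 hd hL1
    rwa [hL2] at this
  obtain ⟨j, hj, rfl⟩ := (Nat.dvd_prime_pow hp).1 hdvd
  have h1 := hmem _ (pow_pos hp.pos j) (pow_split hD hd)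
  have h2 : n ≤ j := (Nat.pow_le_pow_iff_right hp.one_lt).1 h1
  obtain rfl : m = n := by omega
  obtain rfl : j = m := by omega
  refine ⟨hd, L, inferInstance, inferInstance, ((algebraMap (LaurentSeries k) L).comp (algebraMap (PowerSeries k) (LaurentSeries k))).toAlgebra,
    ?_, ?_, hL3⟩
  · letI : Algebra (PowerSeries k) L := ((algebraMap (LaurentSeries k) L).comp (algebraMap (PowerSeries k) (LaurentSeries k))).toAlgebra
    exact IsScalarTower.of_algebraMap_eq fun _ => rfl
  · obtain ⟨τ⟩ := hL1
    haveI : NeZero (p ^ j) := ⟨hd0.ne'⟩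
    exact csa_ext_equiv hD τ (by rw [hd, finrank_matrix_self, Fintype.card_fin])
end
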